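/- Let G be a finite nilpotent group. Then G is filled if and only if G is an elementary abelian 2-group or one of C₃, C₅, D₈, D₈ × C₂, D₈ ∗ Q₈, or (D₈ ∗ Q₈) × C₂. -/

import Mathlib

open Pointwise

/-- `S` is product-free if `S ∩ SS = ∅`. -/
def ProductFree {G : Type*} [Group G] (S : Set G) : Prop :=
  Disjoint S (S * S)

/-- `S` is locally maximal product-free if it is product-free and not properly
contained in any product-free set. -/
def LocallyMaximalPF {G : Type*} [Group G] (S : Set G) : Prop :=
  ProductFree S ∧ ∀ T : Set G, ProductFree T → S ⊆ T → S = T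

/-- `S` fills `G` (is complete) if every non-identity element lies in `S ∪ SS`. -/
def Fills {G : Type*} [Group G] (S : Set G) : Prop :=
  ∀ g : G, g ≠ 1 → g ∈ S ∪ S * S

/-- `G` is filled if every locally maximal product-free set fills `G`. -/
def Filled (G : Type*) [Group G] : Prop :=
  ∀ S : Set G, LocallyMaximalPF S → Fills S


/-- The central element used to form the central product `D₈ ∗ Q₈`. -/
def d8q8Center : Subgroup (DihedralGroup 4 × QuaternionGroup 2) :=
  Subgroup.zpowers (DihedralGroup.r 2, QuaternionGroup.a 2)

instance : d8q8Center.Normal := by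
  constructor
  intro n hn g
  obtain ⟨k, rfl⟩ := hn
  have hc : ∀ h : DihedralGroup 4 × QuaternionGroup 2,
      h * (DihedralGroup.r 2, QuaternionGroup.a 2) =
        (DihedralGroup.r 2, QuaternionGroup.a 2) * h := by decide
  have hcm := (show Commute g (DihedralGroup.r 2, QuaternionGroup.a 2) from hc g).zpow_right k
  exact Subgroup.mem_zpowers_iff.mpr
    ⟨k, by rw [hcm.eq, mul_assoc, mul_inv_cancel, mul_one]⟩

/-- The central product `D₈ ∗ Q₈`, an extraspecial group of order 32. -/
def D8Q8 : Type := (DihedralGroup 4 × QuaternionGroup 2) ⧸ d8q8Center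

instance : Group D8Q8 := QuotientGroup.Quotient.group d8q8Center


open Pointwise

section basics
variable {G : Type*} [Group G]

lemma pf_iff (S : Set G) : ProductFree S ↔ ∀ a ∈ S, ∀ b ∈ S, a * b ∉ S := by
  unfold ProductFree
  rw [Set.disjoint_right]
  constructor
  · intro h a ha b hb
    exact h (Set.mul_mem_mul ha hb)
  · rintro h _ ⟨a, ha, b, hb, rfl⟩
    exact h a ha b hb

lemma pf_one {S : Set G} (h : ProductFree S) : (1 : G) ∉ S := by
  rw [pf_iff] at h
  intro h1
  exact h 1 h1 1 h1 (by simpa using h1)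

lemma ext_lm [Finite G] (S0 : Set G) (h : ProductFree S0) :
    ∃ S, LocallyMaximalPF S ∧ S0 ⊆ S := by
  have hfin : {S : Set G | ProductFree S}.Finite := Set.toFinite _
  obtain ⟨S, hS, hm⟩ := hfin.exists_le_maximal (a := S0) h
  exact ⟨S, ⟨hm.1, fun T hT hST => le_antisymm hST (hm.2 hT hST)⟩, hS⟩

lemma lm_blocked {S : Set G} (hS : LocallyMaximalPF S) (h : G) (hh : h ∉ S) :
    h = 1 ∨ (∃ a ∈ S, ∃ b ∈ S, h = a * b) ∨ (∃ a ∈ S, h * a ∈ S) ∨ (∃ a ∈ S, a * h ∈ S) ∨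
      h * h ∈ S := by
  by_contra hcon
  push Not at hcon
  obtain ⟨h1, h2, h3, h4, h5⟩ := hcon
  have hpf := hS.1
  have hone := pf_one hpf
  have : ProductFree (insert h S) := by
    rw [pf_iff] at hpf ⊢
    intro a ha b hb hab
    simp only [Set.mem_insert_iff] at ha hb hab
    rcases ha with rfl | ha <;> rcases hb with rfl | hb <;> rcases hab with hab | hab
    · simp at hab; exact h1 hab
    · exact h5 hab
    · simp at hab; subst hab; exact hone hb
    · exact h3 b hb hab
    · simp at hab; subst hab; exact hone ha
    · exact h4 a ha hab
    · exact h2 a ha b hb hab.symm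
    · exact hpf a ha b hb hab
  have := hS.2 _ this (Set.subset_insert _ _)
  exact hh (this ▸ Set.mem_insert _ _)

lemma lm_of_blocked {S : Set G} (hpf : ProductFree S) (hb : ∀ h, h ∉ S →
    h = 1 ∨ (∃ a ∈ S, ∃ b ∈ S, h = a * b) ∨ (∃ a ∈ S, h * a ∈ S) ∨ (∃ a ∈ S, a * h ∈ S) ∨
      h * h ∈ S) : LocallyMaximalPF S := by
  refine ⟨hpf, fun T hT hST => le_antisymm hST ?_⟩
  intro h hhT
  by_contra hh
  have h1 := pf_one hT
  rw [pf_iff] at hT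
  rcases hb h hh with rfl | ⟨a, ha, b, hb, rfl⟩ | ⟨a, ha, hb⟩ | ⟨a, ha, hb⟩ | hb
  · exact h1 hhT
  · exact hT a (hST ha) b (hST hb) hhT
  · exact hT h hhT a (hST ha) (hST hb)
  · exact hT a (hST ha) h hhT (hST hb)
  · exact hT h hhT h hhT (hST hb)

lemma filled_of_surj {Q : Type*} [Group Q] (f : G →* Q) (hf : Function.Surjective f)
    (hG : Filled G) : Filled Q := by
  intro S hS
  have hpf := (pf_iff S).1 hS.1
  by_cases hne : S.Nonempty
  · have hLM : LocallyMaximalPF (f ⁻¹' S) := by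
      apply lm_of_blocked
      · rw [pf_iff]
        intro a ha b hb hab
        simp only [Set.mem_preimage, map_mul] at *
        exact hpf _ ha _ hb hab
      · intro h hh
        rcases lm_blocked hS (f h) hh with h1 | ⟨a, ha, b, hb, hab⟩ | ⟨a, ha, hb⟩ | ⟨a, ha, hb⟩ | hb
        · obtain ⟨s, hs⟩ := hne
          obtain ⟨s, rfl⟩ := hf s
          right; right; left
          exact ⟨s, hs, by simpa [h1] using hs⟩
        · obtain ⟨a, rfl⟩ := hf a
          right; left
          exact ⟨a, ha, a⁻¹ * h, by simpa [hab] using hb, by simp⟩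
        · obtain ⟨a, rfl⟩ := hf a
          right; right; left
          exact ⟨a, ha, by simpa using hb⟩
        · obtain ⟨a, rfl⟩ := hf a
          right; right; right; left
          exact ⟨a, ha, by simpa using hb⟩
        · right; right; right; right
          simpa using hb
    intro q hq
    obtain ⟨g, rfl⟩ := hf q
    have hg1 : g ≠ 1 := by rintro rfl; simp at hq
    rcases hG _ hLM g hg1 with h | ⟨a, ha, b, hb, hab⟩
    · left; exact h
    · right
      exact ⟨f a, ha, f b, hb, by simp [← hab]⟩
  · intro q hq
    rcases lm_blocked hS q (fun h => hne ⟨q, h⟩) with h1 | ⟨a, ha, _⟩ | ⟨a, ha, hb⟩ | ⟨a, ha, hb⟩ | hb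
    · exact absurd h1 hq
    · exact absurd ⟨a, ha⟩ hne
    · exact absurd ⟨a, ha⟩ hne
    · exact absurd ⟨a, ha⟩ hne
    · exact absurd ⟨_, hb⟩ hne

lemma filled_congr {Q : Type*} [Group Q] (e : G ≃* Q) : Filled G ↔ Filled Q :=
  ⟨filled_of_surj e.toMonoidHom e.surjective, filled_of_surj e.symm.toMonoidHom e.symm.surjective⟩

/-- Criterion used for most of the negative results. -/
theorem star [Finite G] (z : G) (hz : z * z = 1) (hz1 : z ≠ 1) (hzc : ∀ g, z * g = g * z)
    (M : G → Prop) (hM : ∀ a b, M (a * b) ↔ (M a ↔ M b)) (hMz : M z) (T0 : Set G)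
    (hT : ∀ t ∈ T0, ¬ M t) (hTz : ∀ t ∈ T0, z * t ∉ T0) (hTT : ∀ s ∈ T0, ∀ t ∈ T0, s * t ≠ z)
    (cov : ∀ m, M m → m ≠ 1 → m ≠ z → m * m ≠ z → ∃ s ∈ T0, ∃ t ∈ T0, m = s * t ∨ m * s = t ∨ s * m = t)
    (w : G) (hw : ¬ M w) (hwz : w * w = z) : ¬ Filled G := by
  intro hF
  have hM1 : M 1 := by have := hM 1 1; simpa using this
  have h1T : (1 : G) ∉ T0 := fun h => hT 1 h hM1
  have hpf : ProductFree (insert z T0) := by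
    rw [pf_iff]
    intro a ha b hb hab
    simp only [Set.mem_insert_iff] at ha hb hab
    rcases ha with rfl | ha <;> rcases hb with rfl | hb <;> rcases hab with hab | hab
    · rw [hz] at hab; exact hz1 hab.symm
    · rw [hz] at hab; exact h1T hab
    · simp at hab; subst hab; exact h1T hb
    · exact hTz b hb hab
    · simp at hab; subst hab; exact h1T ha
    · rw [← hzc] at hab; exact hTz a ha hab
    · exact hTT a ha b hb hab
    · have h1 := hT a ha; have h2 := hT b hb; have h3 := hT _ hab
      rw [hM] at h3; tauto
  obtain ⟨S, hS, hsub⟩ := ext_lm _ hpf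
  have hSpf := (pf_iff S).1 hS.1
  have hone := pf_one hS.1
  have hzS : z ∈ S := hsub (Set.mem_insert _ _)
  have hTS : ∀ t ∈ T0, t ∈ S := fun t ht => hsub (Set.mem_insert_of_mem _ ht)
  have hSM : ∀ m ∈ S, M m → m = z := by
    intro m hm hMm
    by_contra hmz
    have hm1 : m ≠ 1 := by rintro rfl; exact hone hm
    have hmm : m * m ≠ z := fun h => hSpf m hm m hm (h ▸ hzS)
    obtain ⟨s, hs, t, ht, h | h | h⟩ := cov m hMm hm1 hmz hmm
    · exact hSpf s (hTS s hs) t (hTS t ht) (h ▸ hm)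
    · exact hSpf m hm s (hTS s hs) (h ▸ hTS t ht)
    · exact hSpf s (hTS s hs) m hm (h ▸ hTS t ht)
  have hw1 : w ≠ 1 := by rintro rfl; exact hw hM1
  rcases hF S hS w hw1 with h | ⟨a, ha, b, hb, hab⟩
  · exact hSpf w h w h (hwz ▸ hzS)
  · simp only at hab
    have hab' := hw
    rw [← hab, hM] at hab'
    by_cases hMa : M a
    · have := hSM a ha hMa
      subst this
      have hb' : b = a * w := by rw [← hab, ← mul_assoc, hz, one_mul]
      have : b * b = a := by
        rw [hb']
        calc a * w * (a * w) = a * (w * a) * w := by group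
          _ = a * (a * w) * w := by rw [← hzc w]
          _ = (a * a) * (w * w) := by group
          _ = a := by rw [hz, hwz, one_mul]
      exact hSpf b hb b hb (this ▸ hzS)
    · have hMb : M b := by tauto
      have := hSM b hb hMb
      subst this
      have hb' : a = w * b := by rw [← hab, mul_assoc, hz, mul_one]
      have : a * a = b := by
        rw [hb']
        calc w * b * (w * b) = w * (b * w) * b := by group
          _ = w * (w * b) * b := by rw [hzc w]
          _ = (w * w) * (b * b) := by group
          _ = b := by rw [hz, hwz, mul_one]
      exact hSpf a ha a ha (this ▸ hzS)

lemma filled_exp2 (h : ∀ g : G, g ^ 2 = 1) : Filled G := by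
  have h' : ∀ g : G, g * g = 1 := fun g => by rw [← pow_two]; exact h g
  intro S hS g hg
  by_cases hgS : g ∈ S
  · left; exact hgS
  right
  rcases lm_blocked hS g hgS with h1 | ⟨a, ha, b, hb, hab⟩ | ⟨a, ha, hb⟩ | ⟨a, ha, hb⟩ | hb
  · exact absurd h1 hg
  · exact ⟨a, ha, b, hb, hab.symm⟩
  · exact ⟨g * a, hb, a, ha, by simp [mul_assoc, h']⟩
  · exact ⟨a, ha, a * g, hb, by simp [← mul_assoc, h']⟩
  · rw [h'] at hb; exact absurd hb (pf_one hS.1)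

end basics

open Pointwise

/-- `z` is a central involution and all squares lie in `{1, z}`. -/
structure ZSq {G : Type*} [Group G] (z : G) : Prop where
  hz : z * z = 1
  hz1 : z ≠ 1
  hzc : ∀ g, z * g = g * z
  sq : ∀ g : G, g * g = 1 ∨ g * g = z

namespace ZSq
variable {G : Type*} [Group G] {z : G} (H : ZSq z)
include H

lemma inv_z : z⁻¹ = z := by
  rw [inv_eq_iff_mul_eq_one]; exact H.hz

lemma zz (g : G) : z * (z * g) = g := by rw [← mul_assoc, H.hz, one_mul]

lemma mz (a b : G) : a * (z * b) = z * (a * b) := by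
  rw [← mul_assoc, ← H.hzc, mul_assoc]

lemma mz' (a : G) : a * z = z * a := (H.hzc a).symm

lemma zne (g : G) : z * g ≠ g := by
  intro h; exact H.hz1 (by simpa using h)

lemma comm (x y : G) : x * y = y * x ∨ x * y = z * (y * x) := by
  have key : x * y = (x * x) * ((y * x) * (y * x))⁻¹ * (y * y) * (y * x) := by
    rcases H.sq y with hy | hy
    · have : y⁻¹ = y := by rw [inv_eq_iff_mul_eq_one]; exact hy
      rw [hy]
      calc x * y = x * y⁻¹ := by rw [this]
        _ = _ := by group
    · have : y⁻¹ = z * y := by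
        rw [inv_eq_iff_mul_eq_one, H.mz, hy, H.hz]
      have h2 : y⁻¹ * z = y := by rw [this, H.mz', H.zz]
      calc x * y = x * (y⁻¹ * z) := by rw [h2]
        _ = x * x * (y * x * (y * x))⁻¹ * z * (y * x) := by
          rw [mul_assoc _ z, H.hzc (y * x)]; group
        _ = _ := by rw [hy]
  rcases H.sq x with hx | hx <;> rcases H.sq y with hy | hy <;> rcases H.sq (y * x) with hw | hw <;>
    rw [hx, hy, hw] at key <;> rw [key] <;> simp [H.inv_z, H.hz]

lemma sq_z (g : G) : (z * g) * (z * g) = g * g := by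
  rw [mul_assoc, H.mz, H.zz]

lemma inv1 {g : G} (h : g * g = 1) : g⁻¹ = g := by rw [inv_eq_iff_mul_eq_one]; exact h

lemma inv2 {g : G} (h : g * g = z) : g⁻¹ = z * g := by
  rw [inv_eq_iff_mul_eq_one, H.mz, h, H.hz]

lemma comm_sq {x y : G} (h : x * y = y * x) : (x * y) * (x * y) = (x * x) * (y * y) := by
  calc x * y * (x * y) = x * (y * x) * y := by group
    _ = x * (x * y) * y := by rw [h]
    _ = _ := by group

lemma ncomm_sq {x y : G} (h : x * y = z * (y * x)) : (x * y) * (x * y) = z * ((x * x) * (y * y)) := by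
  have h' : y * x = z * (x * y) := by rw [h, H.zz]
  calc x * y * (x * y) = x * (y * x) * y := by group
    _ = x * (z * (x * y)) * y := by rw [h']
    _ = z * (x * (x * y) * y) := by rw [H.mz]; group
    _ = _ := by group

theorem fills_not (S : Set G) (hS : LocallyMaximalPF S) (hzS : z ∉ S) : Fills S := by
  have hpf := (pf_iff S).1 hS.1
  have hone := pf_one hS.1
  have prod : ∀ t ∈ S, t * t = z → ∀ x ∈ S, ∀ y ∈ S, z * t ≠ x * y := by
    intro t ht htz x hx y hy hxy
    have hzt : t = z * (x * y) := by rw [← hxy, H.zz]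
    rcases H.comm x y with h | h
    · have h2 := H.comm_sq h
      rw [← hxy, H.sq_z, htz] at h2
      rcases H.sq x with hx2 | hx2
      · rw [hx2, one_mul] at h2
        apply hpf t ht y hy
        have : t * y = x := by rw [hzt, mul_assoc, mul_assoc, ← h2, H.mz' x, H.zz]
        rwa [this]
      · apply hpf x hx t ht
        have : x * t = y := by rw [hzt, H.mz, ← mul_assoc x, hx2, H.zz]
        rwa [this]
    · rw [h, H.zz] at hzt
      exact hpf y hy x hx (hzt ▸ ht)
  have inv : ∀ t ∈ S, t⁻¹ ∈ S := by
    intro t ht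
    rcases H.sq t with htz | htz
    · rwa [H.inv1 htz]
    · rw [H.inv2 htz]
      by_contra hcon
      rcases lm_blocked hS _ hcon with h1 | ⟨a, ha, b, hb, hab⟩ | ⟨a, ha, hb⟩ | ⟨a, ha, hb⟩ | hb
      · have : t = z := by rw [← H.zz t, h1, mul_one]
        exact hzS (this ▸ ht)
      · exact prod t ht htz a ha b hb hab
      · rcases H.sq a with ha2 | ha2
        · exact prod t ht htz _ hb a ha (by rw [mul_assoc _ a a, ha2, mul_one])
        · apply hpf _ hb a ha
          rw [mul_assoc _ a a, ha2, H.mz' (z * t), H.zz]; exact ht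
      · rcases H.sq a with ha2 | ha2
        · exact prod t ht htz a ha _ hb (by rw [← mul_assoc a a, ha2, one_mul])
        · apply hpf a ha _ hb
          rw [← mul_assoc a a, ha2, H.zz]; exact ht
      · rw [H.sq_z, htz] at hb; exact hzS hb
  intro g hg
  by_cases hgS : g ∈ S
  · left; exact hgS
  right
  rcases lm_blocked hS g hgS with h1 | ⟨a, ha, b, hb, hab⟩ | ⟨a, ha, hb⟩ | ⟨a, ha, hb⟩ | hb
  · exact absurd h1 hg
  · exact ⟨a, ha, b, hb, hab.symm⟩
  · exact ⟨g * a, hb, a⁻¹, inv a ha, by simp⟩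
  · exact ⟨a⁻¹, inv a ha, a * g, hb, by simp⟩
  · rcases H.sq g with h | h <;> rw [h] at hb
    · exact absurd hb hone
    · exact absurd hb hzS

theorem filled_of
    (h1 : ∀ w, w * w = z → ∃ x y, x * x = 1 ∧ y * y = 1 ∧ w = x * y)
    (h2 : ∀ s t : G, s * s = 1 → t * t = 1 → s * t = t * s → (∃ g, s * g ≠ g * s) →
      (∃ g, t * g ≠ g * t) → ∀ g, (s * t) * g = g * (s * t))
    (h3 : ∀ t t' : G, t * t = 1 → t' * t' = 1 → (∀ g, t * g = g * t) → (∀ g, t' * g = g * t') →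
      t ≠ 1 → t ≠ z → t' ≠ 1 → t' ≠ z → t' = t ∨ t' = z * t) : Filled G := by
  intro S hS
  by_cases hzS : z ∈ S
  swap
  · exact H.fills_not S hS hzS
  have hpf := (pf_iff S).1 hS.1
  have hone := pf_one hS.1
  have hinv : ∀ s ∈ S, s * s = 1 := by
    intro s hs
    rcases H.sq s with h | h
    · exact h
    · exact absurd (h ▸ hzS) (hpf s hs s hs)
  have hzs : ∀ s ∈ S, z * s ∉ S := fun s hs => hpf z hzS s hs
  have hI : ∀ g, g ≠ 1 → g ∉ S → g * g = 1 → ∃ a ∈ S, ∃ b ∈ S, g = a * b := by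
    intro g hg hgS hgg
    rcases lm_blocked hS g hgS with h1 | h | ⟨a, ha, hb⟩ | ⟨a, ha, hb⟩ | hb
    · exact absurd h1 hg
    · exact h
    · exact ⟨_, hb, a, ha, by rw [mul_assoc, hinv a ha, mul_one]⟩
    · exact ⟨a, ha, _, hb, by rw [← mul_assoc, hinv a ha, one_mul]⟩
    · rw [hgg] at hb; exact absurd hb hone
  have hC : ∀ u, u * u = 1 → (∃ g, u * g ≠ g * u) → u ∉ S → z * u ∉ S →
      ∀ s ∈ S, ∀ t ∈ S, u = s * t → ∃ s ∈ S, ∃ t ∈ S, u = s * t ∧ (∀ g, t * g = g * t) ∧ t ≠ z := by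
    intro u hu hnc huS hzu s hs t ht hst
    have hcomm : s * t = t * s := by
      rcases H.comm s t with h | h
      · exact h
      · have := H.ncomm_sq h
        rw [← hst, hu, hinv s hs, hinv t ht] at this
        simp at this
        exact absurd this.symm H.hz1
    by_cases hsc : ∃ g, s * g ≠ g * s
    · by_cases htc : ∃ g, t * g ≠ g * t
      · obtain ⟨g, hg⟩ := hnc
        exact absurd (h2 s t (hinv s hs) (hinv t ht) hcomm hsc htc g) (by rw [← hst]; exact hg)
      · push Not at htc
        refine ⟨s, hs, t, ht, hst, htc, ?_⟩
        rintro rfl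
        apply hzu; rw [hst, hcomm, H.zz]; exact hs
    · push Not at hsc
      refine ⟨t, ht, s, hs, by rw [hst, hcomm], hsc, ?_⟩
      rintro rfl
      apply hzu; rw [hst, H.zz]; exact ht
  have key : ∀ u, u * u = 1 → (∃ g, u * g ≠ g * u) → u ∈ S ∨ z * u ∈ S := by
    intro u hu hnc
    by_contra hcon
    push Not at hcon
    obtain ⟨ha, hb⟩ := hcon
    have hu1 : u ≠ 1 := by rintro rfl; simp at hnc
    have hzu1 : z * u ≠ 1 := by
      intro h
      have : u = z := by rw [← H.zz u, h, mul_one]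
      exact ha (this ▸ hzS)
    obtain ⟨s, hs, t, ht, hst⟩ := hI u hu1 ha hu
    obtain ⟨s', hs', t', ht', hst'⟩ := hI (z * u) hzu1 hb (by rw [H.sq_z, hu])
    obtain ⟨s, hs, t, ht, hst, htc, htz⟩ := hC u hu hnc ha hb s hs t ht hst
    obtain ⟨s', hs', t', ht', hst', htc', htz'⟩ := hC (z * u) (by rw [H.sq_z, hu]) (by
      obtain ⟨g, hg⟩ := hnc
      refine ⟨g, ?_⟩
      rw [mul_assoc, H.mz]
      simpa using hg) hb (by rw [H.zz]; exact ha) s' hs' t' ht' hst'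
    have ht1 : t ≠ 1 := by rintro rfl; exact hone ht
    have ht1' : t' ≠ 1 := by rintro rfl; exact hone ht'
    rcases h3 t t' (hinv t ht) (hinv t' ht') htc htc' ht1 htz ht1' htz' with h | h
    · subst h
      rw [hst, ← mul_assoc, mul_left_inj] at hst'
      exact hzs s hs (hst' ▸ hs')
    · exact hzs t ht (h ▸ ht')
  intro g hg
  by_cases hgS : g ∈ S
  · left; exact hgS
  right
  rcases H.sq g with hgg | hgg
  · obtain ⟨a, ha, b, hb, h⟩ := hI g hg hgS hgg
    exact ⟨a, ha, b, hb, h.symm⟩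
  · obtain ⟨x, y, hx, hy, rfl⟩ := h1 g hgg
    have hxy : x * y = z * (y * x) := by
      rcases H.comm x y with h | h
      · have := H.comm_sq h
        rw [hgg, hx, hy, mul_one] at this
        exact absurd this H.hz1
      · exact h
    have hne : x * y ≠ y * x := by rw [hxy]; exact H.zne _
    rcases key x hx ⟨y, hne⟩ with hx' | hx' <;> rcases key y hy ⟨x, hne.symm⟩ with hy' | hy'
    · exact ⟨x, hx', y, hy', rfl⟩
    · exact ⟨_, hy', x, hx', by simp only [hxy]; group⟩
    · exact ⟨y, hy', _, hx', by simp only [hxy, H.mz]⟩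
    · exact ⟨_, hx', _, hy', by simp only [mul_assoc, H.mz, H.zz]⟩

end ZSq

open Pointwise

/-- Commutator exponent of a single generator against a word. -/
def Lk : List ℕ → ℕ → ℕ
  | [], _ => 0
  | k :: ks, x => (if x % 2 = 1 then k else 0) ^^^ Lk ks (x / 2)

/-- The cocycle attached to a table of squares and commutators. -/
def Bf : List (ℕ × List ℕ) → ℕ → ℕ → ℕ
  | [], _, _ => 0
  | (s, ks) :: rows, x, y =>
    (if y % 2 = 1 then (if x % 2 = 1 then s else 0) ^^^ Lk ks (x / 2) else 0) ^^^
      Bf rows (x / 2) (y / 2)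

section coords
variable {G : Type*} [Group G]

/-- The ordered product of the generators selected by the bits of `x`. -/
def Pl : List G → ℕ → G
  | [], _ => 1
  | a :: l, x => (if x % 2 = 1 then a else 1) * Pl l (x / 2)

def CommRel (Z : ℕ → G) (a : G) : List ℕ → List G → Prop
  | k :: ks, b :: l => b * a = a * b * Z k ∧ CommRel Z a ks l
  | [], [] => True
  | _, _ => False

def GRel (Z : ℕ → G) : List (ℕ × List ℕ) → List G → Prop
  | (s, ks) :: rows, a :: l => a * a = Z s ∧ CommRel Z a ks l ∧ GRel Z rows l
  | [], [] => True
  | _, _ => False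

structure ZFun (Z : ℕ → G) : Prop where
  mul : ∀ e f, Z e * Z f = Z (e ^^^ f)
  cen : ∀ e g, Z e * g = g * Z e

namespace ZFun
variable {Z : ℕ → G} (H : ZFun Z)
include H

lemma zero : Z 0 = 1 := by
  have := H.mul 0 0
  simpa using this

lemma self (e : ℕ) : Z e * Z e = 1 := by rw [H.mul, Nat.xor_self, H.zero]

lemma mv (e : ℕ) (a b : G) : a * (Z e * b) = Z e * (a * b) := by
  rw [← mul_assoc, ← H.cen, mul_assoc]

lemma comm (a : G) : ∀ (ks : List ℕ) (l : List G), CommRel Z a ks l → ∀ x,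
    Pl l x * a = a * Pl l x * Z (Lk ks x)
  | k :: ks, b :: l, h, x => by
    have ih := comm a ks l h.2 (x / 2)
    simp only [Pl, Lk]
    by_cases hx : x % 2 = 1
    · simp only [hx, if_true]
      rw [mul_assoc, ih, ← H.mul]
      calc b * (a * Pl l (x / 2) * Z (Lk ks (x / 2))) = (b * a) * Pl l (x / 2) * Z (Lk ks (x / 2)) := by group
        _ = a * b * Z k * Pl l (x / 2) * Z (Lk ks (x / 2)) := by rw [h.1]
        _ = a * b * (Z k * Pl l (x / 2)) * Z (Lk ks (x / 2)) := by group
        _ = _ := by rw [H.cen]; group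
    · simp only [hx, if_false, one_mul]
      rw [ih]; simp
  | [], [], _, x => by simp [Pl, Lk, H.zero]
  | [], _ :: _, h, _ => by simp [CommRel] at h
  | _ :: _, [], h, _ => by simp [CommRel] at h

lemma pmul : ∀ (rows : List (ℕ × List ℕ)) (l : List G), GRel Z rows l → ∀ x y,
    Pl l x * Pl l y = Pl l (x ^^^ y) * Z (Bf rows x y)
  | (s, ks) :: rows, a :: l, h, x, y => by
    have ih := pmul rows l h.2.2 (x / 2) (y / 2)
    have hc := H.comm a ks l h.2.1 (x / 2)
    have hs := h.1
    simp only [Pl, Bf]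
    rw [Nat.xor_div_two, ← H.mul]
    have hxy := @Nat.xor_mod_two_eq_one x y
    set X := Pl l (x / 2)
    set Y := Pl l (y / 2)
    set W := Pl l (x / 2 ^^^ y / 2)
    set b := Bf rows (x / 2) (y / 2)
    set k := Lk ks (x / 2)
    by_cases hx : x % 2 = 1 <;> by_cases hy : y % 2 = 1
    · have : ¬ (x ^^^ y) % 2 = 1 := by rw [hxy]; tauto
      simp only [hx, hy, this, if_true, if_false, one_mul]
      rw [← H.mul]
      calc a * X * (a * Y) = a * (X * a) * Y := by group
        _ = a * (a * X * Z k) * Y := by rw [hc]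
        _ = (a * a) * X * (Z k * Y) := by group
        _ = Z s * ((X * Y) * Z k) := by rw [hs, H.cen k]; group
        _ = Z s * (W * Z b * Z k) := by rw [ih]
        _ = (W * Z b * Z k) * Z s := by rw [H.cen]
        _ = W * (Z b * (Z k * Z s)) := by group
        _ = W * ((Z k * Z s) * Z b) := by rw [H.mul k s, H.cen]
        _ = W * (Z s * Z k * Z b) := by rw [H.cen k]
    · have : (x ^^^ y) % 2 = 1 := by rw [hxy]; tauto
      simp only [hx, hy, this, if_true, if_false, one_mul, H.zero]
      rw [mul_assoc, ih, ← mul_assoc]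
    · have : (x ^^^ y) % 2 = 1 := by rw [hxy]; tauto
      simp only [hx, hy, this, if_true, if_false, one_mul, Nat.zero_xor]
      calc X * (a * Y) = (X * a) * Y := by group
        _ = (a * X * Z k) * Y := by rw [hc]
        _ = a * X * (Z k * Y) := by group
        _ = a * ((X * Y) * Z k) := by rw [H.cen]; group
        _ = a * (W * (Z b * Z k)) := by rw [ih]; group
        _ = a * W * (Z k * Z b) := by rw [H.cen]; group
    · have : ¬ (x ^^^ y) % 2 = 1 := by rw [hxy]; tauto
      simp only [hx, hy, this, if_false, one_mul, H.zero]
      rw [ih]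
  | [], [], _, x, y => by simp [Pl, Bf, H.zero]
  | [], _ :: _, h, _, _ => by simp [GRel] at h
  | _ :: _, [], h, _, _ => by simp [GRel] at h

omit H in
lemma p0 : ∀ l : List G, Pl l 0 = 1
  | [] => rfl
  | a :: l => by simp [Pl, p0 l]

lemma psq {rows : List (ℕ × List ℕ)} {l : List G} (hR : GRel Z rows l) (x : ℕ) :
    Pl l x * Pl l x = Z (Bf rows x x) := by
  rw [H.pmul rows l hR, Nat.xor_self, p0, one_mul]

lemma emul {rows : List (ℕ × List ℕ)} {l : List G} (hR : GRel Z rows l) (x y e f : ℕ) :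
    (Pl l x * Z e) * (Pl l y * Z f) = Pl l (x ^^^ y) * Z (e ^^^ f ^^^ Bf rows x y) := by
  calc (Pl l x * Z e) * (Pl l y * Z f) = Pl l x * (Z e * Pl l y) * Z f := by group
    _ = (Pl l x * Pl l y) * (Z e * Z f) := by rw [H.cen]; group
    _ = Pl l (x ^^^ y) * (Z (Bf rows x y) * Z (e ^^^ f)) := by
      rw [H.pmul rows l hR, H.mul]; group
    _ = _ := by rw [H.cen, H.mul]

lemma esq {rows : List (ℕ × List ℕ)} {l : List G} (hR : GRel Z rows l) (x e : ℕ) :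
    (Pl l x * Z e) * (Pl l x * Z e) = Z (Bf rows x x) := by
  rw [H.emul hR, Nat.xor_self, Nat.xor_self, p0, one_mul, Nat.zero_xor]

lemma ecomm {rows : List (ℕ × List ℕ)} {l : List G} (hR : GRel Z rows l) (x y e f : ℕ) :
    (Pl l x * Z e) * (Pl l y * Z f) = (Pl l y * Z f) * (Pl l x * Z e) ↔
      Z (Bf rows x y ^^^ Bf rows y x) = 1 := by
  rw [H.emul hR, H.emul hR, Nat.xor_comm y x, mul_right_inj, Nat.xor_comm f e, ← H.mul, ← H.mul (e ^^^ f),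
    mul_right_inj, ← H.mul]
  constructor
  · intro h; rw [h, H.self]
  · intro h
    calc Z (Bf rows x y) = Z (Bf rows x y) * Z (Bf rows y x) * Z (Bf rows y x) := by
          rw [mul_assoc, H.self, mul_one]
      _ = _ := by rw [h, one_mul]

lemma eeq {rows : List (ℕ × List ℕ)} {l : List G} (hR : GRel Z rows l) (x y e f : ℕ) :
    Pl l x * Z e = Pl l y * Z f ↔ Pl l (x ^^^ y) * Z (e ^^^ f ^^^ (Bf rows x y ^^^ Bf rows y y)) = 1 := by
  have h1 := H.emul hR x y e f
  have h2 := H.esq hR y f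
  rw [← Nat.xor_assoc, ← H.mul, ← mul_assoc, ← h1]
  constructor
  · intro h; rw [h, h2, H.self]
  · intro h
    have h3 : Pl l x * Z e * (Pl l y * Z f) = (Pl l y * Z f) * (Pl l y * Z f) := by
      rw [h2]
      calc _ = Pl l x * Z e * (Pl l y * Z f) * Z (Bf rows y y) * Z (Bf rows y y) := by
            rw [mul_assoc _ (Z _) (Z _), H.self, mul_one]
        _ = _ := by rw [h, one_mul]
    exact mul_right_cancel h3

end ZFun

/-- Two groups with the same coordinates are isomorphic. -/
theorem iso_of_coords {G' : Type*} [Group G'] {Z : ℕ → G} {Z' : ℕ → G'} (H : ZFun Z) (H' : ZFun Z')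
    (m : ℕ) (rows : List (ℕ × List ℕ)) (l : List G) (l' : List G') (hR : GRel Z rows l)
    (hR' : GRel Z' rows l') (hs : ∀ g : G, ∃ x < 2 ^ m, ∃ e, g = Pl l x * Z e)
    (hs' : ∀ g : G', ∃ x < 2 ^ m, ∃ e, g = Pl l' x * Z' e)
    (hk : ∀ x < 2 ^ m, ∀ e, Pl l x * Z e = 1 ↔ Pl l' x * Z' e = 1) : Nonempty (G ≃* G') := by
  choose f hf e he using hs
  have hwd : ∀ x < 2 ^ m, ∀ y < 2 ^ m, ∀ e e', Pl l x * Z e = Pl l y * Z e' ↔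
      Pl l' x * Z' e = Pl l' y * Z' e' := by
    intro x hx y hy e e'
    rw [H.eeq hR, H'.eeq hR', hk _ (Nat.xor_lt_two_pow hx hy)]
  let φ : G →* G' := MonoidHom.mk' (fun g => Pl l' (f g) * Z' (e g)) (by
    intro a b
    rw [H'.emul hR', ← hwd _ (hf _) _ (Nat.xor_lt_two_pow (hf _) (hf _)), ← he, ← H.emul hR, ← he, ← he])
  refine ⟨MulEquiv.ofBijective φ ⟨?_, ?_⟩⟩
  · intro a b hab
    change Pl l' (f a) * Z' (e a) = Pl l' (f b) * Z' (e b) at hab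
    rw [← hwd _ (hf _) _ (hf _), ← he, ← he] at hab
    exact hab
  · intro g
    obtain ⟨x, hx, i, hi⟩ := hs' g
    refine ⟨Pl l x * Z i, ?_⟩
    change Pl l' (f _) * Z' (e _) = g
    rw [hi, ← hwd _ (hf _) _ hx, ← he]

/-- exponent function of one central involution -/
def Z1 (z : G) (e : ℕ) : G := if e % 2 = 1 then z else 1

lemma Z1_fun {z : G} (hz : z * z = 1) (hzc : ∀ g, z * g = g * z) : ZFun (Z1 z) where
  mul e f := by
    have h := @Nat.xor_mod_two_eq_one e f
    unfold Z1
    by_cases he : e % 2 = 1 <;> by_cases hf : f % 2 = 1 <;> simp [he, hf] at h <;> simp [he, hf, h, hz]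
  cen e g := by
    unfold Z1; split_ifs <;> simp [hzc]

lemma Z1_eq_one {z : G} (hz1 : z ≠ 1) (e : ℕ) : Z1 z e = 1 ↔ e % 2 = 0 := by
  unfold Z1; split_ifs with h <;> simp [h, hz1] <;> omega

/-- exponent function of two central involutions -/
def Z2 (c n : G) (e : ℕ) : G := (if e % 2 = 1 then c else 1) * (if e / 2 % 2 = 1 then n else 1)

lemma Z2_fun {c n : G} (hc : c * c = 1) (hcc : ∀ g, c * g = g * c) (hn : n * n = 1)
    (hnc : ∀ g, n * g = g * n) : ZFun (Z2 c n) where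
  mul e f := by
    have h1 := (Z1_fun hc hcc).mul e f
    have h2 := (Z1_fun hn hnc).mul (e / 2) (f / 2)
    have h3 := (Z1_fun hn hnc).cen (e / 2) (Z1 c f)
    change (Z1 c e * Z1 n (e / 2)) * (Z1 c f * Z1 n (f / 2)) = Z1 c (e ^^^ f) * Z1 n ((e ^^^ f) / 2)
    rw [Nat.xor_div_two, ← h1, ← h2]
    calc _ = Z1 c e * (Z1 n (e / 2) * Z1 c f) * Z1 n (f / 2) := by group
      _ = _ := by rw [h3]; group
  cen e g := by
    have h1 := (Z1_fun hc hcc).cen e g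
    have h2 := (Z1_fun hn hnc).cen (e / 2) g
    change (Z1 c e * Z1 n (e / 2)) * g = g * (Z1 c e * Z1 n (e / 2))
    rw [mul_assoc, h2, ← mul_assoc, h1, mul_assoc]

def qf (rows : List (ℕ × List ℕ)) (x : ℕ) : Bool := Bf rows x x % 2 == 1
def bf (rows : List (ℕ × List ℕ)) (x y : ℕ) : Bool := (Bf rows x y ^^^ Bf rows y x) % 2 == 1

def PosCond (m : ℕ) (rows : List (ℕ × List ℕ)) : Prop :=
  (∀ v < 2 ^ m, qf rows v = true → ∃ u < 2 ^ m, qf rows u = false ∧ qf rows (u ^^^ v) = false) ∧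
  (∀ u < 2 ^ m, qf rows u = false → (∃ g < 2 ^ m, bf rows u g = true) →
    ∀ v < 2 ^ m, qf rows v = false → bf rows u v = false → (∃ g < 2 ^ m, bf rows v g = true) →
      ∀ g < 2 ^ m, bf rows (u ^^^ v) g = false) ∧
  (∀ u < 2 ^ m, u ≠ 0 → (∀ g < 2 ^ m, bf rows u g = false) →
    ∀ v < 2 ^ m, v ≠ 0 → (∀ g < 2 ^ m, bf rows v g = false) → u = v)

theorem filled_of_coords {z : G} (hz : z * z = 1) (hz1 : z ≠ 1) (hzc : ∀ g, z * g = g * z)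
    (m : ℕ) (rows : List (ℕ × List ℕ)) (l : List G) (hR : GRel (Z1 z) rows l)
    (hs : ∀ g : G, ∃ x < 2 ^ m, ∃ e, g = Pl l x * Z1 z e) (hP : PosCond m rows) : Filled G := by
  have HZ := Z1_fun hz hzc
  have h1q : ∀ x, Z1 z (Bf rows x x) = 1 ↔ qf rows x = false := by
    intro x; rw [Z1_eq_one hz1]; simp [qf]
  have hzq : ∀ x, Z1 z (Bf rows x x) = z ↔ qf rows x = true := by
    intro x; unfold Z1 qf; split_ifs with h <;> simp [h, hz1.symm]
  have hb : ∀ x y, Z1 z (Bf rows x y ^^^ Bf rows y x) = 1 ↔ bf rows x y = false := by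
    intro x y; rw [Z1_eq_one hz1]; simp [bf]
  have hzz : ∀ e, Z1 z e = 1 ∨ Z1 z e = z := by
    intro e; unfold Z1; split_ifs <;> simp
  have Hz : ZSq z := ⟨hz, hz1, hzc, by
    intro g
    obtain ⟨x, -, e, rfl⟩ := hs g
    rw [HZ.esq hR]; exact hzz _⟩
  obtain ⟨p1, p2, p3⟩ := hP
  have hcen : ∀ x e, (∀ g, (Pl l x * Z1 z e) * g = g * (Pl l x * Z1 z e)) ↔
      ∀ g < 2 ^ m, bf rows x g = false := by
    intro x e
    constructor
    · intro h g _
      have := h (Pl l g * Z1 z 0)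
      rwa [HZ.ecomm hR, hb] at this
    · intro h g
      obtain ⟨y, hy, f, rfl⟩ := hs g
      rw [HZ.ecomm hR, hb]; exact h y hy
  have hncen : ∀ x e, (∃ g, (Pl l x * Z1 z e) * g ≠ g * (Pl l x * Z1 z e)) ↔
      ∃ g < 2 ^ m, bf rows x g = true := by
    intro x e
    have := not_congr (hcen x e)
    push Not at this
    simpa using this
  apply Hz.filled_of
  · intro w hw
    obtain ⟨v, hv, e, rfl⟩ := hs w
    rw [HZ.esq hR, hzq] at hw
    obtain ⟨u, hu, hu1, hu2⟩ := p1 v hv hw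
    refine ⟨Pl l u * Z1 z (e ^^^ Bf rows u (u ^^^ v)), Pl l (u ^^^ v) * Z1 z 0, ?_, ?_, ?_⟩
    · rw [HZ.esq hR, h1q, hu1]
    · rw [HZ.esq hR, h1q, hu2]
    · rw [HZ.emul hR, ← Nat.xor_assoc, Nat.xor_self, Nat.zero_xor, Nat.xor_zero, Nat.xor_assoc, Nat.xor_self,
        Nat.xor_zero]
  · intro s t hs1 ht1 hst hsn htn
    obtain ⟨u, hu, e, rfl⟩ := hs s
    obtain ⟨v, hv, f, rfl⟩ := hs t
    rw [HZ.esq hR, h1q] at hs1 ht1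
    rw [HZ.ecomm hR, hb] at hst
    rw [hncen] at hsn htn
    rw [HZ.emul hR, hcen]
    exact p2 u hu hs1 hsn v hv ht1 hst htn
  · intro s t hs1 ht1 hsn htn s1 s2 t1 t2
    obtain ⟨u, hu, e, rfl⟩ := hs s
    obtain ⟨v, hv, f, rfl⟩ := hs t
    rw [hcen] at hsn htn
    have hu0 : u ≠ 0 := by
      rintro rfl; rw [ZFun.p0, one_mul] at s1 s2
      rcases hzz e with h | h <;> contradiction
    have hv0 : v ≠ 0 := by
      rintro rfl; rw [ZFun.p0, one_mul] at t1 t2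
      rcases hzz f with h | h <;> contradiction
    obtain rfl := p3 u hu hu0 hsn v hv hv0 htn
    rcases hzz e with h | h <;> rcases hzz f with h' | h' <;> rw [h, h']
    · left; rfl
    · right; rw [mul_one, hzc]
    · right; rw [← hzc, Hz.zz, mul_one]
    · left; rfl

end coords

def rowsD : List (ℕ × List ℕ) := [(0, [1]), (0, [])]
def rowsDC : List (ℕ × List ℕ) := [(0, [1, 0]), (0, [0]), (0, [])]
def rowsH : List (ℕ × List ℕ) := [(0, [1, 0, 0]), (0, [0, 0]), (1, [1]), (1, [])]
def rowsHC : List (ℕ × List ℕ) := [(0, [1, 0, 0, 0]), (0, [0, 0, 0]), (1, [1, 0]), (1, [0]), (0, [])]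

def posCond (m : ℕ) (rows : List (ℕ × List ℕ)) : Bool :=
  let R := List.range (2 ^ m)
  (R.all fun v => !qf rows v || R.any fun u => !qf rows u && !qf rows (u ^^^ v)) &&
  ((R.all fun u => qf rows u || (R.all fun g => !bf rows u g) ||
    R.all fun v => qf rows v || bf rows u v || (R.all fun g => !bf rows v g) ||
      R.all fun g => !bf rows (u ^^^ v) g) &&
  (R.all fun u => u == 0 || R.any (fun g => bf rows u g) ||
    R.all fun v => v == 0 || R.any (fun g => bf rows v g) || u == v))

lemma posCond_iff (m : ℕ) (rows : List (ℕ × List ℕ)) (h : posCond m rows = true) : PosCond m rows := by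
  simp only [posCond, Bool.and_eq_true, List.all_eq_true, List.any_eq_true, Bool.or_eq_true, List.mem_range,
    Bool.not_eq_true', beq_iff_eq] at h
  obtain ⟨h1, h2, h3⟩ := h
  refine ⟨?_, ?_, ?_⟩
  · intro v hv hq
    rcases h1 v hv with h | ⟨u, hu, h⟩
    · simp [hq] at h
    · exact ⟨u, hu, h⟩
  · rintro u hu hq ⟨g, hg, hgu⟩ v hv hqv hb ⟨g', hg', hgv⟩ y hy
    rcases h2 u hu with (h | h) | h
    · simp [hq] at h
    · have := h g hg; simp [hgu] at this
    · rcases h v hv with ((h | h) | h) | h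
      · simp [hqv] at h
      · simp [hb] at h
      · have := h g' hg'; simp [hgv] at this
      · exact h y hy
  · rintro u hu hu0 hq v hv hv0 hqv
    rcases h3 u hu with (h | ⟨g, hg, h⟩) | h
    · exact absurd h hu0
    · simp [hq g hg] at h
    · rcases h v hv with (h | ⟨g, hg, h⟩) | h
      · exact absurd h hv0
      · simp [hqv g hg] at h
      · exact h

lemma pos_DC : PosCond 3 rowsDC := posCond_iff _ _ (by decide +kernel)
lemma pos_HC : PosCond 5 rowsHC := posCond_iff _ _ (by decide +kernel)

open Pointwise

section coordgroups
variable {G : Type*} [Group G]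

theorem ker_iff {z : G} (hz : z * z = 1) (hz1 : z ≠ 1) (hzc : ∀ g, z * g = g * z)
    (m : ℕ) (rows : List (ℕ × List ℕ)) (l : List G) (hR : GRel (Z1 z) rows l) (r : ℕ)
    (hr : r ≠ 0 → Pl l r ≠ 1 ∧ Pl l r ≠ z)
    (hnd : ∀ x < 2 ^ m, x ≠ 0 → x = r ∨ ∃ y < 2 ^ m, bf rows x y = true) :
    ∀ x < 2 ^ m, ∀ e, Pl l x * Z1 z e = 1 ↔ x = 0 ∧ e % 2 = 0 := by
  intro x hx e
  have HZ := Z1_fun hz hzc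
  constructor
  · intro h
    have hx0 : x = 0 := by
      by_contra hx0
      rcases hnd x hx hx0 with rfl | ⟨y, hy, hxy⟩
      · obtain ⟨h1, h2⟩ := hr hx0
        unfold Z1 at h
        split_ifs at h
        · apply h2
          calc Pl l x = Pl l x * z * z := by rw [mul_assoc, hz, mul_one]
            _ = z := by rw [h, one_mul]
        · exact h1 (by simpa using h)
      · have := (HZ.ecomm hR x y e 0).1 (by rw [h]; simp)
        rw [Z1_eq_one hz1] at this
        simp [bf, this] at hxy
    subst hx0
    refine ⟨rfl, ?_⟩
    rw [ZFun.p0, one_mul, Z1_eq_one hz1] at h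
    exact h
  · rintro ⟨rfl, he⟩
    rw [ZFun.p0, one_mul, Z1_eq_one hz1]; exact he

/-- `G` has the coordinates given by `rows` -/
def Coord (G : Type*) [Group G] (m : ℕ) (rows : List (ℕ × List ℕ)) (r : ℕ) : Prop :=
  ∃ (z : G) (l : List G), z * z = 1 ∧ z ≠ 1 ∧ (∀ g, z * g = g * z) ∧ GRel (Z1 z) rows l ∧
    (∀ g : G, ∃ x < 2 ^ m, ∃ e, g = Pl l x * Z1 z e) ∧ (r ≠ 0 → Pl l r ≠ 1 ∧ Pl l r ≠ z)

theorem Coord.filled {m : ℕ} {rows : List (ℕ × List ℕ)} {r : ℕ} (h : Coord G m rows r)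
    (hP : PosCond m rows) : Filled G := by
  obtain ⟨z, l, hz, hz1, hzc, hR, hs, -⟩ := h
  exact filled_of_coords hz hz1 hzc m rows l hR hs hP

theorem Coord.iso {G' : Type*} [Group G'] {m : ℕ} {rows : List (ℕ × List ℕ)} {r : ℕ}
    (hnd : ∀ x < 2 ^ m, x ≠ 0 → x = r ∨ ∃ y < 2 ^ m, bf rows x y = true)
    (h : Coord G m rows r) (h' : Coord G' m rows r) : Nonempty (G ≃* G') := by
  obtain ⟨z, l, hz, hz1, hzc, hR, hs, hr⟩ := h
  obtain ⟨z', l', hz', hz1', hzc', hR', hs', hr'⟩ := h'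
  refine iso_of_coords (Z1_fun hz hzc) (Z1_fun hz' hzc') m rows l l' hR hR' hs hs' ?_
  intro x hx e
  rw [ker_iff hz hz1 hzc m rows l hR r hr hnd x hx, ker_iff hz' hz1' hzc' m rows l' hR' r hr' hnd x hx]

def codeMap (m : ℕ) (z : G) (l : List G) (p : Fin (2 ^ m) × Fin 2) : G := Pl l p.1 * Z1 z p.2

lemma codeMap_surj {m : ℕ} {z : G} {l : List G} (hs : ∀ g : G, ∃ x < 2 ^ m, ∃ e, g = Pl l x * Z1 z e) :
    Function.Surjective (codeMap m z l) := by
  intro g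
  obtain ⟨x, hx, e, rfl⟩ := hs g
  refine ⟨(⟨x, hx⟩, ⟨e % 2, Nat.mod_lt _ (by norm_num)⟩), ?_⟩
  simp [codeMap, Z1]

lemma sum_countP (p : ℕ → Bool) : ∀ n : ℕ,
    ∑ i ∈ Finset.range n, (if p i = true then 1 else 0) = (List.range n).countP p
  | 0 => rfl
  | n + 1 => by
    rw [Finset.sum_range_succ, sum_countP p n, List.range_succ, List.countP_append]
    simp

lemma count_sq {m : ℕ} {rows : List (ℕ × List ℕ)} {z : G} {l : List G} (hz : z * z = 1) (hz1 : z ≠ 1)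
    (hzc : ∀ g, z * g = g * z) (hR : GRel (Z1 z) rows l) (hbij : Function.Bijective (codeMap m z l)) :
    Nat.card {g : G // g * g = 1} = ((List.range (2 ^ m)).countP fun x => !qf rows x) * 2 := by
  have HZ := Z1_fun hz hzc
  have e : {p : Fin (2 ^ m) × Fin 2 // qf rows p.1 = false} ≃ {g : G // g * g = 1} :=
    (Equiv.ofBijective _ hbij).subtypeEquiv (by
      rintro ⟨x, e⟩
      simp only [Equiv.ofBijective_apply, codeMap]
      rw [HZ.esq hR, Z1_eq_one hz1]; simp [qf])
  have e2 : {p : Fin (2 ^ m) × Fin 2 // qf rows p.1 = false} ≃ {x : Fin (2 ^ m) // qf rows x = false} × Fin 2 :=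
    { toFun := fun p => (⟨p.1.1, p.2⟩, p.1.2)
      invFun := fun p => ⟨(p.1.1, p.2), p.1.2⟩
      left_inv := fun p => rfl
      right_inv := fun p => rfl }
  rw [← Nat.card_congr e, Nat.card_congr e2, Nat.card_prod, Nat.card_eq_fintype_card,
    Nat.card_eq_fintype_card, Fintype.card_fin, Fintype.card_subtype]
  congr 1
  rw [← sum_countP, Finset.card_filter, ← Fin.sum_univ_eq_sum_range (fun i => if (!qf rows i) = true then 1 else 0)]
  simp

lemma Coord.count {m : ℕ} {rows : List (ℕ × List ℕ)} {r : ℕ}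
    (hnd : ∀ x < 2 ^ m, x ≠ 0 → x = r ∨ ∃ y < 2 ^ m, bf rows x y = true)
    (h : Coord G m rows r) : Nat.card G = 2 ^ m * 2 ∧
    Nat.card {g : G // g * g = 1} = ((List.range (2 ^ m)).countP fun x => !qf rows x) * 2 := by
  obtain ⟨z, l, hz, hz1, hzc, hR, hs, hr⟩ := h
  have HZ := Z1_fun hz hzc
  have hbij : Function.Bijective (codeMap m z l) := by
    refine ⟨?_, codeMap_surj hs⟩
    rintro ⟨x, e⟩ ⟨y, f⟩ h
    simp only [codeMap] at h
    rw [HZ.eeq hR, ker_iff hz hz1 hzc m rows l hR r hr hnd _ (Nat.xor_lt_two_pow x.2 y.2),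
      Nat.xor_eq_zero_iff] at h
    obtain ⟨h1, h2⟩ := h
    rw [h1, Nat.xor_self, Nat.xor_zero] at h2
    have hxy : x = y := Fin.ext h1
    subst hxy
    have : e = f := by
      revert h2; revert e f; decide
    rw [this]
  exact ⟨by rw [← Nat.card_congr (Equiv.ofBijective _ hbij)]; simp, count_sq hz hz1 hzc hR hbij⟩

lemma Pl_map {G' : Type*} [Group G'] (f : G →* G') : ∀ (l : List G) (x : ℕ), f (Pl l x) = Pl (l.map f) x
  | [], x => by simp [Pl]
  | a :: l, x => by
    simp only [Pl, List.map_cons, map_mul, Pl_map f l]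
    split_ifs <;> simp

lemma Z1_map {G' : Type*} [Group G'] (f : G →* G') (z : G) (e : ℕ) : f (Z1 z e) = Z1 (f z) e := by
  unfold Z1; split_ifs <;> simp

end coordgroups

lemma nd_D : ∀ x < 2 ^ 2, x ≠ 0 → x = 0 ∨ ∃ y < 2 ^ 2, bf rowsD x y = true := by decide +kernel
lemma nd_DC : ∀ x < 2 ^ 3, x ≠ 0 → x = 4 ∨ ∃ y < 2 ^ 3, bf rowsDC x y = true := by decide +kernel
lemma nd_H : ∀ x < 2 ^ 4, x ≠ 0 → x = 0 ∨ ∃ y < 2 ^ 4, bf rowsH x y = true := by decide +kernel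
lemma nd_HC : ∀ x < 2 ^ 5, x ≠ 0 → x = 16 ∨ ∃ y < 2 ^ 5, bf rowsHC x y = true := by decide +kernel

section concrete
open DihedralGroup

lemma coord_D8 : Coord (DihedralGroup 4) 2 rowsD 0 := by
  refine ⟨r 2, [sr 0, sr 1], by decide, by decide, by decide, ?_, ?_, by simp⟩
  · simp only [GRel, rowsD, CommRel]; decide
  · have : ∀ g : DihedralGroup 4, ∃ x < 2 ^ 2, ∃ e < 2, g = Pl [sr 0, sr 1] x * Z1 (r 2) e := by
      decide +kernel
    intro g
    obtain ⟨x, hx, e, -, h⟩ := this g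
    exact ⟨x, hx, e, h⟩

lemma coord_D8C : Coord (DihedralGroup 4 × Multiplicative (ZMod 2)) 3 rowsDC 4 := by
  refine ⟨(r 2, 1), [(sr 0, 1), (sr 1, 1), (1, Multiplicative.ofAdd 1)], by decide, by decide, by decide, ?_, ?_,
    fun _ => by decide⟩
  · simp only [GRel, rowsDC, CommRel]; decide
  · have : ∀ g : DihedralGroup 4 × Multiplicative (ZMod 2), ∃ x < 2 ^ 3, ∃ e < 2,
        g = Pl [(sr 0, 1), (sr 1, 1), (1, Multiplicative.ofAdd 1)] x * Z1 (r 2, 1) e := by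
      decide +kernel
    intro g
    obtain ⟨x, hx, e, -, h⟩ := this g
    exact ⟨x, hx, e, h⟩

abbrev DQ := DihedralGroup 4 × QuaternionGroup 2
def mkq : DQ →* D8Q8 := QuotientGroup.mk' d8q8Center

lemma mkq_surj : Function.Surjective mkq := QuotientGroup.mk'_surjective _

lemma mkq_eq (g h : DQ) : mkq g = mkq h ↔ (g = h ∨ h = g * (r 2, QuaternionGroup.a 2)) := by
  have h1 : mkq g = mkq h ↔ g⁻¹ * h ∈ d8q8Center := QuotientGroup.eq
  have hsq : ((r 2, QuaternionGroup.a 2) : DQ) ^ 2 = 1 := by decide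
  rw [h1]
  constructor
  · rintro ⟨k, hk⟩
    simp only at hk
    rcases Int.even_or_odd' k with ⟨j, rfl | rfl⟩
    · left
      rw [zpow_mul] at hk
      norm_cast at hk
      rw [hsq, one_zpow, eq_comm, inv_mul_eq_one] at hk
      exact hk
    · right
      rw [zpow_add, zpow_mul, zpow_one] at hk
      norm_cast at hk
      rw [hsq, one_zpow, one_mul] at hk
      rw [hk]; group
  · rintro (rfl | rfl)
    · simp [one_mem]
    · rw [inv_mul_cancel_left]; exact Subgroup.mem_zpowers _

def lH0 : List DQ := [(sr 0, 1), (sr 1, 1), (1, QuaternionGroup.a 1), (1, QuaternionGroup.xa 0)]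

lemma surj_H : ∀ g : D8Q8, ∃ x < 2 ^ 4, ∃ e, g = Pl (lH0.map mkq) x * Z1 (mkq (r 2, 1)) e := by
  have : ∀ d : DihedralGroup 4, ∀ q : QuaternionGroup 2, ∃ x < 2 ^ 4, ∃ e < 2,
      ((d, q) : DQ) = Pl lH0 x * Z1 (r 2, 1) e ∨
        Pl lH0 x * Z1 (r 2, 1) e = ((d, q) : DQ) * (r 2, QuaternionGroup.a 2) := by
    decide +kernel
  intro g
  obtain ⟨⟨d, q⟩, rfl⟩ := mkq_surj g
  obtain ⟨x, hx, e, -, h⟩ := this d q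
  refine ⟨x, hx, e, ?_⟩
  rw [← Pl_map, ← Z1_map, ← map_mul, mkq_eq]
  exact h

lemma coord_H : Coord D8Q8 4 rowsH 0 := by
  refine ⟨mkq (r 2, 1), lH0.map mkq, ?_, ?_, ?_, ?_, surj_H, by simp⟩
  · rw [← map_mul, ← map_one mkq, mkq_eq]; decide
  · rw [← map_one mkq, Ne, mkq_eq]; decide
  · intro g
    obtain ⟨g, rfl⟩ := mkq_surj g
    rw [← map_mul, ← map_mul, mkq_eq]; left; revert g; decide
  · simp only [GRel, rowsH, CommRel, lH0, List.map, ← map_mul, ← Z1_map, mkq_eq]; decide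

abbrev DQC := DQ × Multiplicative (ZMod 2)
def mkqc : DQC →* D8Q8 × Multiplicative (ZMod 2) := mkq.prodMap (MonoidHom.id _)

lemma mkqc_surj : Function.Surjective mkqc := mkq_surj.prodMap Function.surjective_id

lemma mkqc_eq (g h : DQC) : mkqc g = mkqc h ↔
    ((g.1 = h.1 ∨ h.1 = g.1 * (r 2, QuaternionGroup.a 2)) ∧ g.2 = h.2) := by
  rw [Prod.ext_iff, ← mkq_eq]; rfl

def lHC0 : List DQC := [((sr 0, 1), 1), ((sr 1, 1), 1), ((1, QuaternionGroup.a 1), 1),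
  ((1, QuaternionGroup.xa 0), 1), ((1, 1), Multiplicative.ofAdd 1)]

lemma surj_HC : ∀ g : D8Q8 × Multiplicative (ZMod 2), ∃ x < 2 ^ 5, ∃ e,
    g = Pl (lHC0.map mkqc) x * Z1 (mkqc ((r 2, 1), 1)) e := by
  have : ∀ d : DihedralGroup 4, ∀ q : QuaternionGroup 2, ∀ c : Multiplicative (ZMod 2),
      ∃ x < 2 ^ 5, ∃ e < 2,
      ((((d, q) : DQ) = (Pl lHC0 x * Z1 ((r 2, 1), 1) e).1 ∨
        (Pl lHC0 x * Z1 ((r 2, 1), 1) e).1 = ((d, q) : DQ) * (r 2, QuaternionGroup.a 2)) ∧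
        c = (Pl lHC0 x * Z1 ((r 2, 1), 1) e).2) := by
    decide +kernel
  intro g
  obtain ⟨⟨⟨d, q⟩, c⟩, rfl⟩ := mkqc_surj g
  obtain ⟨x, hx, e, -, h⟩ := this d q c
  refine ⟨x, hx, e, ?_⟩
  rw [← Pl_map, ← Z1_map, ← map_mul, mkqc_eq]
  exact h

lemma coord_HC : Coord (D8Q8 × Multiplicative (ZMod 2)) 5 rowsHC 16 := by
  refine ⟨mkqc ((r 2, 1), 1), lHC0.map mkqc, ?_, ?_, ?_, ?_, surj_HC, fun _ => ⟨?_, ?_⟩⟩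
  · rw [← map_mul, ← map_one mkqc, mkqc_eq]; decide
  · rw [← map_one mkqc, Ne, mkqc_eq]; decide
  · intro g
    obtain ⟨⟨g, c⟩, rfl⟩ := mkqc_surj g
    rw [← map_mul, ← map_mul, mkqc_eq]
    refine ⟨?_, mul_comm _ _⟩
    left; revert g; simp only [Prod.fst_mul]; decide
  · simp only [GRel, rowsHC, CommRel, lHC0, List.map, ← map_mul, ← Z1_map, mkqc_eq, and_true]
    refine ⟨?_, ⟨?_, ?_, ?_, ?_⟩, ?_, ⟨?_, ?_, ?_⟩, ?_, ⟨?_, ?_⟩, ?_, ?_, ?_⟩ <;> decide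
  · rw [← map_one mkqc, ← Pl_map, Ne, mkqc_eq]; decide
  · rw [← Pl_map, Ne, mkqc_eq]; decide

lemma filled_HC : Filled (D8Q8 × Multiplicative (ZMod 2)) := coord_HC.filled pos_HC
lemma filled_H : Filled D8Q8 := filled_of_surj (MonoidHom.fst _ _) Prod.fst_surjective filled_HC
lemma filled_DC : Filled (DihedralGroup 4 × Multiplicative (ZMod 2)) := coord_D8C.filled pos_DC
lemma filled_D : Filled (DihedralGroup 4) := filled_of_surj (MonoidHom.fst _ _) Prod.fst_surjective filled_DC

lemma count_H : Nat.card D8Q8 = 32 ∧ Nat.card {g : D8Q8 // g * g = 1} = 12 := by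
  have := coord_H.count nd_H
  have h : ((List.range (2 ^ 4)).countP fun x => !qf rowsH x) = 6 := by decide +kernel
  rwa [h] at this

lemma count_HC : Nat.card (D8Q8 × Multiplicative (ZMod 2)) = 64 ∧
    Nat.card {g : D8Q8 × Multiplicative (ZMod 2) // g * g = 1} = 24 := by
  have := coord_HC.count nd_HC
  have h : ((List.range (2 ^ 5)).countP fun x => !qf rowsHC x) = 12 := by decide +kernel
  rwa [h] at this

lemma count_D : Nat.card (DihedralGroup 4) = 8 := (coord_D8.count nd_D).1
lemma count_DC : Nat.card (DihedralGroup 4 × Multiplicative (ZMod 2)) = 16 := (coord_D8C.count nd_DC).1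
end concrete

open Pointwise

lemma exists_half {G : Type*} [Group G] [Finite G] {z : G} (hz : z * z = 1) (hz1 : z ≠ 1) :
    ∃ R : G → Prop, R 1 ∧ ∀ g, R (z * g) ↔ ¬ R g := by
  obtain ⟨n, ⟨f⟩⟩ := Finite.exists_equiv_fin G
  have h0 : ∀ g, f (z * g) < f (z * (z * g)) ↔ ¬ f g < f (z * g) := by
    intro g
    rw [← mul_assoc, hz, one_mul]
    have : f (z * g) ≠ f g := by
      intro h; have := f.injective h; exact hz1 (by simpa using this)
    rw [not_lt]
    exact ⟨le_of_lt, fun h => lt_of_le_of_ne h this⟩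
  refine ⟨fun g => (f g < f (z * g) ↔ f 1 < f (z * 1)), Iff.rfl, fun g => ?_⟩
  simp only [h0]; tauto

namespace ZSq
variable {G : Type*} [Group G] {z : G} (H : ZSq z)
include H

lemma cz (g : G) : Commute z g := H.hzc g

lemma ncomm {x y : G} (h : ¬ Commute x y) : x * y = z * (y * x) :=
  (H.comm x y).resolve_left h

lemma cmul (a b c : G) : Commute (a * b) c ↔ (Commute a c ↔ Commute b c) := by
  by_cases ha : Commute a c <;> by_cases hb : Commute b c
  · simp [ha, hb]
  · simp only [ha, hb, iff_false, not_true]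
    intro h
    have := (ha.inv_left.mul_left h); simp at this; exact hb this
  · simp only [ha, hb, iff_true, iff_false]
    intro h
    have := (h.mul_left hb.inv_left); simp at this; exact ha this
  · simp only [ha, hb, iff_true]
    have h1 := H.ncomm ha
    have h2 := H.ncomm hb
    change a * b * c = c * (a * b)
    rw [mul_assoc, h2, H.mz, ← mul_assoc a c, h1, mul_assoc z, H.zz, mul_assoc]

lemma cmul' (a b c : G) : Commute c (a * b) ↔ (Commute c a ↔ Commute c b) := by
  rw [Commute.symm_iff, H.cmul, Commute.symm_iff (a := c), Commute.symm_iff (a := c)]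

lemma sq_c {x y : G} (h : Commute x y) : (x * y) * (x * y) = (x * x) * (y * y) := H.comm_sq h

lemma sq_n {x y : G} (h : ¬ Commute x y) : (x * y) * (x * y) = z * ((x * x) * (y * y)) :=
  H.ncomm_sq (H.ncomm h)

lemma sq_ne {g : G} (h : g * g ≠ z) : g * g = 1 := (H.sq g).resolve_right h

lemma not_comm_one {x y : G} (h : ¬ Commute x y) : x ≠ 1 ∧ x ≠ z := by
  refine ⟨?_, ?_⟩
  · rintro rfl; exact h (Commute.one_left _)
  · rintro rfl; exact h (H.cz _)

/-- In a filled group, every square root of `z` is a product of two involutions -/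
lemma prod_inv [Finite G] (hF : Filled G) (w : G) (hw : w * w = z) :
    ∃ x y, x * x = 1 ∧ y * y = 1 ∧ w = x * y ∧ ¬ Commute x y := by
  have hpf : ProductFree ({z} : Set G) := by
    rw [pf_iff]; simp only [Set.mem_singleton_iff]
    rintro a rfl b rfl h
    rw [H.hz] at h; exact H.hz1 h.symm
  obtain ⟨S, hS, hsub⟩ := ext_lm _ hpf
  have hSpf := (pf_iff S).1 hS.1
  have hzS : z ∈ S := hsub rfl
  have hinv : ∀ s ∈ S, s * s = 1 := fun s hs => H.sq_ne fun h => hSpf s hs s hs (h ▸ hzS)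
  have hw1 : w ≠ 1 := by rintro rfl; exact H.hz1 (by simpa using hw.symm)
  rcases hF S hS w hw1 with h | ⟨a, ha, b, hb, rfl⟩
  · exact absurd (hinv w h) (by rw [hw]; exact H.hz1)
  · refine ⟨a, b, hinv a ha, hinv b hb, rfl, ?_⟩
    intro h
    have := H.sq_c h
    simp only at hw
    rw [hw, hinv a ha, hinv b hb, mul_one] at this
    exact H.hz1 this

lemma dec {x y : G} (hxy : ¬ Commute x y) (g : G) :
    ∃ c, Commute c x ∧ Commute c y ∧ (g = c ∨ g = x * c ∨ g = y * c ∨ g = x * y * c) := by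
  have hyx : ¬ Commute y x := fun h => hxy h.symm
  by_cases h1 : Commute g x <;> by_cases h2 : Commute g y
  · exact ⟨g, h1, h2, Or.inl rfl⟩
  · refine ⟨x⁻¹ * g, ?_, ?_, Or.inr (Or.inl (by simp))⟩ <;> rw [H.cmul] <;> simp [h1, h2, hxy]
  · refine ⟨y⁻¹ * g, ?_, ?_, Or.inr (Or.inr (Or.inl (by simp)))⟩ <;> rw [H.cmul] <;> simp [h1, h2, hyx]
  · refine ⟨(x * y)⁻¹ * g, ?_, ?_, Or.inr (Or.inr (Or.inr (by group)))⟩ <;>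
      rw [H.cmul, Commute.inv_left_iff, H.cmul] <;> simp [h1, h2, hyx, hxy]

theorem hh [Finite G] {x y p q : G} (hx : x * x = 1) (hy : y * y = 1) (hxy : ¬ Commute x y)
    (hp : p * p = 1) (hq : q * q = 1) (hpq : ¬ Commute p q)
    (hpx : Commute p x) (hpy : Commute p y) (hqx : Commute q x) (hqy : Commute q y) : ¬ Filled G := by
  intro hF
  have hyx : ¬ Commute y x := fun h => hxy h.symm
  obtain ⟨R, hR1, hRz⟩ := exists_half H.hz H.hz1
  have hxyx : ¬ Commute (x * y) x := by rw [H.cmul]; simp [hyx]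
  have hxny : ¬ Commute x (x * y) := fun h => hxyx h.symm
  have hyny : ¬ Commute y (x * y) := by rw [H.cmul']; simp [hyx]
  let A : G → Prop := fun c => Commute c x ∧ Commute c y ∧ c * c = 1 ∧ R c
  let B : G → Prop := fun c => Commute c x ∧ Commute c y ∧ c * c = 1 ∧ (c = 1 ∨ (c ≠ z ∧ ¬ R c))
  have hBz : ∀ c, B c → ¬ B (z * c) := by
    rintro c ⟨-, -, -, h1⟩ ⟨-, -, -, h2⟩
    rw [hRz] at h2
    rcases h1 with rfl | ⟨h1, h1'⟩ <;> rcases h2 with h2 | ⟨h2, h2'⟩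
    · exact H.hz1 (by simpa using h2)
    · exact h2 (mul_one z)
    · apply h1; rw [← H.zz c, h2, mul_one]
    · exact h2' h1'
  have hAz : ∀ c, A c → ¬ A (z * c) := by
    rintro c ⟨-, -, -, h1⟩ ⟨-, -, -, h2⟩
    rw [hRz] at h2; exact h2 h1
  -- elements of `C`
  have hcxy : ∀ c, Commute c x → Commute c y → Commute c (x * y) := fun c h1 h2 => h1.mul_right h2
  have hxc : ∀ c, Commute c x → Commute c y → ¬ Commute (x * c) (x * y) := by
    intro c h1 h2; rw [H.cmul]; simp [hxny, hcxy c h1 h2]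
  have hyc : ∀ c, Commute c x → Commute c y → ¬ Commute (y * c) (x * y) := by
    intro c h1 h2; rw [H.cmul]; simp [hyny, hcxy c h1 h2]
  have hxcx : ∀ c, Commute c x → Commute (x * c) x := by
    intro c h1; rw [H.cmul]; simp [h1]
  have hycx : ∀ c, Commute c x → ¬ Commute (y * c) x := by
    intro c h1; rw [H.cmul]; simp [hyx, h1]
  let T0 : Set G := {t | (∃ c, A c ∧ t = x * c) ∨ (∃ c, B c ∧ t = y * c)}
  have hT0sq : ∀ t ∈ T0, t * t = 1 := by
    rintro t (⟨c, hc, rfl⟩ | ⟨c, hc, rfl⟩)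
    · rw [H.sq_c hc.1.symm, hx, hc.2.2.1, mul_one]
    · rw [H.sq_c hc.2.1.symm, hy, hc.2.2.1, mul_one]
  have hTz : ∀ t ∈ T0, z * t ∉ T0 := by
    rintro t (⟨c, hc, rfl⟩ | ⟨c, hc, rfl⟩) (⟨c', hc', h⟩ | ⟨c', hc', h⟩)
    · rw [← H.mz, mul_right_inj] at h
      exact hAz c hc (h ▸ hc')
    · apply hycx c' hc'.1
      rw [← h, H.cmul]
      simp [H.cz x, hxcx c hc.1]
    · have := hxcx c' hc'.1
      rw [← h, H.cmul] at this
      simp [H.cz x, hycx c hc.1] at this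
    · rw [← H.mz, mul_right_inj] at h
      exact hBz c hc (h ▸ hc')
  have hne : ∀ c, c * c = z → Commute c x → Commute c y →
      ∃ s, s * s = 1 ∧ Commute s x ∧ Commute s y ∧ ¬ Commute s c := by
    intro c hc hcx hcy
    by_cases h1 : Commute p c
    swap
    · exact ⟨p, hp, hpx, hpy, h1⟩
    by_cases h2 : Commute q c
    swap
    · exact ⟨q, hq, hqx, hqy, h2⟩
    obtain ⟨u, v, hu, hv, rfl, huv⟩ := H.prod_inv hF c hc
    have huc : ¬ Commute u (u * v) := by rw [H.cmul']; simp [huv]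
    obtain ⟨d, hdx, hdy, hd⟩ := H.dec hxy u
    have hdc : ¬ Commute d (u * v) := by
      intro h
      apply huc
      generalize u * v = c at *
      rcases hd with rfl | rfl | rfl | rfl
      · exact h
      · exact hcx.symm.mul_left h
      · exact hcy.symm.mul_left h
      · exact (hcx.symm.mul_left hcy.symm).mul_left h
    obtain ⟨d', hdp, hdq, hd'⟩ := H.dec hpq d
    have hall : ¬ Commute d' (u * v) ∧ Commute d' x ∧ Commute d' y := by
      generalize u * v = c at *
      have e1 : ∀ a b g : G, Commute a g → Commute (a * b) g → Commute b g := by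
        intro a b g h h'
        rw [H.cmul] at h'; exact h'.1 h
      rcases hd' with rfl | rfl | rfl | rfl
      · exact ⟨hdc, hdx, hdy⟩
      · exact ⟨fun h => hdc (h1.mul_left h), e1 _ _ _ hpx hdx, e1 _ _ _ hpy hdy⟩
      · exact ⟨fun h => hdc (h2.mul_left h), e1 _ _ _ hqx hdx, e1 _ _ _ hqy hdy⟩
      · exact ⟨fun h => hdc ((h1.mul_left h2).mul_left h), e1 _ _ _ (hpx.mul_left hqx) hdx,
          e1 _ _ _ (hpy.mul_left hqy) hdy⟩
    obtain ⟨h3, h4, h5⟩ := hall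
    rcases H.sq d' with h6 | h6
    · exact ⟨d', h6, h4, h5, h3⟩
    · refine ⟨d' * (p * q), ?_, h4.mul_left (hpx.mul_left hqx), h5.mul_left (hpy.mul_left hqy), ?_⟩
      · rw [H.sq_c (hdp.mul_right hdq), H.sq_n hpq, h6, hp, hq]; simp [H.hz]
      · rw [H.cmul]; simp [h3, h1.mul_left h2]
  refine star z H.hz H.hz1 H.hzc (fun g => Commute g (x * y)) (fun a b => H.cmul a b _) (H.cz _) T0
    ?_ hTz ?_ ?_ (x * (p * q)) ?_ ?_ hF
  · rintro t (⟨c, hc, rfl⟩ | ⟨c, hc, rfl⟩)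
    · exact hxc c hc.1 hc.2.1
    · exact hyc c hc.1 hc.2.1
  · intro s hs t ht hst
    have hs2 := hT0sq s hs
    have : t = z * s := by
      calc t = s * s * t := by rw [hs2, one_mul]
        _ = s * (s * t) := by group
        _ = z * s := by rw [hst, H.mz']
    exact hTz s hs (this ▸ ht)
  · intro m hm hm1 hmz hmm
    have hm2 := H.sq_ne hmm
    obtain ⟨c, hcx, hcy, rfl | rfl | rfl | rfl⟩ := H.dec hxy m
    · by_cases hRm : R m
      · exact ⟨x * 1, Or.inl ⟨1, ⟨Commute.one_left _, Commute.one_left _, one_mul _, hR1⟩, rfl⟩, x * m,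
          Or.inl ⟨m, ⟨hcx, hcy, hm2, hRm⟩, rfl⟩, Or.inl (by rw [mul_one, ← mul_assoc, hx, one_mul])⟩
      · exact ⟨y * 1, Or.inr ⟨1, ⟨Commute.one_left _, Commute.one_left _, one_mul _, Or.inl rfl⟩, rfl⟩, y * m,
          Or.inr ⟨m, ⟨hcx, hcy, hm2, Or.inr ⟨hmz, hRm⟩⟩, rfl⟩, Or.inl (by rw [mul_one, ← mul_assoc, hy, one_mul])⟩
    · exact absurd hm (hxc c hcx hcy)
    · exact absurd hm (hyc c hcx hcy)
    · have hc2 : c * c = z := by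
        rw [H.sq_c (hcxy c hcx hcy).symm, H.sq_n hxy, hx, hy, mul_one, mul_one] at hm2
        rw [← H.zz (c * c), hm2, mul_one]
      obtain ⟨s, hs2, hsx, hsy, hsc⟩ := hne c hc2 hcx hcy
      have ht2 : (s * c) * (s * c) = 1 := by rw [H.sq_n hsc, hs2, hc2, one_mul, H.hz]
      have htx : Commute (s * c) x := hsx.mul_left hcx
      have hty : Commute (s * c) y := hsy.mul_left hcy
      have hst : ¬ Commute s (s * c) := by rw [H.cmul']; simp [hsc]
      have hst' : s * (s * c) = c := by rw [← mul_assoc, hs2, one_mul]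
      generalize htt : s * c = t at *
      -- general step
      have key : ∀ a b, A a → B b → a * b = c → ∃ s ∈ T0, ∃ t ∈ T0,
          x * y * c = s * t ∨ x * y * c * s = t ∨ s * (x * y * c) = t := by
        intro a b ha hb hab
        refine ⟨x * a, Or.inl ⟨a, ha, rfl⟩, y * b, Or.inr ⟨b, hb, rfl⟩, Or.inl ?_⟩
        rw [← hab]
        have := ha.2.1.eq
        calc x * y * (a * b) = x * (y * a) * b := by group
          _ = x * (a * y) * b := by rw [this]
          _ = _ := by group
      have hzx := fun (c : G) (h : Commute c x) => (H.cz x).mul_left h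
      have hzy := fun (c : G) (h : Commute c y) => (H.cz y).mul_left h
      obtain ⟨s1, sz⟩ := H.not_comm_one hst
      obtain ⟨t1, tz⟩ := H.not_comm_one (fun h => hst h.symm : ¬ Commute t s)
      have zne : ∀ g : G, g ≠ 1 → z * g ≠ z := by
        intro g hg h; exact hg (by simpa using h)
      have hts : z * (t * s) = c := by rw [← hst', H.ncomm hst]
      by_cases hRs : R s <;> by_cases hRt : R t
      · exact key t (z * s) ⟨htx, hty, ht2, hRt⟩
          ⟨hzx s hsx, hzy s hsy, by rw [H.sq_z, hs2], Or.inr ⟨zne s s1, by rw [hRz]; simpa using hRs⟩⟩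
          (by rw [H.mz, hts])
      · exact key s t ⟨hsx, hsy, hs2, hRs⟩ ⟨htx, hty, ht2, Or.inr ⟨tz, hRt⟩⟩ hst'
      · exact key (z * s) (z * t) ⟨hzx s hsx, hzy s hsy, by rw [H.sq_z, hs2], by rw [hRz]; exact hRs⟩
          ⟨hzx t htx, hzy t hty, by rw [H.sq_z, ht2], Or.inr ⟨zne t t1, by rw [hRz]; simpa using hRt⟩⟩
          (by rw [mul_assoc, H.mz, H.zz, hst'])
      · exact key (z * t) s ⟨hzx t htx, hzy t hty, by rw [H.sq_z, ht2], by rw [hRz]; exact hRt⟩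
          ⟨hsx, hsy, hs2, Or.inr ⟨sz, hRs⟩⟩ (by rw [mul_assoc, hts])
  · exact hxc _ (hpx.mul_left hqx) (hpy.mul_left hqy)
  · rw [H.sq_c (hpx.mul_left hqx).symm, H.sq_n hpq, hx, hp, hq]; simp

end ZSq

open Pointwise

namespace ZSq
variable {G : Type*} [Group G] {z : G} (H : ZSq z)
include H

/-- adjoin an element to a subgroup containing `z` -/
def adj (K : Subgroup G) (hzK : z ∈ K) (g : G) : Subgroup G where
  carrier := {h | h ∈ K ∨ g * h ∈ K}
  one_mem' := Or.inl K.one_mem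
  mul_mem' := by
    have hgg : g * g ∈ K := by rcases H.sq g with h | h <;> rw [h]; exacts [K.one_mem, hzK]
    rintro a b (ha | ha) (hb | hb)
    · exact Or.inl (K.mul_mem ha hb)
    · right
      rcases H.comm g a with h | h
      · rw [← mul_assoc, h, mul_assoc]; exact K.mul_mem ha hb
      · rw [← mul_assoc, h, mul_assoc, mul_assoc]; exact K.mul_mem hzK (K.mul_mem ha hb)
    · right; rw [← mul_assoc]; exact K.mul_mem ha hb
    · left
      have h1 := K.mul_mem ha hb
      have h2 : g * a * (g * b) = g * (a * g) * b := by group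
      rw [h2] at h1
      rcases H.comm a g with h | h
      · rw [h, show g * (g * a) * b = (g * g) * (a * b) by group] at h1
        exact (K.mul_mem_cancel_left hgg).1 h1
      · rw [h, H.mz, show z * (g * (g * a)) * b = z * (g * g) * (a * b) by group] at h1
        exact (K.mul_mem_cancel_left (K.mul_mem hzK hgg)).1 h1
  inv_mem' := by
    rintro a (ha | ha)
    · exact Or.inl (K.inv_mem ha)
    · right
      rcases H.sq a with h | h
      · rwa [H.inv1 h]
      · rw [H.inv2 h, H.mz]; exact K.mul_mem hzK ha

lemma sep [Finite G] (N : Subgroup G) (hzN : z ∈ N) (e : G) (heN : e ∉ N) :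
    ∃ M : G → Prop, (∀ a b, M (a * b) ↔ (M a ↔ M b)) ∧ (∀ n ∈ N, M n) ∧ ¬ M e := by
  have hfin : {K : Subgroup G | N ≤ K ∧ e ∉ K}.Finite := Set.toFinite _
  obtain ⟨K, hNK, hK⟩ := hfin.exists_le_maximal (a := N) ⟨le_refl N, heN⟩
  have hzK : z ∈ K := hNK hzN
  have heK : e ∉ K := hK.1.2
  have hgg : ∀ g : G, g * g ∈ K := by
    intro g; rcases H.sq g with h | h <;> rw [h]; exacts [K.one_mem, hzK]
  have key : ∀ g, g ∉ K → g * e ∈ K := by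
    intro g hg
    by_contra hcon
    have hle : K ≤ H.adj K hzK g := fun h hh => Or.inl hh
    have := hK.2 (y := H.adj K hzK g) ⟨le_trans hNK hle, fun h => h.elim heK hcon⟩ hle
    exact hg (this (Or.inr (hgg g)))
  refine ⟨fun g => g ∈ K, ?_, fun n hn => hNK hn, heK⟩
  intro a b
  by_cases ha : a ∈ K
  · simp [ha, K.mul_mem_cancel_left ha]
  · by_cases hb : b ∈ K
    · simp [ha, hb, K.mul_mem_cancel_right hb]
    · simp only [ha, hb, iff_true]
      have h1 := key a ha
      have h2 : e * b ∈ K := by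
        have := key b hb
        rcases H.comm e b with h | h
        · rwa [h]
        · rw [h]; exact K.mul_mem hzK this
      have h3 := K.mul_mem h1 h2
      rw [show a * e * (e * b) = a * (e * e) * b by group] at h3
      rcases H.sq e with h | h
      · rwa [h, mul_one] at h3
      · rw [h, H.mz', mul_assoc] at h3
        exact (K.mul_mem_cancel_left hzK).1 h3

/-- the subgroup `{1, z, f, zf}` -/
def four (f : G) (hf : f * f = 1) : Subgroup G where
  carrier := {g | g = 1 ∨ g = z ∨ g = f ∨ g = z * f}
  one_mem' := Or.inl rfl
  mul_mem' := by
    rintro a b (rfl | rfl | rfl | rfl) (rfl | rfl | rfl | rfl) <;>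
      simp [H.hz, hf, H.zz, H.mz, H.mz', mul_assoc]
  inv_mem' := by
    rintro a (rfl | rfl | rfl | rfl) <;> simp [H.inv_z, H.inv1 hf, H.mz']

theorem e2 [Finite G] {e f x w : G} (he : e * e = 1) (hf : f * f = 1) (hec : ∀ g, Commute e g)
    (hfc : ∀ g, Commute f g) (he1 : e ≠ 1) (hez : e ≠ z) (hf1 : f ≠ 1) (hfz : f ≠ z) (hfe : f ≠ e)
    (hfze : f ≠ z * e) (hx : x * x = 1) (hxn : ∃ y, ¬ Commute x y) (hw : w * w = z) : ¬ Filled G := by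
  obtain ⟨M, hM, hMf, hMe⟩ := H.sep (H.four f hf) (Or.inr (Or.inl rfl)) e (by
    rintro (h | h | h | h)
    · exact he1 h
    · exact hez h
    · exact hfe h.symm
    · exact hfze (by rw [h, H.zz]))
  obtain ⟨N, hN, hNe, hNf⟩ := H.sep (H.four e he) (Or.inr (Or.inl rfl)) f (by
    rintro (h | h | h | h)
    · exact hf1 h
    · exact hfz h
    · exact hfe h
    · exact hfze h)
  have hMz : M z := hMf z (Or.inr (Or.inl rfl))
  have hMf : M f := hMf f (Or.inr (Or.inr (Or.inl rfl)))
  have hNz : N z := hNe z (Or.inr (Or.inl rfl))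
  have hNe : N e := hNe e (Or.inr (Or.inr (Or.inl rfl)))
  obtain ⟨R, hR1, hRz⟩ := exists_half H.hz H.hz1
  have e1 : ∀ g, e * (e * g) = g := fun g => by rw [← mul_assoc, he, one_mul]
  have f1 : ∀ g, f * (f * g) = g := fun g => by rw [← mul_assoc, hf, one_mul]
  have hef : ∀ g, f * (e * g) = e * (f * g) := fun g => by
    rw [← mul_assoc, ← (hec f).eq, mul_assoc]
  have hge : ∀ g h, g * (e * h) = e * (g * h) := fun g h => by
    rw [← mul_assoc, ← (hec g).eq, mul_assoc]
  have hgf : ∀ g h, g * (f * h) = f * (g * h) := fun g h => by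
    rw [← mul_assoc, ← (hfc g).eq, mul_assoc]
  have hse : ∀ g, (e * g) * (e * g) = g * g := fun g => by rw [mul_assoc, hge, e1]
  have hsf : ∀ g, (f * g) * (f * g) = g * g := fun g => by rw [mul_assoc, hgf, f1]
  let T0 : Set G := {g | ¬ M g ∧ g * g = 1 ∧ (N g → R (e * g)) ∧
    (¬ N g → e * (f * g) = 1 ∨ (e * (f * g) ≠ z ∧ ¬ R (e * (f * g))))}
  have hTz : ∀ t ∈ T0, z * t ∉ T0 := by
    rintro t ⟨h1, h2, h3, h4⟩ ⟨h1', h2', h3', h4'⟩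
    have hNt : N (z * t) ↔ N t := by rw [hN]; simp [hNz]
    rw [hNt] at h3' h4'
    by_cases hn : N t
    · have := h3' hn
      rw [H.mz, hRz] at this
      exact this (h3 hn)
    · have a := h4 hn
      have b := h4' hn
      rw [H.mz, H.mz, hRz] at b
      generalize e * (f * t) = c at a b
      rcases a with rfl | ⟨a1, a2⟩ <;> rcases b with b | ⟨b1, b2⟩
      · exact H.hz1 (by simpa using b)
      · exact b1 (mul_one z)
      · apply a1; rw [← H.zz c, b, mul_one]
      · exact b2 a2
  -- the two kinds of elements of T0
  have hTa : ∀ a, M a → N a → a * a = 1 → R a → e * a ∈ T0 := by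
    intro a h1 h2 h3 h4
    have : N (e * a) := by rw [hN]; simp [hNe, h2]
    refine ⟨by rw [hM]; simp [hMe, h1], by rw [hse, h3], fun _ => by rwa [e1], fun h => absurd this h⟩
  have hTb : ∀ b, M b → N b → b * b = 1 → (b = 1 ∨ (b ≠ z ∧ ¬ R b)) → e * (f * b) ∈ T0 := by
    intro a h1 h2 h3 h4
    have : ¬ N (e * (f * a)) := by rw [hN, hN]; simp [hNe, h2, hNf]
    refine ⟨by rw [hM, hM]; simp [hMe, h1, hMf], by rw [hse, hsf, h3], fun h => absurd h this, fun _ => ?_⟩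
    rw [hef, e1, f1]; exact h4
  have hM1 : M 1 := by have := hM 1 1; simpa using this
  have hN1 : N 1 := by have := hN 1 1; simpa using this
  -- a noncentral involution in the intersection
  obtain ⟨k0, hk1, hk2, hk3, hk4, hk5⟩ : ∃ k, k * k = 1 ∧ M k ∧ N k ∧ k ≠ 1 ∧ k ≠ z := by
    obtain ⟨y, hy⟩ := hxn
    have h0 : ∃ k, k * k = 1 ∧ M k ∧ ¬ Commute k y := by
      by_cases h : M x
      · exact ⟨x, hx, h, hy⟩
      · refine ⟨e * x, by rw [hse, hx], by rw [hM]; simp [hMe, h], ?_⟩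
        rw [H.cmul]; simp [hec y, hy]
    obtain ⟨k, h1, h2, h3⟩ := h0
    have h0 : ∃ k, k * k = 1 ∧ M k ∧ N k ∧ ¬ Commute k y := by
      by_cases h : N k
      · exact ⟨k, h1, h2, h, h3⟩
      · refine ⟨f * k, by rw [hsf, h1], by rw [hM]; simp [hMf, h2], by rw [hN]; simp [hNf, h], ?_⟩
        rw [H.cmul]; simp [hfc y, h3]
    obtain ⟨k, h1, h2, h3, h4⟩ := h0
    exact ⟨k, h1, h2, h3, H.not_comm_one h4⟩
  obtain ⟨k0, hk1, hk2, hk3, hk4, hkR⟩ : ∃ k, k * k = 1 ∧ M k ∧ N k ∧ k ≠ 1 ∧ R k := by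
    by_cases h : R k0
    · exact ⟨k0, hk1, hk2, hk3, hk4, h⟩
    · refine ⟨z * k0, by rw [H.sq_z, hk1], by rw [hM]; simp [hMz, hk2], by rw [hN]; simp [hNz, hk3], ?_, by rwa [hRz]⟩
      intro h; apply hk5; rw [← H.zz k0, h, mul_one]
  obtain ⟨w', hw1, hw2⟩ : ∃ w', ¬ M w' ∧ w' * w' = z := by
    by_cases h : M w
    · exact ⟨e * w, by rw [hM]; simp [hMe, h], by rw [hse, hw]⟩
    · exact ⟨w, h, hw⟩
  refine star z H.hz H.hz1 H.hzc M hM hMz T0 (fun t ht => ht.1) hTz ?_ ?_ w' hw1 hw2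
  · intro s hs t ht hst
    have hs2 := hs.2.1
    have : t = z * s := by
      calc t = s * s * t := by rw [hs2, one_mul]
        _ = s * (s * t) := by group
        _ = z * s := by rw [hst, H.mz']
    exact hTz s hs (this ▸ ht)
  · intro m hm hm1 hmz hmm
    have hm2 := H.sq_ne hmm
    by_cases hNm : N m
    · by_cases hRm : R m
      · exact ⟨e * 1, hTa 1 hM1 hN1 (one_mul 1) hR1, e * m, hTa m hm hNm hm2 hRm, Or.inl (by rw [mul_one, e1])⟩
      · refine ⟨e * (f * 1), hTb 1 hM1 hN1 (one_mul 1) (Or.inl rfl), e * (f * m),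
          hTb m hm hNm hm2 (Or.inr ⟨hmz, hRm⟩), Or.inl ?_⟩
        rw [mul_one, mul_assoc, hef, e1, f1]
    · have key : ∀ a b, M a → N a → a * a = 1 → R a → M b → N b → b * b = 1 → (b = 1 ∨ (b ≠ z ∧ ¬ R b)) →
          a * b = f * m → ∃ s ∈ T0, ∃ t ∈ T0, m = s * t ∨ m * s = t ∨ s * m = t := by
        intro a b h1 h2 h3 h4 h5 h6 h7 h8 hab
        refine ⟨e * a, hTa a h1 h2 h3 h4, e * (f * b), hTb b h5 h6 h7 h8, Or.inl ?_⟩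
        rw [mul_assoc, hge, e1, hgf, hab, f1]
      have hMk : M (f * m) := by rw [hM]; simp [hMf, hm]
      have hNk : N (f * m) := by rw [hN]; simp [hNf, hNm]
      have hkk : (f * m) * (f * m) = 1 := by rw [hsf, hm2]
      by_cases hRk : R (f * m)
      · exact key _ 1 hMk hNk hkk hRk hM1 hN1 (one_mul 1) (Or.inl rfl) (mul_one _)
      · by_cases hkz : f * m = z
        · refine key k0 (z * k0) hk2 hk3 hk1 hkR (by rw [hM]; simp [hMz, hk2]) (by rw [hN]; simp [hNz, hk3])
            (by rw [H.sq_z, hk1]) (Or.inr ⟨?_, by rw [hRz]; simpa using hkR⟩) (by rw [hkz, H.mz, hk1, mul_one])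
          intro h; exact hk4 (by simpa using h)
        · exact key 1 _ hM1 hN1 (one_mul 1) hR1 hMk hNk hkk (Or.inr ⟨hkz, hRk⟩) (one_mul _)

theorem center_small [Finite G] (hF : Filled G) {x y : G} (hx : x * x = 1) (hy : y * y = 1)
    (hxy : ¬ Commute x y) :
    (∀ c : G, (∀ g : G, Commute c g) → c * c = 1) ∧
    ((∀ c : G, (∀ g : G, Commute c g) → c = 1 ∨ c = z) ∨
      ∃ e : G, e * e = 1 ∧ (∀ g : G, Commute e g) ∧ e ≠ 1 ∧ e ≠ z ∧
        ∀ c : G, (∀ g : G, Commute c g) → c = 1 ∨ c = z ∨ c = e ∨ c = z * e) := by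
  have hC : ∀ c : G, (∀ g : G, Commute c g) → c * c = 1 := by
    intro c hc
    rcases H.sq c with h | h
    · exact h
    · obtain ⟨u, v, hu, hv, rfl, huv⟩ := H.prod_inv hF c h
      have := hc v
      rw [H.cmul] at this
      simp [huv] at this
  refine ⟨hC, ?_⟩
  by_contra hcon
  push Not at hcon
  obtain ⟨⟨e, he, he1, hez⟩, h2⟩ := hcon
  obtain ⟨f, hf, hf1, hfz, hfe, hfze⟩ := h2 e (hC e he) he he1 hez
  refine H.e2 (w := x * y) (hC e he) (hC f hf) he hf he1 hez hf1 hfz hfe hfze hx ⟨y, hxy⟩ ?_ hF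
  rw [H.sq_n hxy, hx, hy]; simp

theorem classify [Finite G] (hF : Filled G) {w : G} (hw : w * w = z) :
    Coord G 2 rowsD 0 ∨ Coord G 3 rowsDC 4 ∨ Coord G 4 rowsH 0 ∨ Coord G 5 rowsHC 16 := by
  obtain ⟨x, y, hx, hy, rfl, hxy⟩ := H.prod_inv hF w hw
  have hyx' : y * x = x * y * z := by
    rw [H.ncomm (fun h => hxy h.symm : ¬ Commute y x), H.mz']
  have Z0 : Z1 z 0 = 1 := rfl
  have Z1' : Z1 z 1 = z := rfl
  have hC2 : ∀ p q, Commute p x → Commute p y → Commute q x → Commute q y → ¬ Commute p q →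
      p * p = z ∧ q * q = z := by
    intro p q hpx hpy hqx hqy hpq
    have hpq' : ¬ Commute p (p * q) := by rw [H.cmul']; simp [hpq]
    have hpq'' : ¬ Commute (p * q) q := by rw [H.cmul]; simp [hpq]
    rcases H.sq p with h | h <;> rcases H.sq q with h' | h'
    · exact absurd hF (H.hh hx hy hxy h h' hpq hpx hpy hqx hqy)
    · exact absurd hF (H.hh hx hy hxy h (by rw [H.sq_n hpq, h, h', one_mul, H.hz]) hpq' hpx hpy
        (hpx.mul_left hqx) (hpy.mul_left hqy))
    · exact absurd hF (H.hh hx hy hxy (by rw [H.sq_n hpq, h, h', mul_one, H.hz]) h' hpq'' 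
        (hpx.mul_left hqx) (hpy.mul_left hqy) hqx hqy)
    · exact ⟨h, h'⟩
  obtain ⟨hCsq, hcen⟩ := H.center_small hF hx hy hxy
  by_cases hab : ∀ p q, Commute p x → Commute p y → Commute q x → Commute q y → Commute p q
  · have hCc : ∀ c, Commute c x → Commute c y → ∀ g, Commute c g := by
      intro c hcx hcy g
      obtain ⟨d, hdx, hdy, rfl | rfl | rfl | rfl⟩ := H.dec hxy g
      · exact hab c g hcx hcy hdx hdy
      · exact hcx.mul_right (hab c d hcx hcy hdx hdy)
      · exact hcy.mul_right (hab c d hcx hcy hdx hdy)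
      · exact (hcx.mul_right hcy).mul_right (hab c d hcx hcy hdx hdy)
    rcases hcen with hcen | ⟨e, he, hec, he1, hez, hcen⟩
    · left
      refine ⟨z, [x, y], H.hz, H.hz1, H.hzc, ?_, ?_, by simp⟩
      · simp [GRel, rowsD, CommRel, Z0, Z1', hx, hy, hyx']
      · intro g
        obtain ⟨c, hcx, hcy, hg⟩ := H.dec hxy g
        have h1 : ∃ i, c = Z1 z i := by
          rcases hcen c (hCc c hcx hcy) with h | h
          · exact ⟨0, h⟩
          · exact ⟨1, h⟩
        obtain ⟨i, rfl⟩ := h1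
        rcases hg with h | h | h | h
        · exact ⟨0, by norm_num, i, by rw [h]; simp [Pl]⟩
        · exact ⟨1, by norm_num, i, by rw [h]; simp [Pl]⟩
        · exact ⟨2, by norm_num, i, by rw [h]; simp [Pl]⟩
        · exact ⟨3, by norm_num, i, by rw [h]; simp [Pl]⟩
    · right; left
      refine ⟨z, [x, y, e], H.hz, H.hz1, H.hzc, ?_, ?_, fun _ => ?_⟩
      · simp [GRel, rowsDC, CommRel, Z0, Z1', hx, hy, hyx', he, (hec _).eq]
      · intro g
        obtain ⟨c, hcx, hcy, hg⟩ := H.dec hxy g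
        have h1 : ∃ i, c = Z1 z i ∨ c = e * Z1 z i := by
          rcases hcen c (hCc c hcx hcy) with h | h | h | h
          · exact ⟨0, Or.inl h⟩
          · exact ⟨1, Or.inl h⟩
          · exact ⟨0, Or.inr (by rw [h, Z0, mul_one])⟩
          · exact ⟨1, Or.inr (by rw [h, Z1', H.mz'])⟩
        obtain ⟨i, rfl | rfl⟩ := h1
        · rcases hg with h | h | h | h
          · exact ⟨0, by norm_num, i, by rw [h]; simp [Pl]⟩
          · exact ⟨1, by norm_num, i, by rw [h]; simp [Pl]⟩
          · exact ⟨2, by norm_num, i, by rw [h]; simp [Pl]⟩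
          · exact ⟨3, by norm_num, i, by rw [h]; simp [Pl]⟩
        · rcases hg with h | h | h | h
          · exact ⟨4, by norm_num, i, by rw [h]; simp [Pl]⟩
          · exact ⟨5, by norm_num, i, by rw [h]; simp [Pl, mul_assoc]⟩
          · exact ⟨6, by norm_num, i, by rw [h]; simp [Pl, mul_assoc]⟩
          · exact ⟨7, by norm_num, i, by rw [h]; simp [Pl, mul_assoc]⟩
      · simp [Pl, he1, hez]
  · push Not at hab
    obtain ⟨p, q, hpx, hpy, hqx, hqy, hpq⟩ := hab
    obtain ⟨hp, hq⟩ := hC2 p q hpx hpy hqx hqy hpq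
    have hqp' : q * p = p * q * z := by
      rw [H.ncomm (fun h => hpq h.symm : ¬ Commute q p), H.mz']
    have hab : ∀ r s, Commute r x → Commute r y → Commute s x → Commute s y → Commute r p → Commute r q →
        Commute s p → Commute s q → Commute r s := by
      intro r s hrx hry hsx hsy hrp hrq hsp hsq
      by_contra hrs
      obtain ⟨hr, hs⟩ := hC2 r s hrx hry hsx hsy hrs
      refine absurd hF (H.hh hx hy hxy (p := p * r) (q := q * r) ?_ ?_ ?_ (hpx.mul_left hrx) (hpy.mul_left hry)
        (hqx.mul_left hrx) (hqy.mul_left hry))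
      · rw [H.sq_c hrp.symm, hp, hr, H.hz]
      · rw [H.sq_c hrq.symm, hq, hr, H.hz]
      · rw [H.cmul, H.cmul', H.cmul']
        simp [hpq, hrp.symm, hrq]
    have hCc : ∀ c, Commute c x → Commute c y → Commute c p → Commute c q → ∀ g, Commute c g := by
      intro c hcx hcy hcp hcq g
      have hg : ∀ d, Commute d x → Commute d y → Commute c d := by
        intro d hdx hdy
        have e1 : ∀ a b g : G, Commute a g → Commute (a * b) g → Commute b g := by
          intro a b g h h'
          rw [H.cmul] at h'; exact h'.1 h
        obtain ⟨d', hdp, hdq, rfl | rfl | rfl | rfl⟩ := H.dec hpq d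
        · exact hab c d hcx hcy hdx hdy hcp hcq hdp hdq
        · exact hcp.mul_right (hab c d' hcx hcy (e1 _ _ _ hpx hdx) (e1 _ _ _ hpy hdy) hcp hcq hdp hdq)
        · exact hcq.mul_right (hab c d' hcx hcy (e1 _ _ _ hqx hdx) (e1 _ _ _ hqy hdy) hcp hcq hdp hdq)
        · exact (hcp.mul_right hcq).mul_right (hab c d' hcx hcy (e1 _ _ _ (hpx.mul_left hqx) hdx)
            (e1 _ _ _ (hpy.mul_left hqy) hdy) hcp hcq hdp hdq)
      obtain ⟨d, hdx, hdy, rfl | rfl | rfl | rfl⟩ := H.dec hxy g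
      · exact hg g hdx hdy
      · exact hcx.mul_right (hg d hdx hdy)
      · exact hcy.mul_right (hg d hdx hdy)
      · exact (hcx.mul_right hcy).mul_right (hg d hdx hdy)
    have hdec : ∀ g, ∃ i < 16, ∃ c, (∀ g, Commute c g) ∧ g = Pl [x, y, p, q] i * c := by
      intro g
      have e1 : ∀ a b g : G, Commute a g → Commute (a * b) g → Commute b g := by
        intro a b g h h'
        rw [H.cmul] at h'; exact h'.1 h
      obtain ⟨d, hdx, hdy, hd⟩ := H.dec hxy g
      have h1 : ∃ j < 4, ∃ c, (∀ g, Commute c g) ∧ d = Pl [p, q] j * c := by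
        obtain ⟨c, hcp, hcq, rfl | rfl | rfl | rfl⟩ := H.dec hpq d
        · exact ⟨0, by norm_num, d, hCc d hdx hdy hcp hcq, by simp [Pl]⟩
        · exact ⟨1, by norm_num, c, hCc c (e1 _ _ _ hpx hdx) (e1 _ _ _ hpy hdy) hcp hcq, by simp [Pl]⟩
        · exact ⟨2, by norm_num, c, hCc c (e1 _ _ _ hqx hdx) (e1 _ _ _ hqy hdy) hcp hcq, by simp [Pl]⟩
        · exact ⟨3, by norm_num, c, hCc c (e1 _ _ _ (hpx.mul_left hqx) hdx) (e1 _ _ _ (hpy.mul_left hqy) hdy) hcp hcq,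
            by simp [Pl]⟩
      obtain ⟨j, hj, c, hc, rfl⟩ := h1
      have hP : ∀ i < 4, Pl [x, y, p, q] (i + 4 * j) = Pl [x, y] i * Pl [p, q] j := by
        intro i hi
        interval_cases i <;> interval_cases j <;> simp [Pl, mul_assoc]
      rcases hd with h | h | h | h
      · exact ⟨0 + 4 * j, by omega, c, hc, by rw [h, hP 0 (by norm_num)]; simp [Pl]⟩
      · exact ⟨1 + 4 * j, by omega, c, hc, by rw [h, hP 1 (by norm_num)]; simp [Pl, mul_assoc]⟩
      · exact ⟨2 + 4 * j, by omega, c, hc, by rw [h, hP 2 (by norm_num)]; simp [Pl, mul_assoc]⟩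
      · exact ⟨3 + 4 * j, by omega, c, hc, by rw [h, hP 3 (by norm_num)]; simp [Pl, mul_assoc]⟩
    right; right
    rcases hcen with hcen | ⟨e, he, hec, he1, hez, hcen⟩
    · left
      refine ⟨z, [x, y, p, q], H.hz, H.hz1, H.hzc, ?_, ?_, by simp⟩
      · simp [GRel, rowsH, CommRel, Z0, Z1', hx, hy, hyx', hp, hq, hqp', hpx.eq, hpy.eq, hqx.eq, hqy.eq]
      · intro g
        obtain ⟨i, hi, c, hc, rfl⟩ := hdec g
        rcases hcen c hc with rfl | rfl
        · exact ⟨i, hi, 0, rfl⟩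
        · exact ⟨i, hi, 1, rfl⟩
    · right
      refine ⟨z, [x, y, p, q, e], H.hz, H.hz1, H.hzc, ?_, ?_, fun _ => ?_⟩
      · simp [GRel, rowsHC, CommRel, Z0, Z1', hx, hy, hyx', hp, hq, hqp', hpx.eq, hpy.eq, hqx.eq, hqy.eq, he,
          (hec _).eq]
      · intro g
        obtain ⟨i, hi, c, hc, rfl⟩ := hdec g
        have hP0 : Pl [x, y, p, q, e] i = Pl [x, y, p, q] i := by
          interval_cases i <;> simp [Pl]
        have hP1 : Pl [x, y, p, q, e] (16 + i) = Pl [x, y, p, q] i * e := by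
          interval_cases i <;> simp [Pl, mul_assoc]
        rcases hcen c hc with rfl | rfl | rfl | rfl
        · exact ⟨i, by omega, 0, by rw [hP0]; rfl⟩
        · exact ⟨i, by omega, 1, by rw [hP0]; rfl⟩
        · exact ⟨16 + i, by omega, 0, by rw [hP1, Z0, mul_one]⟩
        · exact ⟨16 + i, by omega, 1, by rw [hP1, Z1', mul_assoc, H.mz' e]⟩
      · simp [Pl, he1, hez]

end ZSq

open Pointwise

section cf
variable {G : Type*} [Group G]

set_option maxHeartbeats 1000000 in
/-- The combined criterion with two central involutions `A`, `B`. -/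
theorem cf_crit [Finite G] (A B z : G) (hA : A * A = 1) (hB : B * B = 1) (hAB : A * B = z)
    (hA1 : A ≠ 1) (hB1 : B ≠ 1) (hz1 : z ≠ 1) (hAc : ∀ g, A * g = g * A) (hBc : ∀ g, B * g = g * B)
    (M : G → Prop) (hM : ∀ a b, M (a * b) ↔ (M a ↔ M b)) (hMA : M A) (hMB : M B)
    (w : G) (hw : ¬ M w) (hwz : w * w = z)
    (tA : G) (htA : ¬ M tA) (htA' : tA * tA = A) (tB : G) (htB : ¬ M tB) (htB' : tB * tB = B)
    (cov : ∀ u, M u → u ≠ 1 → u ≠ A → u ≠ B → u ≠ z → u * u ≠ z → ∃ t t', ¬ M t ∧ ¬ M t' ∧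
      (∃ y, (y = 1 ∨ y = A ∨ y = B ∨ y = z) ∧ u = t * t' * y) ∧
      ((t * t = A ∧ t' * t' = B) ∨ (u * u = B ∧ t * t = A ∧ t' * t' = A) ∨
        (u * u = A ∧ t * t = B ∧ t' * t' = B))) : ¬ Filled G := by
  classical
  have hzc : ∀ g, z * g = g * z := fun g => by
    rw [← hAB, mul_assoc, hBc, ← mul_assoc, hAc, mul_assoc]
  have hz : z * z = 1 := by
    calc z * z = A * (B * A) * B := by rw [← hAB]; group
      _ = (A * A) * (B * B) := by rw [hBc]; group
      _ = 1 := by rw [hA, hB, one_mul]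
  have hMz : M z := by rw [← hAB, hM]; exact iff_of_true hMA hMB
  have hzA : z * A = B := by rw [← hAB, hAc, mul_assoc, hA, mul_one]
  have hzB : z * B = A := by rw [← hAB, mul_assoc, hB, mul_one]
  have hzi : z⁻¹ = z := inv_eq_of_mul_eq_one_left hz
  have hAz : A ≠ z := fun h => hB1 (by rw [h] at hAB; simpa using hAB)
  have hBz : B ≠ z := fun h => hA1 (by rw [h] at hAB; simpa using hAB)
  let f : G → ℕ := fun g => (Finite.equivFin G g : ℕ)
  have hf : ∀ {a b}, f a = f b → a = b := fun {a b} h => (Finite.equivFin G).injective (Fin.ext h)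
  let m : G → ℕ := fun t => min (f t) (f t⁻¹)
  have hmi : ∀ t, m t⁻¹ = m t := fun t => by simp only [m, inv_inv]; exact min_comm _ _
  have hzz : ∀ t, z * (z * t) = t := fun t => by rw [← mul_assoc, hz, one_mul]
  have hzti : ∀ t, (z * t)⁻¹ = z * t⁻¹ := fun t => by rw [mul_inv_rev, hzi, hzc]
  have hsq : ∀ t, (z * t) * (z * t) = t * t := fun t => by
    rw [mul_assoc, ← mul_assoc t, ← hzc t, mul_assoc z, hzz]
  have hmne : ∀ t, (t * t = A ∨ t * t = B) → m t ≠ m (z * t) := by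
    intro t ht h
    have h1 : t ≠ z * t := fun h => hz1 (by simpa using h.symm)
    have h1' : t⁻¹ ≠ z * t⁻¹ := fun h => hz1 (by simpa using h.symm)
    have h2 : t ≠ z * t⁻¹ := fun h => by
      have : t * t = z := by
        calc t * t = z * t⁻¹ * t := by rw [← h]
          _ = z := by group
      rcases ht with ht | ht
      · exact hAz (ht.symm.trans this)
      · exact hBz (ht.symm.trans this)
    have h2' : t⁻¹ ≠ z * t := fun h => h2 (by rw [h, hzz])
    simp only [m, hzti] at h
    rcases min_choice (f t) (f t⁻¹) with e1 | e1 <;>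
      rcases min_choice (f (z * t)) (f (z * t⁻¹)) with e2 | e2 <;> rw [e1, e2] at h
    · exact h1 (hf h)
    · exact h2 (hf h)
    · exact h2' (hf h)
    · exact h1' (hf h)
  let T0 : Set G := {t | ¬ M t ∧ (t * t = A ∨ t * t = B) ∧ m t < m (z * t)}
  have hMz' : ∀ t, M (z * t) ↔ M t := fun t => by rw [hM]; simp [hMz]
  have hM1 : M 1 := by have := hM 1 1; simpa using this
  have hMi : ∀ t, M t⁻¹ ↔ M t := fun t => by
    have := hM t t⁻¹
    rw [mul_inv_cancel] at this
    exact (this.1 hM1).symm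
  have hAi : A⁻¹ = A := inv_eq_of_mul_eq_one_left hA
  have hBi : B⁻¹ = B := inv_eq_of_mul_eq_one_left hB
  have hTi : ∀ t ∈ T0, t⁻¹ ∈ T0 := by
    rintro t ⟨h1, h2, h3⟩
    refine ⟨by rwa [hMi], ?_, ?_⟩
    · rw [← mul_inv_rev]
      rcases h2 with h | h <;> rw [h] <;> simp [hAi, hBi]
    · rw [← hzti, hmi, hmi]; exact h3
  have hTn : ∀ t ∈ T0, z * t ∉ T0 := by
    rintro t ⟨h1, h2, h3⟩ ⟨h4, h5, h6⟩
    rw [hzz] at h6; omega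
  have hTe : ∀ t, ¬ M t → (t * t = A ∨ t * t = B) → ∃ s ∈ T0, s * s = t * t ∧ (s = t ∨ s = z * t) := by
    intro t h1 h2
    rcases lt_or_gt_of_ne (hmne t h2) with h | h
    · exact ⟨t, ⟨h1, h2, h⟩, rfl, Or.inl rfl⟩
    · exact ⟨z * t, ⟨by rwa [hMz'], by rwa [hsq], by rwa [hzz]⟩, hsq t, Or.inr rfl⟩
  have hY : ∀ y, (y = 1 ∨ y = A ∨ y = B ∨ y = z) → (z * y = 1 ∨ z * y = A ∨ z * y = B ∨ z * y = z) := by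
    rintro y (rfl | rfl | rfl | rfl)
    · simp
    · simp [hzA]
    · simp [hzB]
    · simp [hz]
  have inv_of : ∀ t C : G, C * C = 1 → t * t = C → t⁻¹ = t * C := by
    intro t C hC ht
    apply inv_eq_of_mul_eq_one_right
    rw [← mul_assoc, ht, hC]
  -- case two
  have case2 : ∀ A B : G, A * A = 1 → B * B = 1 → A * B = z → (∀ g, A * g = g * A) →
      (∀ g, B * g = g * B) → ∀ t ∈ T0, ∀ t' ∈ T0, t * t = A → t' * t' = A → ∀ y,
      (y = 1 ∨ y = A ∨ y = B ∨ y = z) → (t * t' * y) * (t * t' * y) = B →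
      ∃ s ∈ T0, ∃ r ∈ T0, t * t' * y = s * r := by
    intro A B hA hB hAB hAc hBc t ht t' ht' h1 h2 y hy hu
    have hyc : ∀ g, y * g = g * y := by
      rcases hy with rfl | rfl | rfl | rfl
      · simp
      · exact hAc
      · exact hBc
      · exact hzc
    have hy2 : y * y = 1 := by
      rcases hy with rfl | rfl | rfl | rfl
      · simp
      · exact hA
      · exact hB
      · exact hz
    have e1 : t * t' * (t * t') = B := by
      rw [← hu, mul_assoc (t * t') y, ← mul_assoc y, hyc (t * t'), mul_assoc (t * t') y y, hy2, mul_one]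
    have e2 : t' * t = t * t' * B := by
      have i1 := inv_of t A hA h1
      have i2 := inv_of t' A hA h2
      have : t' * t = t⁻¹ * B * t'⁻¹ := by rw [← e1]; group
      rw [this, i1, i2]
      calc t * A * B * (t' * A) = t * A * (B * t') * A := by group
        _ = t * (A * (t' * B)) * A := by rw [hBc]; group
        _ = t * t' * (B * A) * A := by rw [hAc]; group
        _ = t * t' * B * (A * A) := by group
        _ = t * t' * B := by rw [hA, mul_one]
    have i2 := inv_of t' A hA h2
    rcases hy with rfl | rfl | rfl | rfl
    · exact ⟨t, ht, t', ht', by simp⟩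
    · exact ⟨t, ht, t'⁻¹, hTi _ ht', by rw [i2, mul_assoc]⟩
    · exact ⟨t', ht', t, ht, by rw [e2]⟩
    · refine ⟨t'⁻¹, hTi _ ht', t, ht, ?_⟩
      rw [i2, mul_assoc, mul_assoc, hAc t, ← mul_assoc t', e2, ← hAB, mul_assoc _ B A, hAc B, mul_assoc]
  refine star z hz hz1 hzc M hM hMz T0 (fun t ht => ht.1) hTn ?_ ?_ w hw hwz
  · intro s hs t ht hst
    have : s = z * t⁻¹ := by rw [← hst]; group
    exact hTn _ (hTi t ht) (this ▸ hs)
  · intro u hu hu1 huz huu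
    have key : ∃ s ∈ T0, ∃ t ∈ T0, u = s * t := by
      by_cases huA : u = A
      · obtain ⟨s, hs, h1, h2⟩ := hTe tA htA (Or.inl htA')
        exact ⟨s, hs, s, hs, by rw [h1, htA', huA]⟩
      by_cases huB : u = B
      · obtain ⟨s, hs, h1, h2⟩ := hTe tB htB (Or.inr htB')
        exact ⟨s, hs, s, hs, by rw [h1, htB', huB]⟩
      obtain ⟨t, t', ht, ht', ⟨y, hy, huy⟩, hc⟩ := cov u hu hu1 huA huB huz huu
      have hq : (t * t = A ∨ t * t = B) ∧ (t' * t' = A ∨ t' * t' = B) := by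
        rcases hc with ⟨h1, h2⟩ | ⟨-, h1, h2⟩ | ⟨-, h1, h2⟩
        · exact ⟨Or.inl h1, Or.inr h2⟩
        · exact ⟨Or.inl h1, Or.inl h2⟩
        · exact ⟨Or.inr h1, Or.inr h2⟩
      obtain ⟨s, hs, hs1, hs2⟩ := hTe t ht hq.1
      obtain ⟨s', hs', hs1', hs2'⟩ := hTe t' ht' hq.2
      have hy' : ∃ y, (y = 1 ∨ y = A ∨ y = B ∨ y = z) ∧ u = s * s' * y := by
        rcases hs2 with rfl | rfl <;> rcases hs2' with rfl | rfl
        · exact ⟨y, hy, huy⟩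
        · refine ⟨z * y, hY y hy, ?_⟩
          rw [huy, ← mul_assoc s z, ← hzc s, mul_assoc z, hzc, mul_assoc (s * t'), hzz]
        · refine ⟨z * y, hY y hy, ?_⟩
          rw [huy, mul_assoc z, hzc, mul_assoc (t * s'), hzz]
        · refine ⟨y, hy, ?_⟩
          rw [huy, mul_assoc z, ← mul_assoc t z, ← hzc t, mul_assoc z t, hzz]
      obtain ⟨y', hy', huy'⟩ := hy'
      rw [← hs1, ← hs1'] at hc
      rcases hc with ⟨h1, h2⟩ | ⟨h0, h1, h2⟩ | ⟨h0, h1, h2⟩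
      · have i1 := inv_of s A hA h1
        have i2 := inv_of s' B hB h2
        rcases hy' with rfl | rfl | rfl | rfl
        · exact ⟨s, hs, s', hs', by rw [huy', mul_one]⟩
        · exact ⟨s⁻¹, hTi s hs, s', hs', by rw [huy', i1, mul_assoc, mul_assoc, hAc]⟩
        · exact ⟨s, hs, s'⁻¹, hTi s' hs', by rw [huy', i2, mul_assoc]⟩
        · refine ⟨s⁻¹, hTi s hs, s'⁻¹, hTi s' hs', ?_⟩
          rw [huy', i1, i2, ← hAB, mul_assoc s A, ← mul_assoc A s', hAc s']
          group
      · rw [huy'] at h0 ⊢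
        exact case2 A B hA hB hAB hAc hBc s hs s' hs' h1 h2 y' hy' h0
      · rw [huy'] at h0 ⊢
        exact case2 B A hB hA (by rw [← hBc] at hAB; exact hAB) hBc hAc s hs s' hs' h1 h2 y'
          (by rcases hy' with h | h | h | h <;> simp [h]) h0
    obtain ⟨s, hs, t, ht, h⟩ := key
    exact ⟨s, hs, t, ht, Or.inl h⟩

end cf

open Pointwise

section twoinv
variable {G : Type*} [Group G]

/-- Number of square roots of `1` in a quotient by a central involution. -/
lemma card_fiber {Q : Type*} [Group Q] [Finite G] (φ : G →* Q) (hφ : Function.Surjective φ) {z : G}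
    (hz1 : z ≠ 1) (hk : ∀ g, φ g = 1 ↔ g = 1 ∨ g = z) (P : Q → Prop) :
    Nat.card {g : G // P (φ g)} = Nat.card {q : Q // P q} * 2 := by
  choose s hs using hφ
  have hφz : φ z = 1 := (hk z).2 (Or.inr rfl)
  let F : {q : Q // P q} × Fin 2 → {g : G // P (φ g)} := fun p =>
    ⟨s p.1.1 * (if p.2 = 0 then 1 else z), by
      have : φ (s p.1.1 * (if p.2 = 0 then 1 else z)) = p.1.1 := by
        rw [map_mul, hs]; split_ifs <;> simp [hφz]
      rw [this]; exact p.1.2⟩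
  have hF : Function.Bijective F := by
    constructor
    · rintro ⟨⟨q, hq⟩, i⟩ ⟨⟨q', hq'⟩, j⟩ h
      have h' : s q * (if i = 0 then 1 else z) = s q' * (if j = 0 then 1 else z) := congrArg Subtype.val h
      have h1 : q = q' := by
        have := congrArg φ h'
        rw [map_mul, map_mul, hs, hs] at this
        split_ifs at this <;> simpa [hφz] using this
      subst h1
      have h2 : i = j := by
        have h'' := mul_left_cancel h'
        revert h''
        fin_cases i <;> fin_cases j <;> simp [hz1, hz1.symm]
      rw [h2]
    · rintro ⟨g, hg⟩
      have : φ ((s (φ g))⁻¹ * g) = 1 := by rw [map_mul, map_inv, hs]; group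
      rcases (hk _).1 this with h | h
      · exact ⟨(⟨φ g, hg⟩, 0), Subtype.ext (by simp [F]; rw [inv_mul_eq_one] at h; exact h)⟩
      · exact ⟨(⟨φ g, hg⟩, 1), Subtype.ext (by simp [F]; rw [← h]; group)⟩
  rw [← Nat.card_congr (Equiv.ofBijective F hF), Nat.card_prod]
  simp

structure TwoC (c n : G) (m : ℕ) (rows : List (ℕ × List ℕ)) (l : List G) : Prop where
  hc : c * c = 1
  hn : n * n = 1
  hcc : ∀ g, c * g = g * c
  hnc : ∀ g, n * g = g * n
  hR : GRel (Z2 c n) rows l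
  hs : ∀ g : G, ∃ x < 2 ^ m, ∃ e, g = Pl l x * Z2 c n e
  card : Nat.card G = 2 ^ m * 4

namespace TwoC
variable {c n : G} {m : ℕ} {rows : List (ℕ × List ℕ)} {l : List G} (H : TwoC c n m rows l)

lemma Z2_mod (c n : G) (e : ℕ) : Z2 c n (e % 4) = Z2 c n e := by
  unfold Z2
  have h1 : e % 4 % 2 = e % 2 := by omega
  have h2 : e % 4 / 2 % 2 = e / 2 % 2 := by omega
  rw [h1, h2]

include H
lemma fn : ZFun (Z2 c n) := Z2_fun H.hc H.hcc H.hn H.hnc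

lemma bij : Function.Bijective (fun p : Fin (2 ^ m) × Fin 4 => Pl l p.1 * Z2 c n p.2) := by
  haveI : Finite G := Nat.finite_of_card_ne_zero (by rw [H.card]; positivity)
  rw [Nat.bijective_iff_surjective_and_card]
  refine ⟨?_, by rw [H.card]; simp⟩
  intro g
  obtain ⟨x, hx, e, rfl⟩ := H.hs g
  exact ⟨(⟨x, hx⟩, ⟨e % 4, Nat.mod_lt _ (by norm_num)⟩), by simp [Z2_mod]⟩

lemma inj {x y e f : ℕ} (hx : x < 2 ^ m) (hy : y < 2 ^ m) (h : Pl l x * Z2 c n e = Pl l y * Z2 c n f) :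
    x = y ∧ e % 4 = f % 4 := by
  have := @H.bij.1 (⟨x, hx⟩, ⟨e % 4, Nat.mod_lt _ (by norm_num)⟩)
    (⟨y, hy⟩, ⟨f % 4, Nat.mod_lt _ (by norm_num)⟩) (by simpa [Z2_mod] using h)
  simpa using this

lemma Zinj {e f : ℕ} (h : Z2 c n e = Z2 c n f) : e % 4 = f % 4 :=
  (H.inj (x := 0) (y := 0) (by positivity) (by positivity) (by rw [h])).2

lemma count (k : ℕ) : Nat.card {g : G // g * g = 1 ∨ g * g = Z2 c n k} =
    ((List.range (2 ^ m)).countP fun x => Bf rows x x % 4 == 0 || Bf rows x x % 4 == k % 4) * 4 := by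
  have e : {p : Fin (2 ^ m) × Fin 4 // (Bf rows p.1 p.1 % 4 == 0 || Bf rows p.1 p.1 % 4 == k % 4) = true} ≃
      {g : G // g * g = 1 ∨ g * g = Z2 c n k} :=
    (Equiv.ofBijective _ H.bij).subtypeEquiv (by
      rintro ⟨x, e⟩
      simp only [Equiv.ofBijective_apply]
      rw [H.fn.esq H.hR, ← H.fn.zero]
      have h0 : ∀ a b, Z2 c n a = Z2 c n b ↔ a % 4 = b % 4 := fun a b =>
        ⟨H.Zinj, fun h => by rw [← Z2_mod, h, Z2_mod]⟩
      simp [h0])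
  have e2 : {p : Fin (2 ^ m) × Fin 4 // (Bf rows p.1 p.1 % 4 == 0 || Bf rows p.1 p.1 % 4 == k % 4) = true} ≃
      {x : Fin (2 ^ m) // (Bf rows x x % 4 == 0 || Bf rows x x % 4 == k % 4) = true} × Fin 4 :=
    { toFun := fun p => (⟨p.1.1, p.2⟩, p.1.2)
      invFun := fun p => ⟨(p.1.1, p.2), p.1.2⟩
      left_inv := fun p => rfl
      right_inv := fun p => rfl }
  rw [← Nat.card_congr e, Nat.card_congr e2, Nat.card_prod, Nat.card_eq_fintype_card,
    Nat.card_eq_fintype_card, Fintype.card_fin, Fintype.card_subtype]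
  congr 1
  rw [← sum_countP, Finset.card_filter, ← Fin.sum_univ_eq_sum_range
    (fun i => if (Bf rows i i % 4 == 0 || Bf rows i i % 4 == k % 4) = true then 1 else 0)]

/-- the finite condition implying non-filledness -/
theorem notFilled (h : ℕ) (hh : 2 ^ m = 2 * h) (hpow : ∃ k, h = 2 ^ k) (ty : ℕ → ℕ) (hty : ∀ x < 2 ^ m, Bf rows x x % 4 = ty x)
    (h1 : ∃ w < 2 ^ m, h ≤ w ∧ ty w = 1) (h2 : ∃ w < 2 ^ m, h ≤ w ∧ ty w = 2)
    (h3 : ∃ w < 2 ^ m, h ≤ w ∧ ty w = 3)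
    (hcov : ∀ u < h, u ≠ 0 → ty u ≠ 1 → ∃ t < 2 ^ m, h ≤ t ∧
      ((ty t = 2 ∧ ty (t ^^^ u) = 3) ∨ (ty u = 3 ∧ ty t = 2 ∧ ty (t ^^^ u) = 2) ∨
        (ty u = 2 ∧ ty t = 3 ∧ ty (t ^^^ u) = 3))) : ¬ Filled G := by
  haveI : Finite G := Nat.finite_of_card_ne_zero (by rw [H.card]; positivity)
  have hx : ∀ x < 2 ^ m, ∀ y < 2 ^ m, (x ^^^ y < h ↔ (x < h ↔ y < h)) := by
    obtain ⟨k, rfl⟩ := hpow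
    have hm : m = k + 1 := by
      have : 2 ^ m = 2 ^ (k + 1) := by rw [hh, pow_succ, mul_comm]
      exact Nat.pow_right_injective (le_refl 2) this
    have key : ∀ x < 2 ^ m, (x < 2 ^ k ↔ x.testBit k = false) := by
      intro x hx
      constructor
      · exact fun h => Nat.testBit_lt_two_pow h
      · intro h
        by_contra hlt
        have : x / 2 ^ k = 1 := by
          apply Nat.div_eq_of_lt_le <;> omega
        simp [Nat.testBit_eq_decide_div_mod_eq, this] at h
    intro x hx y hy
    rw [key _ (Nat.xor_lt_two_pow hx hy), key x hx, key y hy, Nat.testBit_xor]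
    cases x.testBit k <;> cases y.testBit k <;> simp
  have ZZ := H.fn
  have hsq : ∀ x e, (Pl l x * Z2 c n e) * (Pl l x * Z2 c n e) = Z2 c n (Bf rows x x) := ZZ.esq H.hR
  have hsq0 : ∀ x, x < 2 ^ m → Pl l x * Pl l x = Z2 c n (ty x) := by
    intro x hx'; rw [ZZ.psq H.hR, ← Z2_mod, hty x hx']
  have z0 : Z2 c n 0 = 1 := ZZ.zero
  have zne : ∀ a b, a % 4 ≠ b % 4 → Z2 c n a ≠ Z2 c n b := fun a b hab h => hab (H.Zinj h)
  let M : G → Prop := fun g => ∃ x < h, ∃ e, g = Pl l x * Z2 c n e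
  have hMP : ∀ x < 2 ^ m, ∀ e, M (Pl l x * Z2 c n e) ↔ x < h := by
    intro x hx e
    constructor
    · rintro ⟨y, hy, f, hf⟩
      rwa [(H.inj hx (by omega) hf).1]
    · intro hxh; exact ⟨x, hxh, e, rfl⟩
  have hMP0 : ∀ x < 2 ^ m, M (Pl l x) ↔ x < h := by
    intro x hx; have := hMP x hx 0; rwa [z0, mul_one] at this
  have hpos : 0 < h := by have : 0 < 2 ^ m := by positivity
                          omega
  have hMZ : ∀ e, M (Z2 c n e) := fun e => ⟨0, hpos, e, by rw [ZFun.p0, one_mul]⟩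
  obtain ⟨w, hw, hwh, hw1⟩ := h1
  obtain ⟨a, ha, hah, ha2⟩ := h2
  obtain ⟨b, hb, hbh, hb3⟩ := h3
  refine cf_crit (Z2 c n 2) (Z2 c n 3) (Z2 c n 1) (ZZ.self _) (ZZ.self _) (by rw [ZZ.mul]; rfl)
    (by rw [← z0]; exact zne _ _ (by norm_num)) (by rw [← z0]; exact zne _ _ (by norm_num))
    (by rw [← z0]; exact zne _ _ (by norm_num)) (ZZ.cen _) (ZZ.cen _) M ?_ (hMZ _) (hMZ _)
    (Pl l w) (by rw [hMP0 w hw]; omega) (by rw [hsq0 w hw, hw1])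
    (Pl l a) (by rw [hMP0 a ha]; omega) (by rw [hsq0 a ha, ha2])
    (Pl l b) (by rw [hMP0 b hb]; omega) (by rw [hsq0 b hb, hb3]) ?_
  · intro g g'
    obtain ⟨x, hx1, e, rfl⟩ := H.hs g
    obtain ⟨y, hy1, f, rfl⟩ := H.hs g'
    rw [ZZ.emul H.hR, hMP _ (Nat.xor_lt_two_pow hx1 hy1), hMP _ hx1, hMP _ hy1, hx x hx1 y hy1]
  · rintro _ ⟨u, hu, e, rfl⟩ n1 nA nB nz nsq
    have hum : u < 2 ^ m := by omega
    have usq : (Pl l u * Z2 c n e) * (Pl l u * Z2 c n e) = Z2 c n (ty u) := by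
      rw [hsq, ← Z2_mod, hty u hum]
    have four : ∀ e, Z2 c n e = 1 ∨ Z2 c n e = Z2 c n 2 ∨ Z2 c n e = Z2 c n 3 ∨ Z2 c n e = Z2 c n 1 := by
      intro e
      rw [← Z2_mod]
      have : e % 4 < 4 := Nat.mod_lt _ (by norm_num)
      interval_cases e % 4 <;> simp [z0]
    have hu0 : u ≠ 0 := by
      rintro rfl
      rw [ZFun.p0, one_mul] at n1 nA nB nz
      rcases four e with h | h | h | h
      · exact n1 h
      · exact nA h
      · exact nB h
      · exact nz h
    have hu1 : ty u ≠ 1 := fun h => nsq (by rw [usq, h])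
    obtain ⟨t, ht, hth, hc⟩ := hcov u hu hu0 hu1
    have htu : t ^^^ u < 2 ^ m := Nat.xor_lt_two_pow ht hum
    have htx : ¬ t ^^^ u < h := by rw [hx t ht u hum]; simp [hu]; omega
    refine ⟨Pl l t, Pl l (t ^^^ u), by rw [hMP0 t ht]; omega, by rwa [hMP0 _ htu], ?_, ?_⟩
    · have := ZZ.pmul rows l H.hR t (t ^^^ u)
      rw [← Nat.xor_assoc, Nat.xor_self, Nat.zero_xor] at this
      refine ⟨Z2 c n (Bf rows t (t ^^^ u) ^^^ e), four _, ?_⟩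
      rw [this, mul_assoc, ZZ.mul, ← Nat.xor_assoc, Nat.xor_self, Nat.zero_xor]
    · rw [usq, hsq0 t ht, hsq0 _ htu]
      rcases hc with ⟨h1, h2⟩ | ⟨h0, h1, h2⟩ | ⟨h0, h1, h2⟩
      · left; rw [h1, h2]; exact ⟨rfl, rfl⟩
      · right; left; rw [h0, h1, h2]; exact ⟨rfl, rfl, rfl⟩
      · right; right; rw [h0, h1, h2]; exact ⟨rfl, rfl, rfl⟩

end TwoC
end twoinv

open Pointwise

/-- table entry: bit zero is `r`, bit one is `b` -/
def en (r : ℕ) (b : Bool) : ℕ := cond b (r + 2) r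

def masks4 : List ℕ := [43690, 34952, 41120, 43520, 52428, 49344, 52224, 61680, 61440, 65280]
def rows4 (b : ℕ → Bool) : List (ℕ × List ℕ) :=
  [(en 0 (b 0), [en 1 (b 1), en 0 (b 2), en 0 (b 3)]), (en 0 (b 4), [en 0 (b 5), en 0 (b 6)]),
    (en 1 (b 7), [en 1 (b 8)]), (en 1 (b 9), [])]
def masks5 : List ℕ := [2863311530, 2290649224, 2694881440, 2852170240, 2863267840, 3435973836,
  3233857728, 3422604288, 3435921408, 4042322160, 4026593280, 4042260480, 4278255360, 4278190080,
  4294901760]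
def rows5 (b : ℕ → Bool) : List (ℕ × List ℕ) :=
  [(en 0 (b 0), [en 1 (b 1), en 0 (b 2), en 0 (b 3), en 0 (b 4)]),
    (en 0 (b 5), [en 0 (b 6), en 0 (b 7), en 0 (b 8)]), (en 1 (b 9), [en 1 (b 10), en 0 (b 11)]),
    (en 1 (b 12), [en 0 (b 13)]), (en 0 (b 14), [])]

/-- xor of the masks selected by `b` -/
def acc (b : ℕ → Bool) : List ℕ → ℕ → ℕ → ℕ
  | [], _, q => q
  | m :: ms, k, q => acc b ms (k + 1) (q ^^^ cond (b k) m 0)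

def force (q : ℕ) (p : ℕ → Bool) : Bool := Nat.rec (motive := fun _ => Bool) (p 0) (fun n _ => p (n + 1)) q

lemma force_eq (q : ℕ) (p : ℕ → Bool) : force q p = p q := by cases q <;> rfl

def enum (p : ℕ → Bool) : List ℕ → ℕ → Bool
  | [], q => p q
  | m :: ms, q => enum p ms q && force (Nat.xor q m) fun q => enum p ms q

lemma enum_spec (p : ℕ → Bool) (b : ℕ → Bool) : ∀ (ms : List ℕ) (k q : ℕ), enum p ms q = true →
    p (acc b ms k q) = true
  | [], _, _, h => h
  | m :: ms, k, q, h => by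
    rw [enum, force_eq, Bool.and_eq_true] at h
    rw [acc]
    cases b k
    · exact enum_spec p b ms (k + 1) _ (by simpa using h.1)
    · exact enum_spec p b ms (k + 1) _ h.2

def bc (y : ℕ) : ℕ := Nat.mod (Nat.shiftRight 95125173855764218123276304889944061997689682402263585766959741291920687686033329201817409157123347502415384089435969498586180241031507595463600295898153685276653211633572815512294064538494957912327413386667662218713394765509704508661031522276467630197481635010039778342554499416459730172574551513689147646224 (Nat.mul 4 y)) 16

def cnt : ℕ → ℕ → ℕ
  | 0, _ => 0
  | k + 1, x => Nat.add (bc (Nat.mod x 256)) (cnt k (Nat.div x 256))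

lemma bc_eq : ∀ y < 256, bc y = (List.range 8).countP fun i => y.testBit i := by decide +kernel

lemma cnt_eq : ∀ (k x : ℕ), cnt k x = (List.range (8 * k)).countP fun i => x.testBit i
  | 0, x => rfl
  | k + 1, x => by
    have h : 8 * (k + 1) = 8 + 8 * k := by ring
    rw [cnt, cnt_eq k, h, List.range_add, List.countP_append, List.countP_map]
    have h1 : bc (Nat.mod x 256) = (List.range 8).countP fun i => x.testBit i := by
      rw [bc_eq (Nat.mod x 256) (Nat.mod_lt x (by norm_num))]
      apply List.countP_congr
      intro i hi
      rw [List.mem_range] at hi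
      have : Nat.mod x 256 = x % 2 ^ 8 := rfl
      rw [this, Nat.testBit_mod_two_pow]; simp [hi]
    rw [h1]
    have h2 : (fun i => (Nat.div x 256).testBit i) = (fun i => x.testBit i) ∘ (fun i => 8 + i) := by
      funext i
      have : Nat.div x 256 = x / 2 ^ 8 := rfl
      simp only [Function.comp]
      rw [this, Nat.testBit_div_two_pow, Nat.add_comm]
    rw [h2]; rfl

/-- type of the square: bit zero from `Q1`, bit one from `Q` -/
def tyM (Q1 Q x : ℕ) : ℕ := Nat.add (cond (Q1.testBit x) 1 0) (cond (Q.testBit x) 2 0)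

def cfCond (h Q1 Q : ℕ) : Bool :=
  ((List.range h).any fun w => Nat.beq (tyM Q1 Q (h + w)) 1) &&
  (((List.range h).any fun w => Nat.beq (tyM Q1 Q (h + w)) 2) &&
  (((List.range h).any fun w => Nat.beq (tyM Q1 Q (h + w)) 3) &&
  ((List.range h).all fun u => Nat.beq u 0 || (Nat.beq (tyM Q1 Q u) 1 || ((List.range h).any fun t =>
    (Nat.beq (tyM Q1 Q (h + t)) 2 && Nat.beq (tyM Q1 Q ((h + t) ^^^ u)) 3) ||
    ((Nat.beq (tyM Q1 Q u) 3 && (Nat.beq (tyM Q1 Q (h + t)) 2 && Nat.beq (tyM Q1 Q ((h + t) ^^^ u)) 2)) ||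
    (Nat.beq (tyM Q1 Q u) 2 && (Nat.beq (tyM Q1 Q (h + t)) 3 && Nat.beq (tyM Q1 Q ((h + t) ^^^ u)) 3))))))))

def chk (k h Q1 tgt Q : ℕ) : Bool :=
  cond (Nat.beq (cnt k Q) tgt) (cond (Nat.beq (cnt k (Nat.xor Q Q1)) tgt) (cfCond h Q1 Q) true) true

set_option maxRecDepth 100000 in
lemma enum4 : enum (chk 2 8 30584 10) masks4 0 = true := by decide +kernel
set_option maxRecDepth 100000 in
lemma enum5 : enum (chk 4 16 2004383608 20) masks5 0 = true := by decide +kernel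

lemma mod4_tb (n : ℕ) : n % 4 = cond (n.testBit 0) 1 0 + cond (n.testBit 1) 2 0 := by
  simp only [Nat.testBit_eq_decide_div_mod_eq, Bool.cond_decide, pow_zero, pow_one, Nat.div_one]
  split_ifs <;> omega

lemma en0a (b : Bool) : (en 0 b).testBit 0 = false := by cases b <;> rfl
lemma en0b (b : Bool) : (en 0 b).testBit 1 = b := by cases b <;> rfl
lemma en1a (b : Bool) : (en 1 b).testBit 0 = true := by cases b <;> rfl
lemma en1b (b : Bool) : (en 1 b).testBit 1 = b := by cases b <;> rfl
lemma cond_tb (b : Bool) (m x : ℕ) : (cond b m 0).testBit x = (b && m.testBit x) := by cases b <;> simp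


open Pointwise


set_option maxHeartbeats 4000000 in
lemma ty4 (b : ℕ → Bool) : ∀ x < 2 ^ 4, Bf (rows4 b) x x % 4 = tyM 30584 (acc b masks4 0 0) x := by
  intro x hx
  rw [mod4_tb, tyM]
  change _ = cond _ 1 0 + cond _ 2 0
  norm_num only at hx
  congr 2
  · interval_cases x <;>
    (simp only [rows4, Bf, Lk, Nat.reduceMod, Nat.reduceDiv, Nat.reduceEqDiff, if_true, if_false,
      Nat.testBit_xor, en0a, en1a, Nat.zero_testBit, Bool.xor_false, Bool.false_xor, zero_ne_one]; rfl)
  · interval_cases x <;>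
    (simp only [rows4, acc, masks4, Bf, Lk, Nat.reduceMod, Nat.reduceDiv, Nat.reduceEqDiff, if_true, if_false,
      Nat.testBit_xor, en0b, en1b, cond_tb, Nat.zero_testBit, Bool.xor_false, Bool.false_xor, zero_ne_one,
      Nat.zero_add, Nat.reduceAdd] ;
     simp only [Nat.testBit_eq_decide_div_mod_eq, Nat.reducePow, Nat.reduceMod, Nat.reduceDiv, Nat.reduceEqDiff,
      decide_true, decide_false, Bool.and_true, Bool.and_false, Bool.xor_false, Bool.false_xor, zero_ne_one] ;
     try ac_rfl)

set_option maxHeartbeats 4000000 in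
lemma ty5 (b : ℕ → Bool) : ∀ x < 2 ^ 5, Bf (rows5 b) x x % 4 = tyM 2004383608 (acc b masks5 0 0) x := by
  intro x hx
  rw [mod4_tb, tyM]
  change _ = cond _ 1 0 + cond _ 2 0
  norm_num only at hx
  congr 2
  · interval_cases x <;>
    (simp only [rows5, Bf, Lk, Nat.reduceMod, Nat.reduceDiv, Nat.reduceEqDiff, if_true, if_false,
      Nat.testBit_xor, en0a, en1a, Nat.zero_testBit, Bool.xor_false, Bool.false_xor, zero_ne_one]; rfl)
  · interval_cases x <;>
    (simp only [rows5, acc, masks5, Bf, Lk, Nat.reduceMod, Nat.reduceDiv, Nat.reduceEqDiff, if_true, if_false,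
      Nat.testBit_xor, en0b, en1b, cond_tb, Nat.zero_testBit, Bool.xor_false, Bool.false_xor, zero_ne_one,
      Nat.zero_add, Nat.reduceAdd] ;
     simp only [Nat.testBit_eq_decide_div_mod_eq, Nat.reducePow, Nat.reduceMod, Nat.reduceDiv, Nat.reduceEqDiff,
      decide_true, decide_false, Bool.and_true, Bool.and_false, Bool.xor_false, Bool.false_xor, zero_ne_one] ;
     try ac_rfl)

lemma countP_compl (N a : ℕ) (p q : ℕ → Bool) (h : ∀ x < N, p x = !q x)
    (hp : (List.range N).countP p = a) : (List.range N).countP q = N - a := by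
  have h1 := List.length_eq_countP_add_countP q (l := List.range N)
  have h2 : (List.range N).countP (fun x => ¬ q x) = (List.range N).countP p := by
    apply List.countP_congr
    intro x hx
    rw [h x (List.mem_range.1 hx)]
    simp
  rw [List.length_range, h2, hp] at h1
  omega

lemma cnt_one (k Q1 Q a : ℕ) (rows : List (ℕ × List ℕ)) (N : ℕ) (hN : N = 8 * k)
    (hty : ∀ x < N, Bf rows x x % 4 = tyM Q1 Q x)
    (h : (List.range N).countP (fun x => Bf rows x x % 4 == 0 || Bf rows x x % 4 == 1 % 4) = a) :
    cnt k Q = N - a := by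
  rw [cnt_eq, ← hN]
  refine countP_compl N a _ _ ?_ h
  intro x hx
  rw [hty x hx, tyM]
  cases Q1.testBit x <;> cases Q.testBit x <;> rfl

lemma cnt_three (k Q1 Q a : ℕ) (rows : List (ℕ × List ℕ)) (N : ℕ) (hN : N = 8 * k)
    (hty : ∀ x < N, Bf rows x x % 4 = tyM Q1 Q x)
    (h : (List.range N).countP (fun x => Bf rows x x % 4 == 0 || Bf rows x x % 4 == 3 % 4) = a) :
    cnt k (Nat.xor Q Q1) = N - a := by
  rw [cnt_eq, ← hN]
  refine countP_compl N a _ _ ?_ h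
  intro x hx
  have : (Nat.xor Q Q1).testBit x = (Q.testBit x ^^ Q1.testBit x) := Nat.testBit_xor ..
  rw [hty x hx, tyM, this]
  cases Q1.testBit x <;> cases Q.testBit x <;> rfl

section
variable {G : Type*} [Group G]

lemma cf_use {c n : G} {m : ℕ} {rows : List (ℕ × List ℕ)} {l : List G} (H : TwoC c n m rows l)
    (k Q1 Q a e : ℕ) (he : m = e + 1) (hN : 2 ^ m = 8 * k)
    (hty : ∀ x < 2 ^ m, Bf rows x x % 4 = tyM Q1 Q x) (ha : a ≤ 2 ^ m)
    (h1 : Nat.card {g : G // g * g = 1 ∨ g * g = Z2 c n 1} = a * 4)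
    (h3 : Nat.card {g : G // g * g = 1 ∨ g * g = Z2 c n 3} = a * 4)
    (hchk : chk k (2 ^ e) Q1 (2 ^ m - a) Q = true) : ¬ Filled G := by
  rw [H.count] at h1 h3
  have e1 := cnt_one k Q1 Q a rows (2 ^ m) hN hty (by omega)
  have e3 := cnt_three k Q1 Q a rows (2 ^ m) hN hty (by omega)
  rw [chk, e1, e3] at hchk
  have hb : Nat.beq (2 ^ m - a) (2 ^ m - a) = true := by simp
  rw [hb, cond_true, cond_true] at hchk
  simp only [cfCond, Bool.and_eq_true, Bool.or_eq_true, List.any_eq_true, List.all_eq_true, List.mem_range,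
    Nat.beq_eq] at hchk
  obtain ⟨⟨w1, hw1, t1⟩, ⟨w2, hw2, t2⟩, ⟨w3, hw3, t3⟩, hc⟩ := hchk
  have h2 : 2 ^ m = 2 * 2 ^ e := by rw [he, pow_succ, mul_comm]
  refine H.notFilled (2 ^ e) h2 ⟨e, rfl⟩ (tyM Q1 Q) hty
    ⟨2 ^ e + w1, by omega, by omega, t1⟩ ⟨2 ^ e + w2, by omega, by omega, t2⟩
    ⟨2 ^ e + w3, by omega, by omega, t3⟩ ?_
  intro u hu hu0 hu1
  rcases hc u hu with h | h | ⟨t, ht, h⟩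
  · exact absurd h hu0
  · exact absurd h hu1
  · exact ⟨2 ^ e + t, by omega, by omega, h⟩

lemma notFilled4 {c n : G} {b : ℕ → Bool} {l : List G} (H : TwoC c n 4 (rows4 b) l)
    (h1 : Nat.card {g : G // g * g = 1 ∨ g * g = c} = 24)
    (h3 : Nat.card {g : G // g * g = 1 ∨ g * g = c * n} = 24) : ¬ Filled G := by
  refine cf_use H 2 30584 _ 6 3 rfl (by norm_num) (ty4 b) (by norm_num) ?_ ?_
    (enum_spec _ b masks4 0 0 enum4)
  · simpa [Z2] using h1
  · simpa [Z2] using h3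

lemma notFilled5 {c n : G} {b : ℕ → Bool} {l : List G} (H : TwoC c n 5 (rows5 b) l)
    (h1 : Nat.card {g : G // g * g = 1 ∨ g * g = c} = 48)
    (h3 : Nat.card {g : G // g * g = 1 ∨ g * g = c * n} = 48) : ¬ Filled G := by
  refine cf_use H 4 2004383608 _ 12 4 rfl (by norm_num) (ty5 b) (by norm_num) ?_ ?_
    (enum_spec _ b masks5 0 0 enum5)
  · simpa [Z2] using h1
  · simpa [Z2] using h3
end

open Pointwise

section lifts
variable {G : Type*} [Group G]

lemma comm_lift {n : G} (hnc : ∀ g, n * g = g * n) {x p q c : G} {i j k : Bool}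
    (h1 : x * p = p * x * cond i n 1) (h2 : x * q = q * x * cond j n 1)
    (h : q * p = p * q * c * cond k n 1) : x * c = c * x := by
  have hN : ∀ (b : Bool) (g : G), cond b n 1 * g = g * cond b n 1 := by
    intro b g; cases b <;> simp [hnc]
  have hI := hN i
  have hJ := hN j
  have hK := hN k
  generalize cond i n 1 = I at *
  generalize cond j n 1 = J at *
  generalize cond k n 1 = K at *
  have e1 : x * (q * p) = (q * p) * x * (J * I) := by
    calc x * (q * p) = (x * q) * p := by group
      _ = q * x * (J * p) := by rw [h2]; group
      _ = q * (x * p) * J := by rw [hJ]; group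
      _ = q * p * x * (I * J) := by rw [h1]; group
      _ = _ := by rw [hI]
  have e2 : x * (p * q) = (p * q) * x * (J * I) := by
    calc x * (p * q) = (x * p) * q := by group
      _ = p * x * (I * q) := by rw [h1]; group
      _ = p * (x * q) * I := by rw [hI]; group
      _ = _ := by rw [h2]; group
  have e3 : (p * q) * (x * c) * (J * I) * K = (p * q) * (c * x) * (J * I) * K := by
    calc (p * q) * (x * c) * (J * I) * K = (p * q) * x * (c * J) * I * K := by group
      _ = (p * q) * x * J * (c * I) * K := by rw [← hJ]; group
      _ = (p * q) * x * (J * I) * c * K := by rw [← hI]; group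
      _ = x * (p * q * c * K) := by rw [← e2]; group
      _ = p * q * c * (K * (x * (J * I))) := by rw [← h, e1, h]; group
      _ = _ := by rw [hK]; group
  exact mul_left_cancel (mul_right_cancel (mul_right_cancel e3))

lemma sq_lift {n : G} (hn : n * n = 1) (hnc : ∀ g, n * g = g * n) {p q c : G} {i k : Bool}
    (hcp : p * c = c * p) (h1 : p * p = cond i n 1) (h : q * p = p * q * c * cond k n 1) : c * c = 1 := by
  have hN : ∀ (b : Bool) (g : G), cond b n 1 * g = g * cond b n 1 := by
    intro b g; cases b <;> simp [hnc]
  have hI := hN i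
  have hK := hN k
  have hKK : cond k n 1 * cond k n 1 = 1 := by cases k <;> simp [hn]
  generalize cond i n 1 = I at *
  generalize cond k n 1 = K at *
  have e : p * p * q * (c * c) = p * p * q * 1 := by
    calc p * p * q * (c * c) = p * p * q * c * c * (K * K) := by rw [hKK]; group
      _ = p * (p * q * c * K) * c * K := by
        rw [← mul_assoc, mul_assoc _ c K, ← hK c]; group
      _ = p * q * (p * c) * K := by rw [← h]; group
      _ = p * q * c * (p * K) := by rw [hcp]; group
      _ = (p * q * c * K) * p := by rw [← hK]; group
      _ = q * (p * p) := by rw [← h]; group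
      _ = p * p * q * 1 := by rw [h1, ← hI, mul_one]
  exact mul_left_cancel e

lemma comm_Pl {c : G} : ∀ (l : List G), (∀ a ∈ l, a * c = c * a) → ∀ x, Pl l x * c = c * Pl l x
  | [], _, x => by simp [Pl]
  | a :: l, h, x => by
    have ih := comm_Pl l (fun b hb => h b (List.mem_cons_of_mem _ hb)) (x / 2)
    have ha := h a (List.mem_cons_self)
    rw [Pl]
    split_ifs
    · rw [mul_assoc, ih, ← mul_assoc, ha, mul_assoc]
    · rw [one_mul, ih]

lemma Z2en0 (c n : G) (b : Bool) : Z2 c n (en 0 b) = cond b n 1 := by cases b <;> simp [Z2, en]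
lemma Z2en1 (c n : G) (b : Bool) : Z2 c n (en 1 b) = c * cond b n 1 := by cases b <;> simp [Z2, en]

section
variable {Q : Type*} [Group Q] {φ : G →* Q} {n : G}

lemma lift_eq (hk : ∀ g, φ g = 1 ↔ g = 1 ∨ g = n) {x y : G} (h : φ x = φ y) :
    ∃ b : Bool, x = y * cond b n 1 := by
  have : φ (y⁻¹ * x) = 1 := by rw [map_mul, map_inv, h]; group
  rcases (hk _).1 this with h | h
  · exact ⟨false, by rw [cond_false, mul_one]; exact (inv_mul_eq_one.1 h).symm⟩
  · exact ⟨true, by rw [cond_true, ← h]; group⟩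

lemma surj_lift (hk : ∀ g, φ g = 1 ↔ g = 1 ∨ g = n) {m : ℕ} {c : G} {l : List G}
    (hs : ∀ q : Q, ∃ x < 2 ^ m, ∃ e, q = Pl (l.map φ) x * Z1 (φ c) e) :
    ∀ g : G, ∃ x < 2 ^ m, ∃ e, g = Pl l x * Z2 c n e := by
  intro g
  obtain ⟨x, hx, e, he⟩ := hs (φ g)
  rw [← Pl_map, ← Z1_map, ← map_mul] at he
  obtain ⟨b, hb⟩ := lift_eq hk he
  refine ⟨x, hx, e % 2 + cond b 2 0, ?_⟩
  rw [hb, mul_assoc]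
  congr 1
  have : e % 2 < 2 := Nat.mod_lt _ (by norm_num)
  cases b <;> rcases (by omega : e % 2 = 0 ∨ e % 2 = 1) with h | h <;> simp [Z1, Z2, h]

lemma cen_lift (hk : ∀ g, φ g = 1 ↔ g = 1 ∨ g = n) (hnc : ∀ g, n * g = g * n) {m : ℕ} {c : G} {l : List G}
    (hs : ∀ q : Q, ∃ x < 2 ^ m, ∃ e, q = Pl (l.map φ) x * Z1 (φ c) e)
    (hl : ∀ a ∈ l, a * c = c * a) : ∀ g, c * g = g * c := by
  intro g
  obtain ⟨x, hx, e, rfl⟩ := surj_lift hk hs g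
  have h1 := comm_Pl l hl x
  have h2 : c * Z2 c n e = Z2 c n e * c := by
    unfold Z2; split_ifs <;> simp [hnc, mul_assoc]
  rw [mul_assoc, ← h2, ← mul_assoc, ← h1, mul_assoc]

theorem two4 (hφ : Function.Surjective φ) (hk : ∀ g, φ g = 1 ↔ g = 1 ∨ g = n)
    (hn : n * n = 1) (hnc : ∀ g, n * g = g * n) (hQ : Coord Q 4 rowsH 0) (hcard : Nat.card G = 64) :
    ∃ (c : G) (b : ℕ → Bool) (l : List G), TwoC c n 4 (rows4 b) l := by
  obtain ⟨z', l', hz, hz1, hzc, hR, hs, -⟩ := hQ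
  obtain ⟨c, rfl⟩ := hφ z'
  rcases l' with _ | ⟨q1, _ | ⟨q2, _ | ⟨q3, _ | ⟨q4, _ | ⟨q5, l'⟩⟩⟩⟩⟩ <;> try (simp [GRel, CommRel, rowsH] at hR; done)
  obtain ⟨a1, rfl⟩ := hφ q1
  obtain ⟨a2, rfl⟩ := hφ q2
  obtain ⟨a3, rfl⟩ := hφ q3
  obtain ⟨a4, rfl⟩ := hφ q4
  simp only [GRel, CommRel, rowsH, and_true, ← map_mul, ← Z1_map] at hR
  obtain ⟨r0, ⟨r1, r2, r3⟩, r4, ⟨r5, r6⟩, r7, r8, r9⟩ := hR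
  obtain ⟨b0, h0⟩ := lift_eq hk r0
  obtain ⟨b1, h1⟩ := lift_eq hk r1
  obtain ⟨b2, h2⟩ := lift_eq hk r2
  obtain ⟨b3, h3⟩ := lift_eq hk r3
  obtain ⟨b4, h4⟩ := lift_eq hk r4
  obtain ⟨b5, h5⟩ := lift_eq hk r5
  obtain ⟨b6, h6⟩ := lift_eq hk r6
  obtain ⟨b7, h7⟩ := lift_eq hk r7
  obtain ⟨b8, h8⟩ := lift_eq hk r8
  obtain ⟨b9, h9⟩ := lift_eq hk r9
  have z0 : Z1 c 0 = 1 := rfl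
  have z1 : Z1 c 1 = c := rfl
  simp only [z0, z1, mul_one, one_mul] at h0 h1 h2 h3 h4 h5 h6 h7 h8 h9
  have flip : ∀ {x y : G} {b : Bool}, x * y = y * x * cond b n 1 → y * x = x * y * cond b n 1 := by
    intro x y b h
    rw [h]; cases b <;> simp [mul_assoc, hn]
  have c3 : a3 * c = c * a3 := comm_lift hnc h2 h5 h1
  have c4 : a4 * c = c * a4 := comm_lift hnc h3 h6 h1
  have c1 : a1 * c = c * a1 := comm_lift hnc (flip h2) (flip h3) h8
  have c2 : a2 * c = c * a2 := comm_lift hnc (flip h5) (flip h6) h8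
  have hcc : c * c = 1 := sq_lift hn hnc c1 h0 h1
  have hs' : ∀ q : Q, ∃ x < 2 ^ 4, ∃ e, q = Pl ([a1, a2, a3, a4].map φ) x * Z1 (φ c) e := hs
  have hcen := cen_lift hk hnc hs' (by
    intro a ha
    simp only [List.mem_cons, List.not_mem_nil, or_false] at ha
    rcases ha with rfl | rfl | rfl | rfl <;> assumption)
  refine ⟨c, fun i => [b0, b1, b2, b3, b4, b5, b6, b7, b8, b9].getD i false, [a1, a2, a3, a4],
    hcc, hn, hcen, hnc, ?_, surj_lift hk hs', by rw [hcard]; norm_num⟩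
  simp only [GRel, CommRel, rows4, Z2en0, Z2en1, List.getD_cons_zero, List.getD_cons_succ, and_true, ← mul_assoc]
  exact ⟨h0, ⟨h1, h2, h3⟩, h4, ⟨h5, h6⟩, h7, h8, h9⟩

theorem two5 (hφ : Function.Surjective φ) (hk : ∀ g, φ g = 1 ↔ g = 1 ∨ g = n)
    (hn : n * n = 1) (hnc : ∀ g, n * g = g * n) (hQ : Coord Q 5 rowsHC 16) (hcard : Nat.card G = 128) :
    ∃ (c : G) (b : ℕ → Bool) (l : List G), TwoC c n 5 (rows5 b) l := by
  obtain ⟨z', l', hz, hz1, hzc, hR, hs, -⟩ := hQ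
  obtain ⟨c, rfl⟩ := hφ z'
  rcases l' with _ | ⟨q1, _ | ⟨q2, _ | ⟨q3, _ | ⟨q4, _ | ⟨q5, _ | ⟨q6, l'⟩⟩⟩⟩⟩⟩ <;>
    try (simp [GRel, CommRel, rowsHC] at hR; done)
  obtain ⟨a1, rfl⟩ := hφ q1
  obtain ⟨a2, rfl⟩ := hφ q2
  obtain ⟨a3, rfl⟩ := hφ q3
  obtain ⟨a4, rfl⟩ := hφ q4
  obtain ⟨a5, rfl⟩ := hφ q5
  simp only [GRel, CommRel, rowsHC, and_true, ← map_mul, ← Z1_map] at hR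
  obtain ⟨r0, ⟨r1, r2, r3, r4⟩, r5, ⟨r6, r7, r8⟩, r9, ⟨r10, r11⟩, r12, r13, r14⟩ := hR
  obtain ⟨b0, h0⟩ := lift_eq hk r0
  obtain ⟨b1, h1⟩ := lift_eq hk r1
  obtain ⟨b2, h2⟩ := lift_eq hk r2
  obtain ⟨b3, h3⟩ := lift_eq hk r3
  obtain ⟨b4, h4⟩ := lift_eq hk r4
  obtain ⟨b5, h5⟩ := lift_eq hk r5
  obtain ⟨b6, h6⟩ := lift_eq hk r6
  obtain ⟨b7, h7⟩ := lift_eq hk r7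
  obtain ⟨b8, h8⟩ := lift_eq hk r8
  obtain ⟨b9, h9⟩ := lift_eq hk r9
  obtain ⟨b10, h10⟩ := lift_eq hk r10
  obtain ⟨b11, h11⟩ := lift_eq hk r11
  obtain ⟨b12, h12⟩ := lift_eq hk r12
  obtain ⟨b13, h13⟩ := lift_eq hk r13
  obtain ⟨b14, h14⟩ := lift_eq hk r14
  have z0 : Z1 c 0 = 1 := rfl
  have z1 : Z1 c 1 = c := rfl
  simp only [z0, z1, mul_one, one_mul] at h0 h1 h2 h3 h4 h5 h6 h7 h8 h9 h10 h11 h12 h13 h14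
  have flip : ∀ {x y : G} {b : Bool}, x * y = y * x * cond b n 1 → y * x = x * y * cond b n 1 := by
    intro x y b h
    rw [h]; cases b <;> simp [mul_assoc, hn]
  have c3 : a3 * c = c * a3 := comm_lift hnc h2 h6 h1
  have c4 : a4 * c = c * a4 := comm_lift hnc h3 h7 h1
  have c5 : a5 * c = c * a5 := comm_lift hnc h4 h8 h1
  have c1 : a1 * c = c * a1 := comm_lift hnc (flip h2) (flip h3) h10
  have c2 : a2 * c = c * a2 := comm_lift hnc (flip h6) (flip h7) h10
  have hcc : c * c = 1 := sq_lift hn hnc c1 h0 h1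
  have hs' : ∀ q : Q, ∃ x < 2 ^ 5, ∃ e, q = Pl ([a1, a2, a3, a4, a5].map φ) x * Z1 (φ c) e := hs
  have hcen := cen_lift hk hnc hs' (by
    intro a ha
    simp only [List.mem_cons, List.not_mem_nil, or_false] at ha
    rcases ha with rfl | rfl | rfl | rfl | rfl <;> assumption)
  refine ⟨c, fun i => [b0, b1, b2, b3, b4, b5, b6, b7, b8, b9, b10, b11, b12, b13, b14].getD i false,
    [a1, a2, a3, a4, a5], hcc, hn, hcen, hnc, ?_, surj_lift hk hs', by rw [hcard]; norm_num⟩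
  simp only [GRel, CommRel, rows5, Z2en0, Z2en1, List.getD_cons_zero, List.getD_cons_succ, and_true, ← mul_assoc]
  exact ⟨h0, ⟨h1, h2, h3, h4⟩, h5, ⟨h6, h7, h8⟩, h9, ⟨h10, h11⟩, h12, h13, h14⟩
end
end lifts

open Pointwise

/-- Multiplication of codes `r^i n^l a^j e^k ↦ i + 4 l + 8 j + 16 k`. -/
def mulc (ka al de be ga ep x y : ℕ) : ℕ :=
  let i := x % 4
  let j := x / 8 % 2
  let k := x / 16 % 2
  let i' := y % 4
  let j' := y / 8 % 2
  let k' := y / 16 % 2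
  let s := i + (if j = 1 then (4 - i') % 4 else i')
  let t := x / 4 % 2 + y / 4 % 2 + be * (k * i') + ga * (k * j') + de * (j * j') + ep * (k * k') +
    (if j = 1 ∧ i' ≠ 0 then al * i' + ka else 0) + ka * (s / 4)
  s % 4 + 4 * (t % 2) + 8 * ((j + j') % 2) + 16 * ((k + k') % 2)

def lmCheck (N : ℕ) (f : ℕ → ℕ → ℕ) (S : List ℕ) : Bool :=
  (S.all fun a => Nat.blt a N && S.all fun b => !S.elem (f a b) && !Nat.beq (f a b) 1) && (!S.elem 1 &&
  (List.range N).all fun h => S.elem h || (Nat.beq h 0 || (S.elem (f h h) ||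
    ((S.any fun a => S.elem (f h a)) || ((S.any fun a => S.elem (f a h)) ||
    S.any fun a => S.any fun b => Nat.beq h (f a b))))))

def zCheck (N : ℕ) (f : ℕ → ℕ → ℕ) : Bool :=
  Nat.beq (f 2 2) 0 && (List.range N).all fun x => Nat.beq (f 2 x) (f x 2) &&
    (Nat.beq (f x x) 0 || Nat.beq (f x x) 2)

def pCheck (N : ℕ) (f : ℕ → ℕ → ℕ) (S : List ℕ) : Bool := zCheck N f || lmCheck N f S

def tab16 : List (List ℕ) :=
  [[], [2, 3, 8, 12],
  [2, 4, 8, 14], [2, 3, 8, 12],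
  [2, 4], [2, 3, 8, 12],
  [2, 4, 9, 15], [2, 3, 8, 12]]
def tab32 : List (List ℕ) :=
  [[], [2, 3, 8, 12, 16, 20, 25, 29],
  [2, 4, 8, 14, 16, 22, 26, 28], [2, 3, 8, 12, 16, 20, 25, 29],
  [2, 4, 16, 22], [2, 3, 8, 12, 16, 20, 25, 29],
  [2, 4, 9, 15, 16, 22, 27, 29], [2, 3, 8, 12, 16, 20, 25, 29],
  [2, 8, 14, 17, 23, 26, 30], [2, 3, 8, 12, 16, 20, 25, 29],
  [2, 8, 12, 18, 20, 25, 31], [2, 3, 8, 12, 16, 20, 25, 29],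
  [2, 8, 12, 16, 22, 25, 31], [2, 3, 8, 12, 16, 20, 25, 29],
  [2, 10, 14, 16, 22, 27, 31], [2, 3, 8, 12, 16, 20, 25, 29],
  [2, 11, 15, 18, 20, 26, 30], [2, 3, 8, 12, 16, 20, 25, 29],
  [2, 4, 8, 14, 16, 22, 25, 31], [2, 3, 8, 12, 16, 20, 25, 29],
  [2, 11, 15, 16, 22, 24, 30], [2, 3, 8, 12, 16, 20, 25, 29],
  [2, 4, 9, 15, 16, 22, 24, 30], [2, 3, 8, 12, 16, 20, 25, 29],
  [2, 11, 13, 17, 23, 27, 31], [2, 3, 8, 12, 16, 20, 25, 29],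
  [2, 10, 14, 18, 20, 27, 31], [2, 3, 8, 12, 16, 20, 25, 29],
  [2, 9, 13, 18, 20, 24, 28], [2, 3, 8, 12, 16, 20, 25, 29],
  [2, 9, 13, 17, 23, 25, 31], [2, 3, 8, 12, 16, 20, 25, 29],
  [7, 10, 14, 16, 17, 24, 28], [2, 3, 8, 12, 16, 17, 26, 30],
  [2, 4, 8, 14, 17, 23, 27, 29], [2, 3, 8, 12, 16, 17, 26, 30],
  [7, 22, 23, 25, 27, 29, 31], [2, 3, 8, 12, 16, 17, 26, 30],
  [2, 4, 9, 15, 17, 23, 24, 30], [2, 3, 8, 12, 16, 17, 26, 30],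
  [2, 8, 14, 18, 22, 25, 31], [2, 3, 8, 12, 16, 20, 25, 29],
  [2, 4, 8, 14], [2, 3, 8, 12, 16, 20, 25, 29],
  [2, 4, 24, 30], [2, 3, 8, 12, 16, 20, 25, 29],
  [2, 9, 15, 18, 22, 26, 28], [2, 3, 8, 12, 16, 20, 25, 29],
  [7, 22, 23, 25, 27, 29, 31], [2, 3, 8, 12, 16, 17, 26, 30],
  [2, 4, 8, 14, 17, 23, 24, 30], [2, 3, 8, 12, 16, 17, 26, 30],
  [2, 4, 17, 23], [2, 3, 8, 12, 16, 17, 26, 30],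
  [2, 4, 9, 15, 17, 23, 25, 31], [2, 3, 8, 12, 16, 17, 26, 30],
  [2, 11, 13, 18, 22, 26, 28], [2, 3, 8, 12, 16, 20, 25, 29],
  [2, 10, 12, 16, 20, 25, 31], [2, 3, 8, 12, 16, 20, 25, 29],
  [2, 4, 25, 31], [2, 3, 8, 12, 16, 20, 25, 29],
  [2, 4, 9, 15], [2, 3, 8, 12, 16, 20, 25, 29]]

lemma check16 : ∀ ka < 2, ∀ al < 2, ∀ de < 2,
    pCheck 16 (mulc ka al de 0 0 0) (tab16.getD (ka + 2 * al + 4 * de) []) = true := by decide +kernel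

set_option maxRecDepth 100000 in
lemma check32 : ∀ ka < 2, ∀ al < 2, ∀ de < 2, ∀ be < 2, ∀ ga < 2, ∀ ep < 2,
    pCheck 32 (mulc ka al de be ga ep)
      (tab32.getD (ka + 2 * al + 4 * de + 8 * be + 16 * ga + 32 * ep) []) = true := by decide +kernel

section codes
variable {G : Type*} [Group G]

/-- A group described by codes. -/
structure CodeG (E : ℕ → G) (N : ℕ) (f : ℕ → ℕ → ℕ) : Prop where
  mul : ∀ x < N, ∀ y < N, E x * E y = E (f x y)
  lt : ∀ x < N, ∀ y < N, f x y < N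
  surj : ∀ g : G, ∃ x < N, g = E x
  card : Nat.card G = N
  one : E 0 = 1
  big : 2 < N

lemma CodeG.inj {E : ℕ → G} {N : ℕ} {f : ℕ → ℕ → ℕ} (H : CodeG E N f) {x y : ℕ} (hx : x < N) (hy : y < N)
    (h : E x = E y) : x = y := by
  haveI : Finite G := Nat.finite_of_card_ne_zero (by rw [H.card]; have := H.big; omega)
  have hb : Function.Bijective (fun i : Fin N => E i) := by
    rw [Nat.bijective_iff_surjective_and_card]
    refine ⟨?_, by rw [H.card]; simp⟩
    intro g
    obtain ⟨x, hx, rfl⟩ := H.surj g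
    exact ⟨⟨x, hx⟩, rfl⟩
  have := @hb.1 ⟨x, hx⟩ ⟨y, hy⟩ h
  simpa using this

theorem CodeG.concl {E : ℕ → G} {N : ℕ} {f : ℕ → ℕ → ℕ} (H : CodeG E N f) {S : List ℕ}
    (hc : pCheck N f S = true) : (∃ z : G, ZSq z) ∨ ¬ Filled G := by
  have hbig := H.big
  rw [pCheck, Bool.or_eq_true] at hc
  rcases hc with hc | hc
  · left
    simp only [zCheck, Bool.and_eq_true, Bool.or_eq_true, List.all_eq_true, List.mem_range, Nat.beq_eq] at hc
    obtain ⟨h1, h2⟩ := hc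
    refine ⟨E 2, by rw [H.mul 2 hbig 2 hbig, h1, H.one], ?_, ?_, ?_⟩
    · intro h
      rw [← H.one] at h
      have := H.inj hbig (by omega) h
      omega
    · intro g
      obtain ⟨x, hx, rfl⟩ := H.surj g
      rw [H.mul 2 hbig x hx, H.mul x hx 2 hbig, (h2 x hx).1]
    · intro g
      obtain ⟨x, hx, rfl⟩ := H.surj g
      rw [H.mul x hx x hx]
      rcases (h2 x hx).2 with h | h
      · left; rw [h, H.one]
      · right; rw [h]
  · right
    simp only [lmCheck, Bool.and_eq_true, Bool.or_eq_true, List.all_eq_true, List.any_eq_true, List.mem_range,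
      Nat.beq_eq, List.elem_eq_mem, decide_eq_true_eq, Bool.not_eq_true', decide_eq_false_iff_not,
      Nat.blt_eq] at hc
    obtain ⟨h1, h2, h3⟩ := hc
    have hlt : ∀ a ∈ S, a < N := fun a ha => (h1 a ha).1
    let T : Set G := {g | ∃ a ∈ S, g = E a}
    have hT : ∀ x < N, (E x ∈ T ↔ x ∈ S) := by
      intro x hx
      constructor
      · rintro ⟨a, ha, h⟩
        rwa [H.inj hx (hlt a ha) h]
      · intro h; exact ⟨x, h, rfl⟩
    have hpf : ProductFree T := by
      rw [pf_iff]
      rintro _ ⟨a, ha, rfl⟩ _ ⟨b, hb, rfl⟩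
      rw [H.mul a (hlt a ha) b (hlt b hb), hT _ (H.lt a (hlt a ha) b (hlt b hb))]
      exact ((h1 a ha).2 b hb).1
    have hLM : LocallyMaximalPF T := by
      apply lm_of_blocked hpf
      intro g hg
      obtain ⟨x, hx, rfl⟩ := H.surj g
      rw [hT x hx] at hg
      rcases h3 x hx with h | h | h | ⟨a, ha, h⟩ | ⟨a, ha, h⟩ | ⟨a, ha, b, hb, h⟩
      · exact absurd h hg
      · left; rw [h, H.one]
      · right; right; right; right
        rw [H.mul x hx x hx]; exact ⟨_, h, rfl⟩
      · right; right; left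
        exact ⟨E a, ⟨a, ha, rfl⟩, by rw [H.mul x hx a (hlt a ha)]; exact ⟨_, h, rfl⟩⟩
      · right; right; right; left
        exact ⟨E a, ⟨a, ha, rfl⟩, by rw [H.mul a (hlt a ha) x hx]; exact ⟨_, h, rfl⟩⟩
      · right; left
        exact ⟨E a, ⟨a, ha, rfl⟩, E b, ⟨b, hb, rfl⟩, by rw [H.mul a (hlt a ha) b (hlt b hb), ← h]⟩
    intro hF
    have h11 : E 1 ≠ 1 := by
      intro h
      rw [← H.one] at h
      have := H.inj (by omega) (by omega) h
      omega
    rcases hF T hLM (E 1) h11 with h | ⟨_, ⟨a, ha, rfl⟩, _, ⟨b, hb, rfl⟩, h⟩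
    · rw [hT 1 (by omega)] at h; exact h2 h
    · simp only at h
      rw [H.mul a (hlt a ha) b (hlt b hb)] at h
      have := H.inj (H.lt a (hlt a ha) b (hlt b hb)) (by omega) h
      have h5 := ((h1 a ha).2 b hb).2
      simp [this] at h5
end codes

open Pointwise

section codemul
variable {G : Type*} [Group G]

def Ecode (r n a e : G) (x : ℕ) : G :=
  r ^ (x % 4) * a ^ (x / 8 % 2) * e ^ (x / 16 % 2) * n ^ (x / 4 % 2)

structure CRel (r n a e : G) (ka al de be ga ep : ℕ) : Prop where
  hn : n * n = 1
  hnc : ∀ g, n * g = g * n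
  hr : r ^ 4 = n ^ ka
  har : a * r = r ^ 3 * a * n ^ (al + ka)
  ha : a * a = n ^ de
  her : e * r = r * e * n ^ be
  hea : e * a = a * e * n ^ ga
  he : e * e = n ^ ep

namespace CRel
variable {r n a e : G} {ka al de be ga ep : ℕ} (H : CRel r n a e ka al de be ga ep)
include H

lemma nc (t : ℕ) (g : G) : n ^ t * g = g * n ^ t := by
  have : Commute n g := H.hnc g
  exact (this.pow_left t).eq

lemma nmod (t : ℕ) : n ^ t = n ^ (t % 2) := by
  conv_lhs => rw [← Nat.div_add_mod t 2, pow_add, pow_mul, pow_two, H.hn, one_pow, one_mul]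

lemma L1 (i : ℕ) : e * r ^ i = r ^ i * e * n ^ (be * i) := by
  induction i with
  | zero => simp
  | succ i ih =>
    rw [pow_succ, ← mul_assoc, ih, mul_assoc _ (n ^ _) r, H.nc, ← mul_assoc, mul_assoc _ e r, H.her, mul_add,
      pow_add]
    have := H.nc (be * i) (n ^ be)
    simp only [mul_assoc, mul_one, this]

lemma L1' {k : ℕ} (hk : k < 2) (i : ℕ) : e ^ k * r ^ i = r ^ i * e ^ k * n ^ (be * (k * i)) := by
  interval_cases k
  · simp
  · simpa using H.L1 i

lemma L2 {k j : ℕ} (hk : k < 2) (hj : j < 2) : e ^ k * a ^ j = a ^ j * e ^ k * n ^ (ga * (k * j)) := by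
  interval_cases k <;> interval_cases j <;> simp [H.hea]

lemma L4 (s : ℕ) : r ^ s = r ^ (s % 4) * n ^ (ka * (s / 4)) := by
  rw [pow_mul, ← H.hr, ← pow_mul, ← pow_add, Nat.mod_add_div]

lemma L5 {j j' : ℕ} (hj : j < 2) (hj' : j' < 2) : a ^ j * a ^ j' = a ^ ((j + j') % 2) * n ^ (de * (j * j')) := by
  interval_cases j <;> interval_cases j' <;> simp [H.ha]

lemma L6 {j j' : ℕ} (hj : j < 2) (hj' : j' < 2) : e ^ j * e ^ j' = e ^ ((j + j') % 2) * n ^ (ep * (j * j')) := by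
  interval_cases j <;> interval_cases j' <;> simp [H.he]

lemma L3a (i : ℕ) : a * r ^ i = r ^ (3 * i) * a * n ^ ((al + ka) * i) := by
  have h := H.har
  generalize al + ka = q at *
  induction i with
  | zero => simp
  | succ i ih =>
    rw [pow_succ, ← mul_assoc, ih, mul_assoc _ (n ^ _) r, H.nc, ← mul_assoc, mul_assoc _ a r, h, mul_add,
      mul_add, pow_add, pow_add]
    have := H.nc (q * i) (n ^ q)
    simp only [mul_assoc, mul_one, this]

lemma npar {s t : ℕ} (h : s % 2 = t % 2) : n ^ s = n ^ t := by
  rw [H.nmod s, H.nmod t, h]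

lemma L3 {i j : ℕ} (hi : i < 4) (hj : j < 2) : a ^ j * r ^ i =
    r ^ (if j = 1 then (4 - i) % 4 else i) * a ^ j * n ^ (if j = 1 ∧ i ≠ 0 then al * i + ka else 0) := by
  interval_cases j
  · simp
  · rw [pow_one, H.L3a, H.L4 (3 * i), mul_assoc _ (n ^ _) a, H.nc, ← mul_assoc, mul_assoc _ (n ^ _), ← pow_add]
    have key : (ka * (3 * i / 4) + (al + ka) * i) % 2 = (if 1 = 1 ∧ i ≠ 0 then al * i + ka else 0) % 2 := by
      interval_cases i <;> norm_num <;> omega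
    rw [H.npar key]
    congr 2
    simp only [reduceIte]
    congr 1
    interval_cases i <;> rfl

lemma mul (x y : ℕ) :
    Ecode r n a e x * Ecode r n a e y = Ecode r n a e (mulc ka al de be ga ep x y) := by
  have hi : x % 4 < 4 := Nat.mod_lt _ (by norm_num)
  have hi' : y % 4 < 4 := Nat.mod_lt _ (by norm_num)
  have hj : x / 8 % 2 < 2 := Nat.mod_lt _ (by norm_num)
  have hj' : y / 8 % 2 < 2 := Nat.mod_lt _ (by norm_num)
  have hk : x / 16 % 2 < 2 := Nat.mod_lt _ (by norm_num)
  have hk' : y / 16 % 2 < 2 := Nat.mod_lt _ (by norm_num)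
  unfold Ecode mulc
  dsimp only
  generalize x % 4 = i at *
  generalize y % 4 = i' at *
  generalize x / 8 % 2 = j at *
  generalize y / 8 % 2 = j' at *
  generalize x / 16 % 2 = k at *
  generalize y / 16 % 2 = k' at *
  generalize x / 4 % 2 = l at *
  generalize y / 4 % 2 = l' at *
  have h3 := H.L3 hi' hj
  generalize (if j = 1 then (4 - i') % 4 else i') = i'' at *
  generalize (if j = 1 ∧ i' ≠ 0 then al * i' + ka else 0) = u at *
  generalize ht : (l + l' + be * (k * i') + ga * (k * j') + de * (j * j') + ep * (k * k') + u +
        ka * ((i + i'') / 4)) = t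
  have q1 : ((i + i'') % 4 + 4 * (t % 2) + 8 * ((j + j') % 2) + 16 * ((k + k') % 2)) % 4 = (i + i'') % 4 := by omega
  have q2 : ((i + i'') % 4 + 4 * (t % 2) + 8 * ((j + j') % 2) + 16 * ((k + k') % 2)) / 4 % 2 = t % 2 := by omega
  have q3 : ((i + i'') % 4 + 4 * (t % 2) + 8 * ((j + j') % 2) + 16 * ((k + k') % 2)) / 8 % 2 = (j + j') % 2 := by omega
  have q4 : ((i + i'') % 4 + 4 * (t % 2) + 8 * ((j + j') % 2) + 16 * ((k + k') % 2)) / 16 % 2 = (k + k') % 2 := by omega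
  rw [q1, q2, q3, q4, ← H.nmod]
  have c1 := H.L1' hk i'
  have c2 := H.L2 hk hj'
  have c4 := H.L4 (i + i'')
  have c5 := H.L5 hj hj'
  have c6 := H.L6 hk hk'
  calc r ^ i * a ^ j * e ^ k * n ^ l * (r ^ i' * a ^ j' * e ^ k' * n ^ l')
      = r ^ i * a ^ j * e ^ k * (n ^ l * (r ^ i' * a ^ j' * e ^ k' * n ^ l')) := by group
    _ = r ^ i * a ^ j * (e ^ k * r ^ i') * a ^ j' * e ^ k' * (n ^ l' * n ^ l) := by rw [H.nc]; simp only [mul_assoc]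
    _ = r ^ i * (a ^ j * r ^ i') * e ^ k * (n ^ (be * (k * i')) * (a ^ j' * e ^ k' * (n ^ l' * n ^ l))) := by
        rw [c1]; simp only [mul_assoc]
    _ = r ^ i * r ^ i'' * a ^ j * (n ^ u * (e ^ k * a ^ j' * e ^ k' * (n ^ l' * n ^ l) * n ^ (be * (k * i')))) := by
        rw [H.nc (be * (k * i')), h3]; simp only [mul_assoc]
    _ = r ^ (i + i'') * a ^ j * (e ^ k * a ^ j') * e ^ k' * ((n ^ l' * n ^ l) * n ^ (be * (k * i')) * n ^ u) := by
        rw [H.nc u, pow_add]; simp only [mul_assoc]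
    _ = r ^ (i + i'') * (a ^ j * a ^ j') * e ^ k * (n ^ (ga * (k * j')) * (e ^ k' *
          ((n ^ l' * n ^ l) * n ^ (be * (k * i')) * n ^ u))) := by
        rw [c2]; simp only [mul_assoc]
    _ = r ^ (i + i'') * (a ^ j * a ^ j') * (e ^ k * e ^ k') *
          ((n ^ l' * n ^ l) * n ^ (be * (k * i')) * n ^ u * n ^ (ga * (k * j'))) := by
        rw [H.nc (ga * (k * j'))]; simp only [mul_assoc]
    _ = r ^ ((i + i'') % 4) * (n ^ (ka * ((i + i'') / 4)) * (a ^ ((j + j') % 2) *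
          (n ^ (de * (j * j')) * (e ^ ((k + k') % 2) * (n ^ (ep * (k * k')) *
          ((n ^ l' * n ^ l) * n ^ (be * (k * i')) * n ^ u * n ^ (ga * (k * j')))))))) := by
        rw [c4, c5, c6]; simp only [mul_assoc]
    _ = r ^ ((i + i'') % 4) * a ^ ((j + j') % 2) * e ^ ((k + k') % 2) * (n ^ (ep * (k * k')) *
          ((n ^ l' * n ^ l) * n ^ (be * (k * i')) * n ^ u * n ^ (ga * (k * j'))) * n ^ (de * (j * j')) *
          n ^ (ka * ((i + i'') / 4))) := by
        rw [H.nc (de * (j * j')), H.nc (ka * ((i + i'') / 4))]; simp only [mul_assoc]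
    _ = _ := by
        simp only [← pow_add]
        congr 2
        omega

lemma code {N : ℕ} (hN : N = 16 ∨ N = 32) (hlt : ∀ x < N, ∀ y < N, mulc ka al de be ga ep x y < N)
    (hs : ∀ g, ∃ x < N, g = Ecode r n a e x) (hcard : Nat.card G = N) :
    CodeG (Ecode r n a e) N (mulc ka al de be ga ep) where
  mul x _ y _ := H.mul x y
  lt := hlt
  surj := by intro g; obtain ⟨x, hx, h⟩ := hs g; exact ⟨x, hx, by simp [h]⟩
  card := hcard
  one := by simp [Ecode]
  big := by omega

end CRel

lemma ncond (n : G) (b : Bool) : cond b n 1 = n ^ b.toNat := by cases b <;> simp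

lemma D_words {Q : Type*} [Group Q] {X Y Z : Q} (hx : X * X = 1) (hy : Y * Y = 1) (hz : Z * Z = 1)
    (hzc : ∀ g, Z * g = g * Z) (h : Y * X = X * Y * Z) :
    (X * Y) ^ 4 = 1 ∧ X * (X * Y) = (X * Y) ^ 3 * X ∧
    ∀ v t, ∃ i < 4, ∃ j < 2, (if v % 2 = 1 then X else 1) * (if v / 2 % 2 = 1 then Y else 1) * Z1 Z t =
      (X * Y) ^ i * X ^ j := by
  have r2 : (X * Y) ^ 2 = Z := by
    calc (X * Y) ^ 2 = X * (Y * X) * Y := by rw [pow_two]; group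
      _ = X * X * Y * (Z * Y) := by rw [h]; group
      _ = X * X * (Y * Y) * Z := by rw [hzc]; group
      _ = Z := by rw [hx, hy]; group
  have r4 : (X * Y) ^ 4 = 1 := by
    rw [show 4 = 2 * 2 from rfl, pow_mul, r2, pow_two, hz]
  have r1x : X * Y * X = Y * Z := by
    rw [mul_assoc, h, ← mul_assoc, ← mul_assoc, hx, one_mul]
  have r3x : (X * Y) ^ 3 * X = Y := by
    rw [pow_succ, r2, mul_assoc, r1x, hzc, mul_assoc, hz, mul_one]
  refine ⟨r4, by rw [r3x, ← mul_assoc, hx, one_mul], ?_⟩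
  intro v t
  unfold Z1
  by_cases h1 : v % 2 = 1 <;> by_cases h2 : v / 2 % 2 = 1 <;> by_cases h3 : t % 2 = 1 <;>
    simp only [h1, h2, h3, if_true, if_false, one_mul, mul_one]
  · exact ⟨3, by norm_num, 0, by norm_num, by rw [pow_zero, mul_one, pow_succ, r2, hzc]⟩
  · exact ⟨1, by norm_num, 0, by norm_num, by simp⟩
  · exact ⟨2, by norm_num, 1, by norm_num, by rw [r2, pow_one, hzc]⟩
  · exact ⟨0, by norm_num, 1, by norm_num, by simp⟩
  · exact ⟨1, by norm_num, 1, by norm_num, by rw [pow_one, pow_one, r1x]⟩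
  · exact ⟨3, by norm_num, 1, by norm_num, by rw [pow_one, r3x]⟩
  · exact ⟨2, by norm_num, 0, by norm_num, by rw [r2, pow_zero, mul_one]⟩
  · exact ⟨0, by norm_num, 0, by norm_num, by simp⟩

lemma toNat_lt' (b : Bool) : b.toNat < 2 := by cases b <;> simp

section
variable {Q : Type*} [Group Q] {φ : G →* Q} {n : G}

lemma par_al (hn : n * n = 1) (ka b : ℕ) : n ^ b = n ^ ((b + ka) % 2 + ka) := by
  have nmod : ∀ t, n ^ t = n ^ (t % 2) := fun t => by
    conv_lhs => rw [← Nat.div_add_mod t 2, pow_add, pow_mul, pow_two, hn, one_pow, one_mul]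
  rw [nmod b, nmod (_ + ka)]
  congr 1; omega

lemma E_lift (hk : ∀ g, φ g = 1 ↔ g = 1 ∨ g = n) {r a e g : G} {i j k : ℕ} (hi : i < 4) (hj : j < 2) (hk2 : k < 2)
    (h : φ g = φ r ^ i * φ a ^ j * φ e ^ k) : ∃ b < 2, g = Ecode r n a e (i + 4 * b + 8 * j + 16 * k) := by
  rw [← map_pow, ← map_pow, ← map_pow, ← map_mul, ← map_mul] at h
  obtain ⟨b, hb⟩ := lift_eq hk h
  refine ⟨b.toNat, toNat_lt' b, ?_⟩
  have hb2 := toNat_lt' b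
  rw [hb, ncond, Ecode]
  generalize b.toNat = b at *
  rw [show (i + 4 * b + 8 * j + 16 * k) % 4 = i by omega, show (i + 4 * b + 8 * j + 16 * k) / 4 % 2 = b by omega,
    show (i + 4 * b + 8 * j + 16 * k) / 8 % 2 = j by omega, show (i + 4 * b + 8 * j + 16 * k) / 16 % 2 = k by omega]

theorem quot_D (hφ : Function.Surjective φ) (hk : ∀ g, φ g = 1 ↔ g = 1 ∨ g = n)
    (hn : n * n = 1) (hnc : ∀ g, n * g = g * n) (hQ : Coord Q 2 rowsD 0) (hcard : Nat.card G = 16) :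
    (∃ z : G, ZSq z) ∨ ¬ Filled G := by
  obtain ⟨z', l', hz, hz1, hzc, hR, hs, -⟩ := hQ
  rcases l' with _ | ⟨q1, _ | ⟨q2, _ | ⟨q3, l'⟩⟩⟩ <;> try (simp [GRel, CommRel, rowsD] at hR; done)
  obtain ⟨a, rfl⟩ := hφ q1
  obtain ⟨y, rfl⟩ := hφ q2
  have z0 : Z1 z' 0 = 1 := rfl
  have z1 : Z1 z' 1 = z' := rfl
  simp only [GRel, CommRel, rowsD, and_true, z0, z1] at hR
  obtain ⟨ra, rya, ry⟩ := hR
  obtain ⟨w4, w3, hw⟩ := D_words ra ry hz hzc rya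
  rw [← map_mul] at ra w4 w3 hw
  rw [← map_one φ] at ra
  rw [← map_pow, ← map_one φ] at w4
  rw [← map_pow, ← map_mul, ← map_mul] at w3
  generalize a * y = r at *
  obtain ⟨ka, h4⟩ := lift_eq hk w4
  obtain ⟨al', h3⟩ := lift_eq hk w3
  obtain ⟨de, h2⟩ := lift_eq hk ra
  rw [ncond, one_mul] at h4 h2
  rw [ncond, par_al hn ka.toNat] at h3
  have H : CRel r n a 1 ka.toNat ((al'.toNat + ka.toNat) % 2) de.toNat 0 0 0 :=
    ⟨hn, hnc, h4, h3, h2, by simp, by simp, by simp⟩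
  have hc := H.code (N := 16) (Or.inl rfl) (by
    intro x hx y hy
    have e1 : x / 16 % 2 = 0 := by omega
    have e2 : y / 16 % 2 = 0 := by omega
    unfold mulc
    dsimp only
    rw [e1, e2]
    omega) (by
    intro g
    obtain ⟨v, hv, t, h⟩ := hs (φ g)
    obtain ⟨i, hi, j, hj, hw⟩ := hw v t
    simp only [Pl, mul_one] at h
    rw [hw] at h
    obtain ⟨b, hb, hg⟩ := E_lift hk (r := r) (a := a) (e := 1) (g := g) hi hj (k := 0) (by norm_num) (by rw [h, pow_zero, mul_one])
    exact ⟨_, by omega, hg⟩) hcard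
  exact hc.concl (check16 _ (toNat_lt' _) _ (Nat.mod_lt _ (by norm_num)) _ (toNat_lt' _))

theorem quot_DC (hφ : Function.Surjective φ) (hk : ∀ g, φ g = 1 ↔ g = 1 ∨ g = n)
    (hn : n * n = 1) (hnc : ∀ g, n * g = g * n) (hQ : Coord Q 3 rowsDC 4) (hcard : Nat.card G = 32) :
    (∃ z : G, ZSq z) ∨ ¬ Filled G := by
  obtain ⟨z', l', hz, hz1, hzc, hR, hs, -⟩ := hQ
  rcases l' with _ | ⟨q1, _ | ⟨q2, _ | ⟨q3, _ | ⟨q4, l'⟩⟩⟩⟩ <;> try (simp [GRel, CommRel, rowsDC] at hR; done)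
  obtain ⟨a, rfl⟩ := hφ q1
  obtain ⟨y, rfl⟩ := hφ q2
  obtain ⟨e, rfl⟩ := hφ q3
  have z0 : Z1 z' 0 = 1 := rfl
  have z1 : Z1 z' 1 = z' := rfl
  simp only [GRel, CommRel, rowsDC, and_true, z0, z1, mul_one] at hR
  obtain ⟨ra, ⟨rya, rea⟩, ry, rey, ree⟩ := hR
  obtain ⟨w4, w3, hw⟩ := D_words ra ry hz hzc rya
  have rer : φ (e * (a * y)) = φ ((a * y) * e) := by
    simp only [map_mul]
    rw [← mul_assoc, rea, mul_assoc, rey, mul_assoc]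
  rw [← map_mul] at ra w4 w3 hw
  rw [← map_one φ] at ra
  rw [← map_pow, ← map_one φ] at w4
  rw [← map_pow, ← map_mul, ← map_mul] at w3
  rw [← map_mul, ← map_mul] at rea
  rw [← map_mul, ← map_one φ] at ree
  generalize a * y = r at *
  obtain ⟨ka, h4⟩ := lift_eq hk w4
  obtain ⟨al', h3⟩ := lift_eq hk w3
  obtain ⟨de, h2⟩ := lift_eq hk ra
  obtain ⟨be, h5⟩ := lift_eq hk rer
  obtain ⟨ga, h6⟩ := lift_eq hk rea
  obtain ⟨ep, h7⟩ := lift_eq hk ree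
  rw [ncond, one_mul] at h4 h2 h7
  rw [ncond] at h5 h6
  rw [ncond, par_al hn ka.toNat] at h3
  have H : CRel r n a e ka.toNat ((al'.toNat + ka.toNat) % 2) de.toNat be.toNat ga.toNat ep.toNat :=
    ⟨hn, hnc, h4, h3, h2, h5, h6, h7⟩
  have hc := H.code (N := 32) (Or.inr rfl) (by
    intro x hx y hy
    unfold mulc
    dsimp only
    omega) (by
    intro g
    obtain ⟨v, hv, t, h⟩ := hs (φ g)
    obtain ⟨i, hi, j, hj, hw⟩ := hw v t
    simp only [Pl, mul_one] at h
    have hcom : ∀ b : Bool, φ e ^ b.toNat * Z1 z' t = Z1 z' t * φ e ^ b.toNat := by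
      intro b; cases b
      · simp
      · unfold Z1; split_ifs <;> simp [hzc]
    have h3 : (if v / 2 / 2 % 2 = 1 then φ e else 1) = φ e ^ (decide (v / 2 / 2 % 2 = 1)).toNat := by
      split_ifs with h <;> simp [h]
    rw [h3, ← mul_assoc, mul_assoc, hcom, ← mul_assoc, hw] at h
    obtain ⟨b, hb, hg⟩ := E_lift hk (e := e) hi hj (toNat_lt' _) h
    have := toNat_lt' (decide (v / 2 / 2 % 2 = 1))
    exact ⟨_, by omega, hg⟩) hcard
  exact hc.concl (check32 _ (toNat_lt' _) _ (Nat.mod_lt _ (by norm_num)) _ (toNat_lt' _) _ (toNat_lt' _)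
    _ (toNat_lt' _) _ (toNat_lt' _))
end
end codemul

open Pointwise

section cyc
variable {G : Type*} [Group G]

lemma cyc_eq {g : G} {n : ℕ} (hn : orderOf g = n) {i j : ℕ} : g ^ i = g ^ j ↔ i % n = j % n := by
  rw [pow_eq_pow_iff_modEq, hn]; rfl

lemma not_filled_cyc4 {g : G} (ho : orderOf g = 4) (hs : ∀ x : G, ∃ i < 4, x = g ^ i) : ¬ Filled G := by
  intro hF
  have hpf : ProductFree ({g ^ 2} : Set G) := by
    rw [pf_iff]
    rintro _ rfl _ rfl
    rw [Set.mem_singleton_iff, ← pow_add, cyc_eq ho]; norm_num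
  have hLM : LocallyMaximalPF ({g ^ 2} : Set G) := by
    apply lm_of_blocked hpf
    intro h hh
    obtain ⟨i, hi, rfl⟩ := hs h
    simp only [Set.mem_singleton_iff, cyc_eq ho] at hh
    have : i = 0 ∨ i = 1 ∨ i = 3 := by omega
    rcases this with rfl | rfl | rfl
    · left; simp
    · right; right; right; right
      rw [← pow_add]; rfl
    · right; right; right; right
      rw [Set.mem_singleton_iff, ← pow_add, cyc_eq ho]
  have h1 : g ≠ 1 := by
    intro h; rw [h, orderOf_one] at ho; omega
  rcases hF _ hLM g h1 with h | ⟨_, rfl, _, rfl, h⟩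
  · rw [Set.mem_singleton_iff] at h
    nth_rw 1 [← pow_one g] at h
    rw [cyc_eq ho] at h
    omega
  · simp only at h
    nth_rw 3 [← pow_one g] at h
    rw [← pow_add, cyc_eq ho] at h
    omega

lemma not_filled_cyc6 {g : G} {n : ℕ} (h6 : 6 ≤ n) (ho : orderOf g = n) (hs : ∀ x : G, ∃ i < n, x = g ^ i) :
    ¬ Filled G := by
  intro hF
  obtain ⟨k, hk⟩ : ∃ k, k = n / 3 := ⟨_, rfl⟩
  have k2 : 2 ≤ k := by omega
  have k3 : 3 * k ≤ n := by omega
  have k4 : n ≤ 3 * k + 2 := by omega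
  clear hk
  let S : Set G := {x | ∃ i, k ≤ i ∧ i < 2 * k ∧ x = g ^ i}
  have hS : ∀ i < n, (g ^ i ∈ S ↔ k ≤ i ∧ i < 2 * k) := by
    intro i hi
    constructor
    · rintro ⟨j, h1, h2, h3⟩
      rw [cyc_eq ho, Nat.mod_eq_of_lt hi, Nat.mod_eq_of_lt (by omega)] at h3
      omega
    · rintro ⟨h1, h2⟩; exact ⟨i, h1, h2, rfl⟩
  have hred : ∀ i, n ≤ i → g ^ i = g ^ (i - n) := by
    intro i hi
    rw [cyc_eq ho]
    conv_lhs => rw [← Nat.sub_add_cancel hi, Nat.add_mod_right]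
  have hsum : ∀ i j, k ≤ i → i < 2 * k → k ≤ j → j < 2 * k → ∃ m < n, g ^ i * g ^ j = g ^ m ∧ (m + 1 < k ∨ 2 * k ≤ m) := by
    intro i j h1 h2 h3 h4
    by_cases h : i + j < n
    · exact ⟨i + j, h, by rw [pow_add], by omega⟩
    · exact ⟨i + j - n, by omega, by rw [← pow_add, hred _ (by omega)], by omega⟩
  have hpf : ProductFree S := by
    rw [pf_iff]
    rintro _ ⟨i, h1, h2, rfl⟩ _ ⟨j, h3, h4, rfl⟩
    obtain ⟨m, hm, h5, h6⟩ := hsum i j h1 h2 h3 h4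
    rw [h5, hS m hm]; omega
  have hLM : LocallyMaximalPF S := by
    apply lm_of_blocked hpf
    intro h hh
    obtain ⟨i, hi, rfl⟩ := hs h
    rw [hS i hi] at hh
    by_cases c1 : i < k
    · right; right; left
      exact ⟨g ^ k, ⟨k, by omega, by omega, rfl⟩, ⟨i + k, by omega, by omega, by rw [pow_add]⟩⟩
    · by_cases c2 : i + k ≤ n
      · right; left
        refine ⟨g ^ (i / 2), ⟨i / 2, by omega, by omega, rfl⟩, g ^ (i - i / 2), ⟨i - i / 2, by omega, by omega, rfl⟩, ?_⟩
        rw [← pow_add]; congr 1; omega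
      · right; right; left
        refine ⟨g ^ (2 * k - 1), ⟨2 * k - 1, by omega, by omega, rfl⟩, ⟨i + (2 * k - 1) - n, by omega, by omega, ?_⟩⟩
        rw [← pow_add, hred _ (by omega)]
  have h1 : g ^ (k - 1) ≠ 1 := by
    rw [← pow_zero g, Ne, cyc_eq ho, Nat.mod_eq_of_lt (by omega), Nat.mod_eq_of_lt (by omega)]
    omega
  rcases hF S hLM _ h1 with h | ⟨_, ⟨i, h1, h2, rfl⟩, _, ⟨j, h3, h4, rfl⟩, h⟩
  · rw [hS _ (by omega)] at h; omega
  · simp only at h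
    obtain ⟨m, hm, h5, h6⟩ := hsum i j h1 h2 h3 h4
    rw [h5, cyc_eq ho, Nat.mod_eq_of_lt hm, Nat.mod_eq_of_lt (by omega)] at h
    omega

theorem cyc_filled [Finite G] [IsCyclic G] (hF : Filled G) :
    Nat.card G = 1 ∨ Nat.card G = 2 ∨ Nat.card G = 3 ∨ Nat.card G = 5 := by
  obtain ⟨g, hg⟩ := IsCyclic.exists_ofOrder_eq_natCard (α := G)
  have hp : 0 < Nat.card G := Nat.card_pos
  have hs : ∀ x : G, ∃ i < Nat.card G, x = g ^ i := by
    intro x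
    have : Subgroup.zpowers g = ⊤ := by
      apply Subgroup.eq_top_of_card_eq
      rw [Nat.card_zpowers, hg]
    have hx : x ∈ Subgroup.zpowers g := by rw [this]; trivial
    rw [← mem_powers_iff_mem_zpowers] at hx
    obtain ⟨i, rfl⟩ := hx
    refine ⟨i % Nat.card G, Nat.mod_lt _ hp, ?_⟩
    simp only
    rw [cyc_eq hg, Nat.mod_mod]
  by_contra hcon
  by_cases h4 : Nat.card G = 4
  · rw [h4] at hg hs
    exact not_filled_cyc4 hg hs hF
  · exact not_filled_cyc6 (by omega) hg hs hF

def addc (p x y : ℕ) : ℕ := (x % p + y % p) % p + p * ((x / p + y / p) % p)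

lemma checkc3 : pCheck 9 (addc 3) [3, 4, 5] = true := by decide +kernel
lemma checkc5 : pCheck 25 (addc 5) [7, 12, 21, 22, 23] = true := by decide +kernel

/-- Elementary abelian of rank two, `p = 3` or `5`. -/
lemma not_filled_cpp {p : ℕ} (hp : p = 3 ∨ p = 5) {x y : G} (hx : x ^ p = 1) (hy : y ^ p = 1) (hxy : x * y = y * x)
    (hs : ∀ g, ∃ i < p, ∃ j < p, g = x ^ i * y ^ j) (hcard : Nat.card G = p * p) : ¬ Filled G := by
  have hmod : ∀ {u : G}, u ^ p = 1 → ∀ i, u ^ i = u ^ (i % p) := by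
    intro u hu i
    conv_lhs => rw [← Nat.div_add_mod i p, pow_add, pow_mul, hu, one_pow, one_mul]
  have hc : Commute x y := hxy
  have p0 : 0 < p := by omega
  have H : CodeG (fun v => x ^ (v % p) * y ^ (v / p)) (p * p) (addc p) := by
    refine ⟨?_, ?_, ?_, hcard, by simp, by rcases hp with rfl | rfl <;> norm_num⟩
    · intro a _ b _
      simp only [addc]
      rw [Nat.add_mul_mod_self_left, Nat.add_mul_div_left _ _ p0, Nat.mod_mod, Nat.div_eq_of_lt (Nat.mod_lt _ p0),
        zero_add, ← hmod hx (_ + _), ← hmod hy (_ + _), pow_add, pow_add]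
      have := (hc.pow_pow (b % p) (a / p)).eq
      calc x ^ (a % p) * y ^ (a / p) * (x ^ (b % p) * y ^ (b / p))
          = x ^ (a % p) * (y ^ (a / p) * x ^ (b % p)) * y ^ (b / p) := by group
        _ = _ := by rw [← this]; simp only [mul_assoc]
    · intro a _ b _
      unfold addc
      have h1 := Nat.mod_lt (a % p + b % p) p0
      have h2 := Nat.mod_lt (a / p + b / p) p0
      rcases hp with rfl | rfl <;> omega
    · intro g
      obtain ⟨i, hi, j, hj, rfl⟩ := hs g
      refine ⟨i + p * j, by rcases hp with rfl | rfl <;> omega, ?_⟩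
      rw [Nat.add_mul_mod_self_left, Nat.add_mul_div_left _ _ p0, Nat.mod_eq_of_lt hi, Nat.div_eq_of_lt hi, zero_add]
  have key : (∃ z : G, ZSq z) ∨ ¬ Filled G := by
    rcases hp with rfl | rfl
    · exact H.concl checkc3
    · exact H.concl checkc5
  rcases key with ⟨z, hz⟩ | h
  · exfalso
    have h2 : orderOf z = 2 := orderOf_eq_prime (by rw [pow_two, hz.hz]) hz.hz1
    have := orderOf_dvd_natCard z
    rw [h2, hcard] at this
    rcases hp with rfl | rfl <;> omega
  · exact h

/-- `G / N` cyclic of order 3 or 5 with `N` central of prime order: `G` is not filled. -/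
lemma not_filled_ext [Finite G] {Q : Type*} [Group Q] {φ : G →* Q} {n : G} {p q : ℕ} (hp : p.Prime)
    (hq : q = 3 ∨ q = 5)
    (hφ : Function.Surjective φ) (hk : ∀ g, φ g = 1 ↔ g ∈ Subgroup.zpowers n) (ho : orderOf n = p)
    (hnc : ∀ g, n * g = g * n) [IsCyclic Q] (hQ : Nat.card Q = q) (hcard : Nat.card G = Nat.card Q * p) :
    ¬ Filled G := by
  intro hF
  have hqp : q.Prime := by rcases hq with rfl | rfl <;> norm_num
  have hncyc : ¬ IsCyclic G := by
    intro _
    have := cyc_filled hF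
    rw [hcard, hQ] at this
    have := hp.two_le
    rcases hq with rfl | rfl <;> omega
  obtain ⟨y', hy'⟩ := IsCyclic.exists_ofOrder_eq_natCard (α := Q)
  obtain ⟨y, rfl⟩ := hφ y'
  rw [hQ] at hy'
  haveI : Finite Q := Nat.finite_of_card_ne_zero (by rw [hQ]; exact hqp.ne_zero)
  have hyo : q ∣ orderOf y := by rw [← hy']; exact orderOf_map_dvd φ y
  have hyq : y ^ q ∈ Subgroup.zpowers n := by
    rw [← hk, map_pow, ← hy', pow_orderOf_eq_one]
  have hcom : Commute n y := hnc y
  have h1 : y ^ q = 1 := by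
    by_contra hne
    apply hncyc
    apply isCyclic_of_orderOf_eq_card y
    have h1 : orderOf (y ^ q) = p := by
      have : orderOf (y ^ q) ∣ p := by
        obtain ⟨k, hk⟩ := hyq
        rw [← hk, ← ho]
        exact orderOf_dvd_of_mem_zpowers ⟨k, rfl⟩
      rcases (Nat.dvd_prime hp).1 this with h | h
      · exact absurd (orderOf_eq_one_iff.1 h) hne
      · exact h
    rw [orderOf_pow_of_dvd hqp.ne_zero hyo] at h1
    rw [hcard, hQ, ← h1, Nat.mul_div_cancel' hyo]
  have hyo' : orderOf y = q := Nat.dvd_antisymm (orderOf_dvd_of_pow_eq_one h1) hyo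
  by_cases hpq : p = q
  · subst hpq
    refine not_filled_cpp hq (x := y) (y := n) h1 (by rw [← ho, pow_orderOf_eq_one]) (hnc y).symm ?_ (by rw [hcard, hQ]) hF
    intro g
    have p0 := hp.pos
    have htop : Subgroup.zpowers (φ y) = ⊤ := by
      apply Subgroup.eq_top_of_card_eq
      rw [Nat.card_zpowers, hy', hQ]
    have hx : φ g ∈ Subgroup.zpowers (φ y) := by rw [htop]; trivial
    rw [← mem_powers_iff_mem_zpowers] at hx
    obtain ⟨i, hi⟩ := hx
    simp only at hi
    have : (y ^ i)⁻¹ * g ∈ Subgroup.zpowers n := by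
      rw [← hk, map_mul, map_inv, map_pow, hi, inv_mul_cancel]
    rw [← mem_powers_iff_mem_zpowers] at this
    obtain ⟨j, hj⟩ := this
    simp only at hj
    refine ⟨i % p, Nat.mod_lt _ p0, j % p, Nat.mod_lt _ p0, ?_⟩
    nth_rw 1 [← hyo']
    rw [pow_mod_orderOf]
    nth_rw 1 [← ho]
    rw [pow_mod_orderOf, hj]; group
  · apply hncyc
    apply isCyclic_of_orderOf_eq_card (n * y)
    rw [hcom.orderOf_mul_eq_mul_orderOf_of_coprime, ho, hyo', hcard, hQ, mul_comm]
    rw [ho, hyo']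
    exact (Nat.coprime_primes hp hqp).2 hpq

end cyc

open Pointwise

section final

set_option synthInstance.maxSize 2000 in
set_option synthInstance.maxHeartbeats 400000 in
lemma zc3 : ∀ S : Finset (ZMod 3), (∀ a ∈ S, ∀ b ∈ S, a + b ∉ S) →
    (∀ h, h ∉ S → h = 0 ∨ (∃ a ∈ S, ∃ b ∈ S, h = a + b) ∨ (∃ a ∈ S, h + a ∈ S) ∨ (∃ a ∈ S, a + h ∈ S) ∨ h + h ∈ S) →
    ∀ g, g ≠ 0 → g ∈ S ∨ ∃ a ∈ S, ∃ b ∈ S, g = a + b := by decide +kernel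

set_option synthInstance.maxSize 2000 in
set_option synthInstance.maxHeartbeats 400000 in
lemma zc5 : ∀ S : Finset (ZMod 5), (∀ a ∈ S, ∀ b ∈ S, a + b ∉ S) →
    (∀ h, h ∉ S → h = 0 ∨ (∃ a ∈ S, ∃ b ∈ S, h = a + b) ∨ (∃ a ∈ S, h + a ∈ S) ∨ (∃ a ∈ S, a + h ∈ S) ∨ h + h ∈ S) →
    ∀ g, g ≠ 0 → g ∈ S ∨ ∃ a ∈ S, ∃ b ∈ S, g = a + b := by decide +kernel

lemma filled_zmod {n : ℕ} [NeZero n] (hz : ∀ S : Finset (ZMod n), (∀ a ∈ S, ∀ b ∈ S, a + b ∉ S) →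
    (∀ h, h ∉ S → h = 0 ∨ (∃ a ∈ S, ∃ b ∈ S, h = a + b) ∨ (∃ a ∈ S, h + a ∈ S) ∨ (∃ a ∈ S, a + h ∈ S) ∨ h + h ∈ S) →
    ∀ g, g ≠ 0 → g ∈ S ∨ ∃ a ∈ S, ∃ b ∈ S, g = a + b) : Filled (Multiplicative (ZMod n)) := by
  classical
  intro S hS g hg
  let T : Finset (ZMod n) := Finset.univ.filter (fun x => Multiplicative.ofAdd x ∈ S)
  have hT : ∀ x, x ∈ T ↔ Multiplicative.ofAdd x ∈ S := fun x => by simp [T]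
  have h1 := (pf_iff S).1 hS.1
  have := hz T (by
    intro a ha b hb
    rw [hT] at *
    exact h1 _ ha _ hb) (by
    intro h hh
    rw [hT] at hh
    rcases lm_blocked hS _ hh with h | ⟨a, ha, b, hb, h⟩ | ⟨a, ha, h⟩ | ⟨a, ha, h⟩ | h
    · left; exact h
    · right; left; exact ⟨a.toAdd, (hT _).2 ha, b.toAdd, (hT _).2 hb, h⟩
    · right; right; left; exact ⟨a.toAdd, (hT _).2 ha, (hT _).2 h⟩
    · right; right; right; left; exact ⟨a.toAdd, (hT _).2 ha, (hT _).2 h⟩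
    · right; right; right; right; exact (hT _).2 h) g.toAdd hg
  rcases this with h | ⟨a, ha, b, hb, h⟩
  · left; exact (hT _).1 h
  · right; exact ⟨Multiplicative.ofAdd a, (hT _).1 ha, Multiplicative.ofAdd b, (hT _).1 hb, h.symm⟩

lemma filled_cyc35 {G : Type*} [Group G] [Finite G] [IsCyclic G] (h : Nat.card G = 3 ∨ Nat.card G = 5) : Filled G := by
  have e := zmodCyclicMulEquiv (G := G) inferInstance
  rcases h with h | h
  · rw [h] at e
    exact (filled_congr e).1 (filled_zmod zc3)
  · rw [h] at e
    exact (filled_congr e).1 (filled_zmod zc5)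

lemma exists_central {G : Type*} [Group G] [Finite G] (hnil : Group.IsNilpotent G) {p : ℕ} (hp : p.Prime)
    (hd : p ∣ Nat.card G) : ∃ n : G, orderOf n = p ∧ ∀ g, n * g = g * n := by
  classical
  haveI := Fact.mk hp
  have := (Group.isNilpotent_of_finite_tfae (G := G)).out 0 4
  obtain ⟨e⟩ := this.1 hnil
  let P : Sylow p G := default
  have hmem : p ∈ (Nat.card G).primeFactors := Nat.mem_primeFactors.2 ⟨hp, hd, Nat.card_pos.ne'⟩
  have hPd : p ∣ Nat.card P := P.dvd_card_of_dvd_card hd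
  haveI : Nontrivial P := by
    rw [← Finite.one_lt_card_iff_nontrivial]
    exact lt_of_lt_of_le hp.one_lt (Nat.le_of_dvd Nat.card_pos hPd)
  have hPp : IsPGroup p P := P.isPGroup'
  haveI := hPp.center_nontrivial
  have hcp : IsPGroup p (Subgroup.center P) := hPp.to_subgroup _
  obtain ⟨k, hk, hk2⟩ := hcp.nontrivial_iff_card.1 inferInstance
  obtain ⟨c, hc⟩ := exists_prime_orderOf_dvd_card' (G := Subgroup.center P) p (by rw [hk2]; exact dvd_pow_self p hk.ne')
  let p' : (Nat.card G).primeFactors := ⟨p, hmem⟩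
  let c1 : (∀ P : Sylow p' G, (↑P : Subgroup G)) := Pi.mulSingle (M := fun P : Sylow p' G => (↑P : Subgroup G)) P (c : P)
  let c2 : (∀ p : (Nat.card G).primeFactors, ∀ P : Sylow p G, (↑P : Subgroup G)) :=
    Pi.mulSingle (M := fun p : (Nat.card G).primeFactors => ∀ P : Sylow p G, (↑P : Subgroup G)) p' c1
  have ho : orderOf c2 = p := by
    have h1 : orderOf c2 = orderOf c1 :=
      orderOf_injective (MonoidHom.mulSingle (fun p : (Nat.card G).primeFactors => ∀ P : Sylow p G, (↑P : Subgroup G)) p')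
        (by intro a b h; exact Pi.mulSingle_injective (M := fun p : (Nat.card G).primeFactors => ∀ P : Sylow p G, (↑P : Subgroup G)) p' h) c1
    have h2 : orderOf c1 = orderOf (c : P) :=
      orderOf_injective (MonoidHom.mulSingle (fun P : Sylow p' G => (↑P : Subgroup G)) P)
        (by intro a b h; exact Pi.mulSingle_injective (M := fun P : Sylow p' G => (↑P : Subgroup G)) P h) (c : P)
    rw [h1, h2, Subgroup.orderOf_coe, hc]
  have hcc : ∀ x : P, (c : P) * x = x * c := fun x => (Subgroup.mem_center_iff.1 c.2 x).symm
  have hc1 : ∀ x, c1 * x = x * c1 := by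
    intro x
    funext R
    by_cases h : R = P
    · subst h
      simp only [Pi.mul_apply, c1, Pi.mulSingle_eq_same]
      exact hcc _
    · simp [c1, Pi.mulSingle_eq_of_ne h]
  have hc2 : ∀ x, c2 * x = x * c2 := by
    intro x
    funext R
    by_cases h : R = p'
    · subst h
      simp only [Pi.mul_apply, c2, Pi.mulSingle_eq_same]
      exact hc1 _
    · simp [c2, Pi.mulSingle_eq_of_ne h]
  refine ⟨e c2, by rw [MulEquiv.orderOf_eq, ho], ?_⟩
  intro g
  obtain ⟨x, rfl⟩ := e.surjective g
  rw [← map_mul, hc2, map_mul]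

universe u

lemma exists_quot {G : Type u} [Group G] [Finite G] (hnil : Group.IsNilpotent G) {n : G} {p : ℕ} (ho : orderOf n = p)
    (hnc : ∀ g, n * g = g * n) : ∃ (Q : Type u) (_ : Group Q) (_ : Finite Q) (φ : G →* Q),
      Group.IsNilpotent Q ∧ Function.Surjective φ ∧ (∀ g, φ g = 1 ↔ g ∈ Subgroup.zpowers n) ∧
      Nat.card G = Nat.card Q * p := by
  haveI : (Subgroup.zpowers n).Normal := by
    constructor
    rintro _ ⟨k, rfl⟩ g
    have : Commute n g := hnc g
    refine ⟨k, ?_⟩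
    simp only
    rw [← (this.zpow_left k).eq, mul_inv_cancel_right]
  refine ⟨G ⧸ Subgroup.zpowers n, inferInstance, inferInstance, QuotientGroup.mk' _, inferInstance,
    QuotientGroup.mk'_surjective _, ?_, ?_⟩
  · intro g; simp
  · rw [← ho, ← Nat.card_zpowers]
    exact Subgroup.card_eq_card_quotient_mul_card_subgroup _

lemma exists_quot2 {G : Type u} [Group G] [Finite G] (hnil : Group.IsNilpotent G) {n : G} (hn : n * n = 1) (hn1 : n ≠ 1)
    (hnc : ∀ g, n * g = g * n) : ∃ (Q : Type u) (_ : Group Q) (_ : Finite Q) (φ : G →* Q),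
      Group.IsNilpotent Q ∧ Function.Surjective φ ∧ (∀ g, φ g = 1 ↔ g = 1 ∨ g = n) ∧
      Nat.card G = Nat.card Q * 2 := by
  have ho : orderOf n = 2 := orderOf_eq_prime (by rw [pow_two, hn]) hn1
  obtain ⟨Q, i1, i2, φ, h1, h2, h3, h4⟩ := exists_quot hnil ho hnc
  refine ⟨Q, i1, i2, φ, h1, h2, ?_, h4⟩
  intro g
  rw [h3]
  constructor
  · intro h
    rw [← mem_powers_iff_mem_zpowers] at h
    obtain ⟨k, hk⟩ := h
    simp only at hk
    rw [← pow_mod_orderOf, ho] at hk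
    rcases (by omega : k % 2 = 0 ∨ k % 2 = 1) with h | h
    · left; rw [← hk, h, pow_zero]
    · right; rw [← hk, h, pow_one]
  · rintro (rfl | rfl)
    · exact one_mem _
    · exact Subgroup.mem_zpowers _

def FList (G : Type*) [Group G] : Prop :=
  (∀ g : G, g ^ 2 = 1) ∨ (IsCyclic G ∧ Nat.card G = 3) ∨
        (IsCyclic G ∧ Nat.card G = 5) ∨ Nonempty (G ≃* DihedralGroup 4) ∨
        Nonempty (G ≃* DihedralGroup 4 × Multiplicative (ZMod 2)) ∨
        Nonempty (G ≃* D8Q8) ∨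
        Nonempty (G ≃* D8Q8 × Multiplicative (ZMod 2))

lemma GRel_map {G Q : Type*} [Group G] [Group Q] (e : G →* Q) {Z : ℕ → G} {Z' : ℕ → Q} (hZ : ∀ k, e (Z k) = Z' k) :
    ∀ rows l, GRel Z rows l → GRel Z' rows (l.map e)
  | [], [], _ => trivial
  | (s, ks) :: rows, a :: l, ⟨h1, h2, h3⟩ => by
    refine ⟨by rw [← map_mul, h1, hZ], ?_, GRel_map e hZ rows l h3⟩
    have hc : ∀ ks l, CommRel Z a ks l → CommRel Z' (e a) ks (l.map e) := by
      intro ks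
      induction ks with
      | nil => intro l h; cases l <;> simp_all [CommRel]
      | cons k ks ih =>
        intro l h
        cases l with
        | nil => simp [CommRel] at h
        | cons b l => exact ⟨by rw [← map_mul, h.1, map_mul, map_mul, hZ], ih l h.2⟩
    exact hc ks l h2

lemma Coord.map {G Q : Type*} [Group G] [Group Q] (e : G ≃* Q) {m rows r} (h : Coord G m rows r) : Coord Q m rows r := by
  obtain ⟨z, l, hz, hz1, hzc, hR, hs, hr⟩ := h
  refine ⟨e z, l.map e, by rw [← map_mul, hz, map_one], by simpa using hz1, ?_, ?_, ?_, ?_⟩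
  · intro g
    obtain ⟨g, rfl⟩ := e.surjective g
    rw [← map_mul, hzc, map_mul]
  · exact GRel_map e.toMonoidHom (fun k => Z1_map e.toMonoidHom z k) rows l hR
  · intro g
    obtain ⟨g, rfl⟩ := e.surjective g
    obtain ⟨x, hx, t, h⟩ := hs g
    refine ⟨x, hx, t, ?_⟩
    conv_lhs => rw [h, map_mul]
    exact congrArg₂ _ (Pl_map e.toMonoidHom l x) (Z1_map e.toMonoidHom z t)
  · intro h0
    have h1 : e (Pl l r) = Pl (l.map e) r := Pl_map e.toMonoidHom l r
    rw [← h1]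
    exact ⟨by simpa using (hr h0).1, by simpa using (hr h0).2⟩

lemma ZSq.flist {G : Type*} [Group G] [Finite G] {z : G} (H : ZSq z) (hF : Filled G) : FList G := by
  by_cases h : ∃ w, w * w = z
  · obtain ⟨w, hw⟩ := h
    rcases H.classify hF hw with h | h | h | h
    · right; right; right; left; exact Coord.iso nd_D h coord_D8
    · right; right; right; right; left; exact Coord.iso nd_DC h coord_D8C
    · right; right; right; right; right; left; exact Coord.iso nd_H h coord_H
    · right; right; right; right; right; right; exact Coord.iso nd_HC h coord_HC
  · left
    intro g
    rcases H.sq g with h' | h'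
    · rw [pow_two, h']
    · exact absurd ⟨g, h'⟩ h

lemma FList.cards {Q : Type*} [Group Q] (h : FList Q) : (∀ g : Q, g ^ 2 = 1) ∨ (IsCyclic Q ∧ Nat.card Q = 3) ∨
    (IsCyclic Q ∧ Nat.card Q = 5) ∨ (Coord Q 2 rowsD 0 ∧ Nat.card Q = 8) ∨ (Coord Q 3 rowsDC 4 ∧ Nat.card Q = 16) ∨
    (Coord Q 4 rowsH 0 ∧ Nat.card Q = 32 ∧ Nat.card {g : Q // g * g = 1} = 12) ∨
    (Coord Q 5 rowsHC 16 ∧ Nat.card Q = 64 ∧ Nat.card {g : Q // g * g = 1} = 24) := by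
  have sqc : ∀ {R : Type} [Group R] (e : Q ≃* R), Nat.card {g : Q // g * g = 1} = Nat.card {g : R // g * g = 1} := by
    intro R _ e
    exact Nat.card_congr (e.toEquiv.subtypeEquiv (fun a => by
      show a * a = 1 ↔ e a * e a = 1
      rw [← map_mul, map_eq_one_iff e e.injective]))
  rcases h with h | h | h | ⟨⟨e⟩⟩ | ⟨⟨e⟩⟩ | ⟨⟨e⟩⟩ | ⟨⟨e⟩⟩
  · exact Or.inl h
  · exact Or.inr (Or.inl h)
  · exact Or.inr (Or.inr (Or.inl h))
  · exact Or.inr (Or.inr (Or.inr (Or.inl ⟨coord_D8.map e.symm, by rw [Nat.card_congr e.toEquiv, count_D]⟩)))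
  · exact Or.inr (Or.inr (Or.inr (Or.inr (Or.inl ⟨coord_D8C.map e.symm, by rw [Nat.card_congr e.toEquiv, count_DC]⟩))))
  · exact Or.inr (Or.inr (Or.inr (Or.inr (Or.inr (Or.inl ⟨coord_H.map e.symm,
      by rw [Nat.card_congr e.toEquiv, count_H.1], by rw [sqc e, count_H.2]⟩)))))
  · exact Or.inr (Or.inr (Or.inr (Or.inr (Or.inr (Or.inr ⟨coord_HC.map e.symm,
      by rw [Nat.card_congr e.toEquiv, count_HC.1], by rw [sqc e, count_HC.2]⟩)))))

lemma exp2_card {Q : Type*} [Group Q] [Finite Q] (h : ∀ g : Q, g ^ 2 = 1) (hodd : ¬ 2 ∣ Nat.card Q) : Nat.card Q = 1 := by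
  rw [Nat.card_eq_one_iff_unique]
  refine ⟨⟨fun a b => ?_⟩, ⟨1⟩⟩
  have : ∀ a : Q, a = 1 := by
    intro a
    by_contra ha
    have := orderOf_eq_prime (h a) ha
    exact hodd (this ▸ orderOf_dvd_natCard a)
  rw [this a, this b]

/-- An involution `c` in a filled group with induction hypothesis: count of square roots. -/
lemma count_quot {G : Type u} [Group G] [Finite G] (hnil : Group.IsNilpotent G) (hF : Filled G)
    (IH : ∀ (Q : Type u) [Group Q] [Finite Q], Group.IsNilpotent Q → Filled Q → Nat.card Q < Nat.card G → FList Q)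
    {c : G} (hc : c * c = 1) (hc1 : c ≠ 1) (hcc : ∀ g, c * g = g * c) :
    FList G ∨ (Nat.card G = 64 → Nat.card {g : G // g * g = 1 ∨ g * g = c} = 24) ∧
      (Nat.card G = 128 → Nat.card {g : G // g * g = 1 ∨ g * g = c} = 48) := by
  obtain ⟨Q, _, _, φ, hQn, hφ, hk, hcard⟩ := exists_quot2 hnil hc hc1 hcc
  have hpos : 0 < Nat.card Q := Nat.card_pos
  have hQ := (IH Q hQn (filled_of_surj φ hφ hF) (by omega)).cards
  have hcnt := card_fiber φ hφ hc1 hk (fun q => q * q = 1)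
  simp only [← map_mul, hk] at hcnt
  rcases hQ with h | h | h | h | h | h | h
  · left
    refine ZSq.flist (z := c) ⟨hc, hc1, hcc, fun g => ?_⟩ hF
    rw [← hk, map_mul, ← pow_two, h]
  · right; omega
  · right; omega
  · right; omega
  · right; omega
  · right; omega
  · right; omega

theorem main_neg (N : ℕ) : ∀ (G : Type u) [Group G] [Finite G], Group.IsNilpotent G → Filled G → Nat.card G = N → FList G := by
  induction N using Nat.strong_induction_on with
  | _ N IH' =>
  intro G _ _ hnil hF hN
  have IH : ∀ (Q : Type u) [Group Q] [Finite Q], Group.IsNilpotent Q → Filled Q → Nat.card Q < Nat.card G → FList Q := by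
    intro Q _ _ h1 h2 h3
    exact IH' _ (hN ▸ h3) Q h1 h2 rfl
  clear IH' hN N
  by_cases h2 : 2 ∣ Nat.card G
  · obtain ⟨n, ho, hnc⟩ := exists_central hnil Nat.prime_two h2
    have hn : n * n = 1 := by rw [← pow_two, ← ho, pow_orderOf_eq_one]
    have hn1 : n ≠ 1 := by rintro rfl; simp at ho
    obtain ⟨Q, _, _, φ, hQn, hφ, hk, hcard⟩ := exists_quot2 hnil hn hn1 hnc
    have hpos : 0 < Nat.card Q := Nat.card_pos
    have hQ := (IH Q hQn (filled_of_surj φ hφ hF) (by omega)).cards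
    have hk' : ∀ g, φ g = 1 ↔ g ∈ Subgroup.zpowers n := by
      intro g
      constructor
      · intro h
        rcases (hk g).1 h with rfl | rfl
        · exact one_mem _
        · exact Subgroup.mem_zpowers _
      · rintro ⟨k, rfl⟩
        simp only
        rw [map_zpow, (hk n).2 (Or.inr rfl), one_zpow]
    rcases hQ with h | ⟨h, h'⟩ | ⟨h, h'⟩ | ⟨h, h'⟩ | ⟨h, h'⟩ | ⟨h, h', -⟩ | ⟨h, h', -⟩
    · refine ZSq.flist (z := n) ⟨hn, hn1, hnc, fun g => ?_⟩ hF
      rw [← hk, map_mul, ← pow_two, h]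
    · exact absurd hF (not_filled_ext Nat.prime_two (Or.inl rfl) hφ hk' ho hnc h' hcard)
    · exact absurd hF (not_filled_ext Nat.prime_two (Or.inr rfl) hφ hk' ho hnc h' hcard)
    · rcases quot_D hφ hk hn hnc h (by omega) with ⟨z, hz⟩ | h
      · exact hz.flist hF
      · exact absurd hF h
    · rcases quot_DC hφ hk hn hnc h (by omega) with ⟨z, hz⟩ | h
      · exact hz.flist hF
      · exact absurd hF h
    · obtain ⟨c, b, l, H⟩ := two4 hφ hk hn hnc h (by omega)
      have hc1 : c ≠ 1 := fun h => by have := H.Zinj (e := 1) (f := 0) (by simp [Z2, h]); omega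
      have hcn1 : c * n ≠ 1 := fun h => by have := H.Zinj (e := 3) (f := 0) (by simp [Z2, h]); omega
      have hcnc : ∀ g, c * n * g = g * (c * n) := fun g => by
        rw [mul_assoc, H.hnc, ← mul_assoc, H.hcc, mul_assoc]
      have hcn : c * n * (c * n) = 1 := by
        rw [hcnc, ← mul_assoc, mul_assoc c n c, H.hnc c, ← mul_assoc, H.hc, one_mul, H.hn]
      rcases count_quot hnil hF IH H.hc hc1 H.hcc with h | h
      · exact h
      rcases count_quot hnil hF IH hcn hcn1 hcnc with h' | h'
      · exact h'
      exact absurd hF (notFilled4 H (h.1 (by omega)) (h'.1 (by omega)))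
    · obtain ⟨c, b, l, H⟩ := two5 hφ hk hn hnc h (by omega)
      have hc1 : c ≠ 1 := fun h => by have := H.Zinj (e := 1) (f := 0) (by simp [Z2, h]); omega
      have hcn1 : c * n ≠ 1 := fun h => by have := H.Zinj (e := 3) (f := 0) (by simp [Z2, h]); omega
      have hcnc : ∀ g, c * n * g = g * (c * n) := fun g => by
        rw [mul_assoc, H.hnc, ← mul_assoc, H.hcc, mul_assoc]
      have hcn : c * n * (c * n) = 1 := by
        rw [hcnc, ← mul_assoc, mul_assoc c n c, H.hnc c, ← mul_assoc, H.hc, one_mul, H.hn]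
      rcases count_quot hnil hF IH H.hc hc1 H.hcc with h | h
      · exact h
      rcases count_quot hnil hF IH hcn hcn1 hcnc with h' | h'
      · exact h'
      exact absurd hF (notFilled5 H (h.2 (by omega)) (h'.2 (by omega)))
  · by_cases h1 : Nat.card G = 1
    · left
      have := (Nat.card_eq_one_iff_unique.1 h1).1
      intro g; exact Subsingleton.elim _ _
    obtain ⟨p, hp, hd⟩ := Nat.exists_prime_and_dvd h1
    obtain ⟨n, ho, hnc⟩ := exists_central hnil hp hd
    obtain ⟨Q, _, _, φ, hQn, hφ, hk, hcard⟩ := exists_quot hnil ho hnc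
    have hpos : 0 < Nat.card Q := Nat.card_pos
    have hlt : Nat.card Q < Nat.card G := by
      rw [hcard]; exact lt_mul_of_one_lt_right hpos hp.one_lt
    have hodd : ¬ 2 ∣ Nat.card Q := fun h => h2 (hcard ▸ h.mul_right p)
    have hQ := (IH Q hQn (filled_of_surj φ hφ hF) hlt).cards
    rcases hQ with h | ⟨h, h'⟩ | ⟨h, h'⟩ | ⟨h, h'⟩ | ⟨h, h'⟩ | ⟨h, h', -⟩ | ⟨h, h', -⟩
    · have hQ1 := exp2_card h hodd
      rw [hQ1, one_mul] at hcard
      have hcyc : IsCyclic G := isCyclic_of_orderOf_eq_card n (by rw [ho, hcard])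
      rcases cyc_filled hF with h | h | h | h
      · exact absurd h h1
      · omega
      · exact Or.inr (Or.inl ⟨hcyc, h⟩)
      · exact Or.inr (Or.inr (Or.inl ⟨hcyc, h⟩))
    · exact absurd hF (not_filled_ext hp (Or.inl rfl) hφ hk ho hnc h' hcard)
    · exact absurd hF (not_filled_ext hp (Or.inr rfl) hφ hk ho hnc h' hcard)
    all_goals omega

lemma main_pos {G : Type*} [Group G] [Finite G] (h : FList G) : Filled G := by
  rcases h with h | ⟨h, h'⟩ | ⟨h, h'⟩ | ⟨⟨e⟩⟩ | ⟨⟨e⟩⟩ | ⟨⟨e⟩⟩ | ⟨⟨e⟩⟩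
  · exact filled_exp2 h
  · exact filled_cyc35 (Or.inl h')
  · exact filled_cyc35 (Or.inr h')
  · exact (filled_congr e).2 filled_D
  · exact (filled_congr e).2 filled_DC
  · exact (filled_congr e).2 filled_H
  · exact (filled_congr e).2 filled_HC

end final

theorem nilpotent_filled_iff {G : Type*} [Group G] [Finite G]
    (hnil : Group.IsNilpotent G) :
    Filled G ↔
      (∀ g : G, g ^ 2 = 1) ∨ (IsCyclic G ∧ Nat.card G = 3) ∨
        (IsCyclic G ∧ Nat.card G = 5) ∨ Nonempty (G ≃* DihedralGroup 4) ∨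
        Nonempty (G ≃* DihedralGroup 4 × Multiplicative (ZMod 2)) ∨
        Nonempty (G ≃* D8Q8) ∨
        Nonempty (G ≃* D8Q8 × Multiplicative (ZMod 2)) := by
  exact ⟨fun h => main_neg _ G hnil h rfl, fun h => main_pos h⟩
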